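/- arXiv:1708.06576 — 3 statements merged into one kernel-verified Lean document; each statement's English description precedes it below -/
import Mathlib

section
/- If Γ is a graph of girth at least 5 on 20 vertices with 41 edges, then δ(Γ) = 3, Δ(Γ) = 5, and Γ has an embedded S_{5,[3,3,3,3,2]} star; that is, Γ has a vertex of degree 5 with four neighbours of degree at least 4 and a fifth neighbour of degree at least 3. -/
open SimpleGraph

/-- `Γ` has girth at least 5: every cycle has length at least 5. -/
def GirthAtLeast5 {V : Type*} (G : SimpleGraph V) : Prop :=
  ∀ ⦃u : V⦄ (w : G.Walk u u), w.IsCycle → 5 ≤ w.length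

/-- `G` has an embedded `S_{D,[e 0, …, e (D-1)]}` star: a vertex `x` of degree `D`
whose `D` neighbours can be enumerated as `y 0, …, y (D-1)` with
`deg (y i) ≥ e i + 1` for each `i`. -/
def HasEmbeddedStar {V : Type*} [Fintype V] (G : SimpleGraph V) [DecidableRel G.Adj]
    (D : ℕ) (e : Fin D → ℕ) : Prop :=
  ∃ (x : V) (y : Fin D → V), G.degree x = D ∧ Function.Injective y ∧
    (∀ i, G.Adj x (y i)) ∧ ∀ i, e i + 1 ≤ G.degree (y i)


section Helpers

set_option linter.unusedSectionVars false

variable {V : Type*} [DecidableEq V] (G : SimpleGraph V) [DecidableRel G.Adj]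

structure Good {V : Type*} (G : SimpleGraph V) : Prop where
  tri : ∀ a b c, G.Adj a b → G.Adj b c → G.Adj a c → False
  c4 : ∀ a b c d, a ≠ b → G.Adj a c → G.Adj b c → G.Adj a d → G.Adj b d → c = d

def nb (A : Finset V) (v : V) : Finset V := A.filter (G.Adj v)

def dg (A : Finset V) (v : V) : ℕ := (nb G A v).card

def sg (A : Finset V) : ℕ := ∑ v ∈ A, dg G A v

lemma mem_nb {A : Finset V} {v w : V} : w ∈ nb G A v ↔ w ∈ A ∧ G.Adj v w := by
  simp [nb]

lemma dg_sum (A : Finset V) (v : V) : dg G A v = ∑ w ∈ A, if G.Adj v w then 1 else 0 := by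
  simp [dg, nb]

lemma dg_double (A B : Finset V) : ∑ x ∈ A, dg G B x = ∑ x ∈ B, dg G A x := by
  simp_rw [dg_sum]
  rw [Finset.sum_comm]
  simp_rw [G.adj_comm]

lemma dg_erase {A : Finset V} {v : V} (hv : v ∈ A) (w : V) :
    dg G A w = dg G (A.erase v) w + if G.Adj w v then 1 else 0 := by
  rw [dg_sum, dg_sum, Finset.sum_erase_add _ _ hv]

lemma dg_erase_adj {A : Finset V} {v : V} (hv : v ∈ A) {w : V} (h : G.Adj w v) :
    dg G A w = dg G (A.erase v) w + 1 := by
  rw [dg_erase G hv, if_pos h]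

lemma dg_erase_nadj {A : Finset V} {v : V} (hv : v ∈ A) {w : V} (h : ¬ G.Adj w v) :
    dg G A w = dg G (A.erase v) w := by
  rw [dg_erase G hv, if_neg h, add_zero]

lemma sg_erase {A : Finset V} {v : V} (hv : v ∈ A) :
    sg G A = sg G (A.erase v) + 2 * dg G A v := by
  have h1 : sg G A = ∑ w ∈ A, dg G (A.erase v) w + dg G A v := by
    unfold sg
    rw [dg_sum G A v, ← Finset.sum_add_distrib]
    refine Finset.sum_congr rfl fun w _ => ?_
    rw [dg_erase G hv w]
    simp_rw [G.adj_comm]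
  rw [h1, ← Finset.sum_erase_add _ _ hv, ← dg_erase_nadj G hv (G.loopless.irrefl v)]
  unfold sg
  ring

lemma sg_even (A : Finset V) : Even (sg G A) := by
  induction A using Finset.induction_on with
  | empty => simp [sg]
  | insert a s ha ih =>
    rw [sg_erase G (Finset.mem_insert_self a s), Finset.erase_insert ha]
    exact ih.add (even_two_mul _)

variable {G}

/-- the basic disjointness lemma -/
lemma star_le (hG : Good G) {B X : Finset V} {v : V} (hv : v ∉ B) (hX : ∀ x ∈ X, G.Adj v x) :
    ∑ x ∈ X, dg G B x + dg G B v ≤ B.card := by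
  have hd : ∀ x ∈ X, ∀ y ∈ X, x ≠ y → Disjoint (nb G B x) (nb G B y) := by
    intro x hx y hy hxy
    rw [Finset.disjoint_left]
    intro z hz hz'
    rw [mem_nb] at hz hz'
    have := hG.c4 x y v z hxy (hX x hx).symm (hX y hy).symm hz.2 hz'.2
    exact hv (this ▸ hz.1)
  have h1 : ∑ x ∈ X, dg G B x = (X.biUnion (nb G B)).card := (Finset.card_biUnion hd).symm
  have h2 : Disjoint (X.biUnion (nb G B)) (nb G B v) := by
    rw [Finset.disjoint_left]
    intro z hz hz'
    rw [Finset.mem_biUnion] at hz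
    obtain ⟨x, hx, hz⟩ := hz
    rw [mem_nb] at hz hz'
    exact hG.tri v x z (hX x hx) hz.2 hz'.2
  rw [h1, dg, ← Finset.card_union_of_disjoint h2]
  apply Finset.card_le_card
  intro z hz
  rw [Finset.mem_union, Finset.mem_biUnion] at hz
  rcases hz with ⟨x, _, hz⟩ | hz
  · exact ((mem_nb G).1 hz).1
  · exact ((mem_nb G).1 hz).1

lemma ball (hG : Good G) {A : Finset V} {v : V} (hv : v ∈ A) :
    ∑ x ∈ nb G A v, dg G A x + 1 ≤ A.card := by
  have h := star_le hG (B := A.erase v) (X := nb G A v) (v := v) (by simp)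
    (fun x hx => ((mem_nb G).1 hx).2)
  have h2 : ∑ x ∈ nb G A v, dg G A x = ∑ x ∈ nb G A v, dg G (A.erase v) x + dg G A v := by
    rw [dg, Finset.card_eq_sum_ones, ← Finset.sum_add_distrib]
    exact Finset.sum_congr rfl fun x hx => dg_erase_adj G hv ((mem_nb G).1 hx).2.symm
  rw [← dg_erase_nadj G hv (G.loopless.irrefl v)] at h
  rw [Finset.card_erase_of_mem hv] at h
  have := Finset.card_pos.2 ⟨v, hv⟩
  omega

lemma ball_min (hG : Good G) {A : Finset V} {v : V} (hv : v ∈ A) {k : ℕ}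
    (hk : ∀ x ∈ A, k ≤ dg G A x) : dg G A v * k + 1 ≤ A.card := by
  have h := ball hG hv
  have := Finset.card_nsmul_le_sum (nb G A v) (dg G A) k
    (fun x hx => hk x ((mem_nb G).1 hx).1)
  rw [smul_eq_mul] at this
  unfold dg at *
  omega

lemma exists_min {A : Finset V} (hA : A.Nonempty) :
    ∃ v ∈ A, ∀ x ∈ A, dg G A v ≤ dg G A x := Finset.exists_min_image A (dg G A) hA

lemma min_sum {A : Finset V} {k : ℕ} (hk : ∀ x ∈ A, k ≤ dg G A x) : A.card * k ≤ sg G A := by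
  have := Finset.card_nsmul_le_sum A (dg G A) k hk
  rw [smul_eq_mul] at this
  exact this

lemma exists_gt {A : Finset V} {k : ℕ} (h : A.card * k < sg G A) : ∃ v ∈ A, k + 1 ≤ dg G A v := by
  by_contra! hc
  have := Finset.sum_le_card_nsmul A (dg G A) k (fun x hx => by have := hc x hx; omega)
  rw [smul_eq_mul] at this
  exact absurd h (not_lt.2 this)

lemma all_eq {A : Finset V} {k : ℕ} (hk : ∀ x ∈ A, k ≤ dg G A x) (h : sg G A ≤ A.card * k) :
    ∀ x ∈ A, dg G A x = k := by
  have h1 : ∑ x ∈ A, k = ∑ x ∈ A, dg G A x := by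
    apply le_antisymm (Finset.sum_le_sum hk)
    rw [Finset.sum_const, smul_eq_mul]
    exact h
  intro x hx
  exact ((Finset.sum_eq_sum_iff_of_le hk).1 h1 x hx).symm

/-- extremal bound -/
def Bd (G : SimpleGraph V) [DecidableRel G.Adj] (n f : ℕ) : Prop :=
  ∀ A : Finset V, A.card = n → sg G A ≤ 2 * f

lemma Bd.erase {n f : ℕ} (h : Bd G n f) {A : Finset V} (hA : A.card = n + 1) {v : V} (hv : v ∈ A) :
    sg G A ≤ 2 * f + 2 * dg G A v := by
  rw [sg_erase G hv]
  have := h (A.erase v) (by rw [Finset.card_erase_of_mem hv, hA]; rfl)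
  omega

/-- minimum degree vertex data -/
lemma min_data (hG : Good G) {n f D : ℕ} (h : Bd G n f) (hD : n < (D + 1) * (D + 1))
    {A : Finset V} (hA : A.card = n + 1) :
    ∃ v ∈ A, (∀ x ∈ A, dg G A v ≤ dg G A x) ∧ dg G A v ≤ D ∧ sg G A ≤ 2 * f + 2 * dg G A v := by
  obtain ⟨v, hv, hm⟩ := exists_min (G := G) (A := A) (Finset.card_pos.1 (by omega))
  refine ⟨v, hv, hm, ?_, h.erase hA hv⟩
  by_contra hc
  have := ball_min hG hv hm
  have : (D + 1) * (D + 1) ≤ dg G A v * dg G A v := Nat.mul_le_mul (by omega) (by omega)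
  omega

lemma Bd.step (hG : Good G) {n f : ℕ} (D : ℕ) (h : Bd G n f) (hD : n < (D + 1) * (D + 1)) :
    Bd G (n + 1) (f + D) := by
  intro A hA
  obtain ⟨v, hv, _, h1, h2⟩ := min_data hG h hD hA
  omega

lemma Bd.step' (hG : Good G) {n f : ℕ} (D : ℕ) (h : Bd G n f) (hD : n < (D + 1) * D)
    (hb : (n + 1) * D < 2 * (f + D)) :
    Bd G (n + 1) (f + D - 1) := by
  intro A hA
  obtain ⟨v, hv, hm, h1, h2⟩ := min_data (D := D) hG h (by nlinarith) hA
  by_contra hc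
  obtain ⟨c, hc2⟩ := sg_even G A
  have h3 : sg G A = 2 * (f + D) := by omega
  have h4 : dg G A v = D := by omega
  obtain ⟨x, hx, hx'⟩ := exists_gt (G := G) (A := A) (k := D) (by rw [hA]; omega)
  rw [h4] at hm
  have h5 := ball_min hG hx hm
  have : (D + 1) * D ≤ dg G A x * D := Nat.mul_le_mul hx' le_rfl
  omega

lemma bd1 : Bd G 1 0 := by
  intro A hA
  obtain ⟨a, rfl⟩ := Finset.card_eq_one.1 hA
  simp [sg, dg, nb, Finset.filter_singleton]

lemma bd10 (hG : Good G) : Bd G 9 12 ∧ Bd G 10 15 := by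
  have h2 : Bd G 2 1 := bd1.step hG 1 (by norm_num)
  have h3 : Bd G 3 2 := h2.step hG 1 (by norm_num)
  have h4 : Bd G 4 3 := h3.step hG 1 (by norm_num)
  have h5 : Bd G 5 5 := h4.step hG 2 (by norm_num)
  have h6 : Bd G 6 6 := h5.step' hG 2 (by norm_num) (by norm_num)
  have h7 : Bd G 7 8 := h6.step hG 2 (by norm_num)
  have h8 : Bd G 8 10 := h7.step hG 2 (by norm_num)
  have h9 : Bd G 9 12 := h8.step hG 2 (by norm_num)
  exact ⟨h9, h9.step hG 3 (by norm_num)⟩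

lemma bd11 (hG : Good G) : Bd G 11 16 := by
  obtain ⟨h9, h10⟩ := bd10 hG
  intro A hA
  obtain ⟨v, hv, hm, h1, h2⟩ := min_data (D := 3) hG h10 (by norm_num) hA
  by_contra hc
  obtain ⟨c, hc2⟩ := sg_even G A
  obtain ⟨x, hx, hx'⟩ := exists_gt (G := G) (A := A) (k := 3) (by rw [hA]; omega)
  have hv2 : dg G A v = 2 := by
    by_contra hne
    have h5 := ball_min hG hx (k := 3) (fun y hy => by have := hm y hy; omega)
    omega
  have hH : (A.erase v).card = 10 := by rw [Finset.card_erase_of_mem hv, hA]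
  have hs := sg_erase G hv
  have h3 : ∀ y ∈ A.erase v, 3 ≤ dg G (A.erase v) y := by
    intro y hy
    have := h9.erase hH hy
    omega
  have h3' := all_eq h3 (by omega)
  obtain ⟨y, hy⟩ : (nb G A v).Nonempty := Finset.card_pos.1 (by unfold dg at hv2; omega)
  rw [mem_nb] at hy
  have hyv : y ≠ v := hy.2.ne'
  have hdy := dg_erase_adj G hv hy.2.symm
  rw [h3' y (Finset.mem_erase.2 ⟨hyv, hy.1⟩)] at hdy
  have hb := ball hG hy.1
  have hvy : v ∈ nb G A y := (mem_nb G).2 ⟨hv, hy.2.symm⟩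
  rw [← Finset.sum_erase_add _ _ hvy] at hb
  have := Finset.card_nsmul_le_sum ((nb G A y).erase v) (dg G A) 3 (by
    intro z hz
    rw [Finset.mem_erase, mem_nb] at hz
    have h6 := h3 z (Finset.mem_erase.2 ⟨hz.1, hz.2.1⟩)
    have h7 := dg_erase G hv z
    omega)
  rw [Finset.card_erase_of_mem hvy, smul_eq_mul] at this
  unfold dg at *
  omega

lemma bd13 (hG : Good G) : Bd G 12 18 ∧ Bd G 13 21 := by
  have h12 : Bd G 12 18 := (bd11 hG).step' hG 3 (by norm_num) (by norm_num)
  exact ⟨h12, h12.step hG 3 (by norm_num)⟩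

lemma adj3 {n f : ℕ} (h : Bd G n f) {A : Finset V} (hA : A.card = n + 2)
    (hs : 2 * f + 10 < sg G A) {x y : V} (hx : x ∈ A) (hy : y ∈ A) (hx3 : dg G A x = 3)
    (hy3 : dg G A y = 3) : ¬ G.Adj x y := by
  intro hxy
  have h1 := sg_erase G hx
  have hy' : y ∈ A.erase x := Finset.mem_erase.2 ⟨hxy.ne', hy⟩
  have h2 := h.erase (A := A.erase x) (by rw [Finset.card_erase_of_mem hx, hA]; rfl) hy'
  have h3 := dg_erase_adj G hx hxy.symm
  omega

/-- structure: degrees 3 and 4 partition -/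
lemma part34 {A : Finset V} (h : ∀ x ∈ A, dg G A x = 3 ∨ dg G A x = 4) :
    ∃ S F : Finset V, S ∪ F = A ∧ Disjoint S F ∧ (∀ x ∈ S, x ∈ A ∧ dg G A x = 3) ∧
      (∀ x ∈ F, x ∈ A ∧ dg G A x = 4) ∧ S.card + F.card = A.card ∧
      3 * S.card + 4 * F.card = sg G A ∧ ∀ x, dg G A x = dg G S x + dg G F x := by
  let S := A.filter (fun x => dg G A x = 3)
  let F := A.filter (fun x => dg G A x = 4)
  have hSF : S ∪ F = A := by
    ext x
    simp only [S, F, Finset.mem_union, Finset.mem_filter]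
    have := h x
    tauto
  have hd : Disjoint S F := by
    rw [Finset.disjoint_left]
    intro x hx hx'
    simp only [S, F, Finset.mem_filter] at hx hx'
    omega
  have hS : ∀ x ∈ S, x ∈ A ∧ dg G A x = 3 := fun x hx => Finset.mem_filter.1 hx
  have hF : ∀ x ∈ F, x ∈ A ∧ dg G A x = 4 := fun x hx => Finset.mem_filter.1 hx
  refine ⟨S, F, hSF, hd, hS, hF, ?_, ?_, ?_⟩
  · rw [← Finset.card_union_of_disjoint hd, hSF]
  · have : sg G A = ∑ x ∈ S, dg G A x + ∑ x ∈ F, dg G A x := by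
      rw [← Finset.sum_union hd, hSF]; rfl
    rw [this, Finset.sum_congr rfl (fun x hx => (hS x hx).2),
      Finset.sum_congr rfl (fun x hx => (hF x hx).2)]
    simp [mul_comm]
  · intro x
    simp_rw [dg_sum]
    rw [← Finset.sum_union hd, hSF]

lemma dg_zero {A : Finset V} {v : V} (h : ∀ x ∈ A, ¬ G.Adj v x) : dg G A v = 0 := by
  rw [dg, Finset.card_eq_zero, nb, Finset.filter_eq_empty_iff]
  exact fun x hx => h x hx

lemma bd14 (hG : Good G) : Bd G 14 23 := by
  obtain ⟨h12, h13⟩ := bd13 hG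
  intro A hA
  obtain ⟨v, hv, hm, h1, h2⟩ := min_data (D := 3) hG h13 (by norm_num) hA
  by_contra hc
  obtain ⟨c, hc2⟩ := sg_even G A
  have hs : sg G A = 48 := by omega
  have hv3 : dg G A v = 3 := by omega
  rw [hv3] at hm
  have h34 : ∀ x ∈ A, dg G A x = 3 ∨ dg G A x = 4 := by
    intro x hx
    have := ball_min hG hx hm
    have := hm x hx
    omega
  obtain ⟨S, F, hSF, hd, hS, hF, hc1, hc3, hdg⟩ := part34 h34
  have hSS : ∀ x ∈ S, dg G S x = 0 := fun x hx => dg_zero fun y hy =>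
    adj3 h12 hA (by omega) (hS x hx).1 (hS y hy).1 (hS x hx).2 (hS y hy).2
  have hSF3 : ∀ x ∈ S, dg G F x = 3 := fun x hx => by
    have := hSS x hx
    have := hdg x
    have := (hS x hx).2
    omega
  have hdc := dg_double G S F
  rw [Finset.sum_congr rfl hSF3, Finset.sum_const, smul_eq_mul] at hdc
  have hF4 : ∀ x ∈ F, dg G S x ≤ 4 := fun x hx => by
    have := hdg x
    have := (hF x hx).2
    omega
  have hF4' : ∀ x ∈ F, dg G S x = 4 := by
    apply (Finset.sum_eq_sum_iff_of_le hF4).1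
    rw [← hdc]
    simp
    omega
  obtain ⟨w, hw⟩ : F.Nonempty := Finset.card_pos.1 (by omega)
  have hst := star_le hG (B := F.erase w) (X := nb G S w) (v := w) (by simp)
    (fun x hx => ((mem_nb G).1 hx).2)
  rw [Finset.sum_congr rfl (g := fun _ => 2) (fun x hx => by
    rw [mem_nb] at hx
    have := dg_erase_adj G hw hx.2.symm
    have := hSF3 x hx.1
    omega), Finset.card_erase_of_mem hw] at hst
  have := hF4' w hw
  unfold dg at this
  simp [this] at hst
  omega

lemma bd15 (hG : Good G) : Bd G 15 26 := (bd14 hG).step hG 3 (by norm_num)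

lemma dj_adj (hG : Good G) {S : Finset V} {u v : V} (h : G.Adj u v) :
    Disjoint (nb G S u) (nb G S v) := by
  rw [Finset.disjoint_left]
  intro z hz hz'
  rw [mem_nb] at hz hz'
  exact hG.tri u v z h hz'.2 hz.2

lemma dj_two (hG : Good G) {S : Finset V} {u v c : V} (huv : u ≠ v) (hc : c ∉ S)
    (hu : G.Adj u c) (hv : G.Adj v c) : Disjoint (nb G S u) (nb G S v) := by
  rw [Finset.disjoint_left]
  intro z hz hz'
  rw [mem_nb] at hz hz'
  have := hG.c4 u v c z huv hu hv hz.2 hz'.2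
  exact hc (this ▸ hz.1)

lemma four (hG : Good G) {S Q : Finset V} {u v : V} (huv : u ≠ v) (hQ : Q ⊆ S)
    (hu : Disjoint (nb G S u) Q) (hv : Disjoint (nb G S v) Q) :
    dg G S u + dg G S v + Q.card ≤ S.card + 1 := by
  have h1 : (nb G S u ∩ nb G S v).card ≤ 1 := by
    rw [Finset.card_le_one]
    intro a ha b hb
    rw [Finset.mem_inter, mem_nb, mem_nb] at ha hb
    exact hG.c4 u v a b huv ha.1.2 ha.2.2 hb.1.2 hb.2.2
  have h2 := Finset.card_union_add_card_inter (nb G S u) (nb G S v)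
  have h3 : Disjoint (nb G S u ∪ nb G S v) Q := Finset.disjoint_union_left.2 ⟨hu, hv⟩
  have h4 : ((nb G S u ∪ nb G S v) ∪ Q).card ≤ S.card := Finset.card_le_card
    (Finset.union_subset (Finset.union_subset (Finset.filter_subset _ _)
      (Finset.filter_subset _ _)) hQ)
  rw [Finset.card_union_of_disjoint h3] at h4
  unfold dg
  omega

lemma next_nb {F : Finset V} {x : V} (a : V) (h : 2 ≤ dg G F x) :
    ∃ y ∈ F, G.Adj x y ∧ y ≠ a := by
  obtain ⟨y, hy⟩ : ((nb G F x).erase a).Nonempty := by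
    apply Finset.card_pos.1
    have := Finset.pred_card_le_card_erase (s := nb G F x) (a := a)
    unfold dg at h
    omega
  rw [Finset.mem_erase, mem_nb] at hy
  exact ⟨y, hy.2.1, hy.2.2, hy.1⟩

/-- the final configuration on 16 vertices is impossible -/
lemma config (hG : Good G) {S F : Finset V} (hd : Disjoint S F) (hS6 : S.card = 6)
    (ht : ∀ x ∈ F, dg G S x + dg G F x = 4) {g h : V} (hgF : g ∈ F) (hhF : h ∈ F)
    (hgh : g ≠ h) (hg1 : dg G S g = 1) (hh1 : dg G S h = 1)
    (h2 : ∀ x ∈ F, x ≠ g → x ≠ h → dg G S x = 2) : False := by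
  have hFS : ∀ x ∈ F, x ∉ S := fun x hx hx' => Finset.disjoint_left.1 hd hx' hx
  have hsub : ∀ x, nb G S x ⊆ S := fun x => Finset.filter_subset _ _
  have hgF3 : dg G F g = 3 := by have := ht g hgF; omega
  have hadj : G.Adj g h := by
    by_contra hn
    have hst := star_le hG (B := S) (X := nb G F g) (v := g) (hFS g hgF)
      (fun x hx => ((mem_nb G).1 hx).2)
    rw [Finset.sum_congr rfl (g := fun _ => 2) (fun x hx => by
      rw [mem_nb] at hx
      exact h2 x hx.1 hx.2.ne' (fun e => hn (e ▸ hx.2))), Finset.sum_const, smul_eq_mul] at hst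
    unfold dg at hgF3 hg1 hst
    omega
  have hhm : h ∈ nb G F g := (mem_nb G).2 ⟨hhF, hadj⟩
  have hc2 : ((nb G F g).erase h).card = 2 := by
    rw [Finset.card_erase_of_mem hhm]; unfold dg at hgF3; omega
  obtain ⟨a, a', haa, hae⟩ := Finset.card_eq_two.1 hc2
  have ha : a ∈ (nb G F g).erase h := by rw [hae]; simp
  have ha' : a' ∈ (nb G F g).erase h := by rw [hae]; simp
  rw [Finset.mem_erase, mem_nb] at ha ha'
  obtain ⟨hah, haF, hga⟩ := ha
  obtain ⟨ha'h, ha'F, hga'⟩ := ha'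
  have ta := h2 a haF hga.ne' hah
  have ta' := h2 a' ha'F hga'.ne' ha'h
  obtain ⟨x, hxF, hax, hxg⟩ := next_nb (G := G) (F := F) (x := a) g (by have := ht a haF; omega)
  have hxh : x ≠ h := by
    rintro rfl
    exact hG.tri g a x hga hax hadj
  have tx := h2 x hxF hxg hxh
  obtain ⟨y, hyF, hxy, hya⟩ := next_nb (G := G) (F := F) (x := x) a (by have := ht x hxF; omega)
  have hyg : y ≠ g := by
    rintro rfl
    exact hG.tri y a x hga hax hxy.symm
  have hyh : y ≠ h := by
    rintro rfl
    exact hya (hG.c4 x g y a hxg hxy hadj hax.symm hga)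
  have ty := h2 y hyF hyg hyh
  obtain ⟨z, hzF, hyz, hzx⟩ := next_nb (G := G) (F := F) (x := y) x (by have := ht y hyF; omega)
  have hgy : ¬ G.Adj g y := fun hgy => hxg (hG.c4 a y x g hya.symm hax hxy.symm hga.symm hgy.symm)
  have hzg : z ≠ g := by
    rintro rfl
    exact hgy hyz.symm
  have hza : z ≠ a := by
    rintro rfl
    exact hG.tri z x y hax hxy hyz.symm
  by_cases hzh : z = h
  · subst hzh
    have d1 : Disjoint (nb G S g) (nb G S z) := dj_adj hG hadj
    have d2 : Disjoint (nb G S g) (nb G S a) := dj_adj hG hga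
    have d3 : Disjoint (nb G S z) (nb G S a) := dj_two hG hza (hFS g hgF) hadj.symm hga.symm
    have e1 : Disjoint (nb G S y) (nb G S z) := dj_adj hG hyz
    have e2 : Disjoint (nb G S y) (nb G S g) := dj_two hG hyg (hFS z hzF) hyz hadj
    have e3 : Disjoint (nb G S y) (nb G S a) := dj_two hG hya (hFS x hxF) hxy.symm hax
    have f1 : Disjoint (nb G S a') (nb G S g) := dj_adj hG hga'.symm
    have f2 : Disjoint (nb G S a') (nb G S z) := dj_two hG ha'h (hFS g hgF) hga'.symm hadj.symm
    have f3 : Disjoint (nb G S a') (nb G S a) := dj_two hG haa.symm (hFS g hgF) hga'.symm hga.symm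
    have hya' : y ≠ a' := by
      rintro rfl
      exact hgy hga'
    have dq : Disjoint (nb G S g ∪ nb G S z) (nb G S a) := Finset.disjoint_union_left.2 ⟨d2, d3⟩
    have := four hG (S := S) (Q := nb G S g ∪ nb G S z ∪ nb G S a) hya'
      (Finset.union_subset (Finset.union_subset (hsub _) (hsub _)) (hsub _))
      (Finset.disjoint_union_right.2 ⟨Finset.disjoint_union_right.2 ⟨e2, e1⟩, e3⟩)
      (Finset.disjoint_union_right.2 ⟨Finset.disjoint_union_right.2 ⟨f1, f2⟩, f3⟩)
    rw [Finset.card_union_of_disjoint dq, Finset.card_union_of_disjoint d1] at this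
    unfold dg at *
    omega
  · have tz := h2 z hzF hzg hzh
    have d1 : Disjoint (nb G S x) (nb G S y) := dj_adj hG hxy
    have e1 : Disjoint (nb G S a) (nb G S x) := dj_adj hG hax
    have e2 : Disjoint (nb G S a) (nb G S y) := dj_two hG hya.symm (hFS x hxF) hax hxy.symm
    have f1 : Disjoint (nb G S z) (nb G S y) := dj_adj hG hyz.symm
    have f2 : Disjoint (nb G S z) (nb G S x) := dj_two hG hzx (hFS y hyF) hyz.symm hxy
    have := four hG (S := S) (Q := nb G S x ∪ nb G S y) hza.symm
      (Finset.union_subset (hsub _) (hsub _))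
      (Finset.disjoint_union_right.2 ⟨e1, e2⟩)
      (Finset.disjoint_union_right.2 ⟨f2, f1⟩)
    rw [Finset.card_union_of_disjoint d1] at this
    unfold dg at *
    omega

lemma no5 (hG : Good G) {A : Finset V} (hA : A.card = 16) (hs : sg G A = 58)
    (hm : ∀ x ∈ A, 3 ≤ dg G A x)
    (hind : ∀ x ∈ A, ∀ y ∈ A, dg G A x = 3 → dg G A y = 3 → ¬ G.Adj x y)
    {u : V} (hu : u ∈ A) (hu5 : dg G A u = 5) : False := by
  have hb := ball hG hu
  have hn3 : ∀ y ∈ nb G A u, dg G A y = 3 := by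
    have hle : ∀ y ∈ nb G A u, 3 ≤ dg G A y := fun y hy => hm y ((mem_nb G).1 hy).1
    have heq : ∑ y ∈ nb G A u, 3 = ∑ y ∈ nb G A u, dg G A y := by
      apply le_antisymm (Finset.sum_le_sum hle)
      rw [Finset.sum_const, smul_eq_mul]
      unfold dg at hu5 hb ⊢
      omega
    exact fun y hy => ((Finset.sum_eq_sum_iff_of_le hle).1 heq y hy).symm
  let P := A.filter (fun x => ¬ dg G A x = 3)
  have hsum : ∑ x ∈ A.filter (fun x => dg G A x = 3), dg G A x + ∑ x ∈ P, dg G A x = sg G A :=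
    Finset.sum_filter_add_sum_filter_not _ _ _
  have hcard : (A.filter (fun x => dg G A x = 3)).card + P.card = A.card :=
    Finset.card_filter_add_card_filter_not _
  have h1 := Finset.card_nsmul_le_sum (A.filter (fun x => dg G A x = 3)) (dg G A) 3
    (fun x hx => hm x (Finset.mem_filter.1 hx).1)
  have h2 := Finset.card_nsmul_le_sum P (dg G A) 4 (fun x hx => by
    have h3 := Finset.mem_filter.1 hx
    have := hm x h3.1
    have := h3.2
    omega)
  rw [smul_eq_mul] at h1 h2
  have hsum' := (add_le_add h1 h2).trans hsum.le
  have huP : u ∈ P := Finset.mem_filter.2 ⟨hu, by omega⟩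
  have hst := star_le hG (B := P.erase u) (X := nb G A u) (v := u) (by simp)
    (fun x hx => ((mem_nb G).1 hx).2)
  rw [Finset.sum_congr rfl (g := fun _ => 2) (fun y hy => by
    have hy3 := hn3 y hy
    rw [mem_nb] at hy
    have hPA : dg G P y = dg G A y := by
      unfold dg
      congr 1
      ext z
      rw [mem_nb, mem_nb]
      constructor
      · exact fun hz => ⟨(Finset.mem_filter.1 hz.1).1, hz.2⟩
      · exact fun hz => ⟨Finset.mem_filter.2 ⟨hz.1, fun hz3 =>
          hind y hy.1 z hz.1 hy3 hz3 hz.2⟩, hz.2⟩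
    have := dg_erase_adj G huP hy.2.symm
    omega), Finset.card_erase_of_mem huP, Finset.sum_const, smul_eq_mul] at hst
  have hu5' : (nb G A u).card = 5 := hu5
  rw [hu5'] at hst
  omega

lemma bd16 (hG : Good G) : Bd G 16 28 := by
  obtain ⟨h12, h13⟩ := bd13 hG
  intro A hA
  obtain ⟨v, hv, hm, h1, h2⟩ := min_data (D := 3) hG (bd15 hG) (by norm_num) hA
  by_contra hc
  obtain ⟨c, hc2⟩ := sg_even G A
  have hs : sg G A = 58 := by omega
  have hv3 : dg G A v = 3 := by omega
  rw [hv3] at hm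
  have hind : ∀ x ∈ A, ∀ y ∈ A, dg G A x = 3 → dg G A y = 3 → ¬ G.Adj x y :=
    fun x hx y hy hx3 hy3 => adj3 (bd14 hG) hA (by omega) hx hy hx3 hy3
  have h34 : ∀ x ∈ A, dg G A x = 3 ∨ dg G A x = 4 := by
    intro x hx
    have := ball_min hG hx hm
    have := hm x hx
    have : dg G A x ≠ 5 := fun h5 => no5 hG hA hs hm hind hx h5
    omega
  obtain ⟨S, F, hSF, hd, hS, hF, hc1, hc3, hdg⟩ := part34 h34
  have hSS : ∀ x ∈ S, dg G S x = 0 := fun x hx => dg_zero fun y hy =>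
    hind x (hS x hx).1 y (hS y hy).1 (hS x hx).2 (hS y hy).2
  have hSF3 : ∀ x ∈ S, dg G F x = 3 := fun x hx => by
    have := hSS x hx
    have := hdg x
    have := (hS x hx).2
    omega
  have ht : ∀ x ∈ F, dg G S x + dg G F x = 4 := fun x hx => by rw [← hdg, (hF x hx).2]
  have ht1 : ∀ w ∈ F, 1 ≤ dg G S w := by
    intro w hw
    by_contra h0
    have hb := ball hG (hF w hw).1
    have := Finset.card_nsmul_le_sum (nb G A w) (dg G A) 4 (by
      intro x hx
      rw [mem_nb] at hx
      rcases h34 x hx.1 with h3 | h4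
      · exfalso
        have hxS : x ∈ S := by
          have : x ∈ S ∪ F := hSF ▸ hx.1
          rcases Finset.mem_union.1 this with h | h
          · exact h
          · have := (hF x h).2
            omega
        exact h0 (Finset.card_pos.2 ⟨x, (mem_nb G).2 ⟨hxS, hx.2⟩⟩)
      · omega)
    rw [smul_eq_mul] at this
    have h4 := (hF w hw).2
    unfold dg at *
    omega
  have ht2 : ∀ w ∈ F, dg G S w ≤ 2 := by
    intro w hw
    by_contra h3
    have h3' : 2 < (nb G S w).card := by unfold dg at h3; omega
    obtain ⟨x, hx, y, hy, z, hz, hxy, hxz, hyz⟩ := Finset.two_lt_card.1 h3'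
    rw [mem_nb] at hx hy hz
    have hwA := (hF w hw).1
    obtain ⟨hxA, hx3⟩ := hS x hx.1
    obtain ⟨hyA, hy3⟩ := hS y hy.1
    obtain ⟨hzA, hz3⟩ := hS z hz.1
    have mx : x ∈ A.erase w := Finset.mem_erase.2 ⟨hx.2.ne', hxA⟩
    have my : y ∈ A.erase w := Finset.mem_erase.2 ⟨hy.2.ne', hyA⟩
    have mz : z ∈ A.erase w := Finset.mem_erase.2 ⟨hz.2.ne', hzA⟩
    have my' : y ∈ (A.erase w).erase x := Finset.mem_erase.2 ⟨hxy.symm, my⟩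
    have mz' : z ∈ (A.erase w).erase x := Finset.mem_erase.2 ⟨hxz.symm, mz⟩
    have mz'' : z ∈ ((A.erase w).erase x).erase y := Finset.mem_erase.2 ⟨hyz.symm, mz'⟩
    have c1 : (A.erase w).card = 15 := by rw [Finset.card_erase_of_mem hwA, hA]
    have c2 : ((A.erase w).erase x).card = 14 := by rw [Finset.card_erase_of_mem mx, c1]
    have c3 : (((A.erase w).erase x).erase y).card = 13 := by
      rw [Finset.card_erase_of_mem my', c2]
    have s1 := sg_erase G hwA
    have s2 := sg_erase G mx
    have s3 := sg_erase G my'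
    have s4 := h12.erase c3 mz''
    have x1 := dg_erase_adj G hwA hx.2.symm
    have y1 := dg_erase_adj G hwA hy.2.symm
    have z1 := dg_erase_adj G hwA hz.2.symm
    have y2 := dg_erase_nadj G mx (hind y hyA x hxA hy3 hx3)
    have z2 := dg_erase_nadj G mx (hind z hzA x hxA hz3 hx3)
    have z3 := dg_erase_nadj G my' (hind z hzA y hyA hz3 hy3)
    have hw4 := (hF w hw).2
    omega
  have hdc := dg_double G S F
  rw [Finset.sum_congr rfl hSF3, Finset.sum_const, smul_eq_mul] at hdc
  have hsum := Finset.sum_filter_add_sum_filter_not F (fun x => dg G S x = 1) (dg G S)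
  have hcard := Finset.card_filter_add_card_filter_not (s := F) (fun x => dg G S x = 1)
  rw [Finset.sum_congr rfl (g := fun _ => 1) (fun x hx => (Finset.mem_filter.1 hx).2),
    Finset.sum_congr (s₁ := F.filter (fun x => ¬ dg G S x = 1)) rfl (g := fun _ => 2)
      (fun x hx => by
        have hx' := Finset.mem_filter.1 hx
        have := ht1 x hx'.1
        have := ht2 x hx'.1
        have := hx'.2
        omega), Finset.sum_const, Finset.sum_const, smul_eq_mul, smul_eq_mul, ← hdc] at hsum
  have hF1 : (F.filter (fun x => dg G S x = 1)).card = 2 := by omega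
  obtain ⟨g, h, hgh, hF1e⟩ := Finset.card_eq_two.1 hF1
  have hg : g ∈ F.filter (fun x => dg G S x = 1) := by rw [hF1e]; simp
  have hh : h ∈ F.filter (fun x => dg G S x = 1) := by rw [hF1e]; simp
  rw [Finset.mem_filter] at hg hh
  refine config hG hd (by omega) ht hg.1 hh.1 hgh hg.2 hh.2 ?_
  intro x hx hxg hxh
  have := ht1 x hx
  have := ht2 x hx
  have : dg G S x ≠ 1 := fun h1 => by
    have : x ∈ F.filter (fun x => dg G S x = 1) := Finset.mem_filter.2 ⟨hx, h1⟩
    rw [hF1e] at this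
    simp [hxg, hxh] at this
  omega

lemma Bd.step2 (hG : Good G) {n f : ℕ} (D : ℕ) (h : Bd G n f) (hD : n < (D + 2) * (D + 2))
    (hb : 2 * f + 2 * (D + 1) < (n + 1) * (D + 1)) :
    Bd G (n + 1) (f + D) := by
  intro A hA
  obtain ⟨v, hv, hm, h1, h2⟩ := min_data (D := D + 1) hG h hD hA
  by_cases hvD : dg G A v = D + 1
  · rw [hvD] at hm h2
    have := min_sum hm
    rw [hA] at this
    omega
  · omega

lemma bd19 (hG : Good G) : Bd G 18 34 ∧ Bd G 19 38 := by
  have h17 : Bd G 17 31 := (bd16 hG).step2 hG 3 (by norm_num) (by norm_num)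
  have h18 : Bd G 18 34 := h17.step2 hG 3 (by norm_num) (by norm_num)
  exact ⟨h18, h18.step hG 4 (by norm_num)⟩

lemma main20 (hG : Good G) {A : Finset V} (hA : A.card = 20) (hs : sg G A = 82) :
    ∃ v ∈ A, dg G A v = 3 ∧ (∀ x ∈ A, x ≠ v → dg G A x = 4 + if G.Adj x v then 1 else 0) := by
  obtain ⟨h18, h19⟩ := bd19 hG
  obtain ⟨v, hv, hm, h1, h2⟩ := min_data (D := 4) hG h19 (by norm_num) hA
  have hv3 : dg G A v = 3 := by
    by_contra hne
    have hv4 : dg G A v = 4 := by omega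
    rw [hv4] at hm
    obtain ⟨x, hx, hx5⟩ := exists_gt (G := G) (A := A) (k := 4) (by omega)
    have := ball_min hG hx hm
    omega
  refine ⟨v, hv, hv3, ?_⟩
  have hs' := sg_erase G hv
  have hc : (A.erase v).card = 19 := by rw [Finset.card_erase_of_mem hv, hA]
  have h4 := all_eq (G := G) (A := A.erase v) (k := 4)
    (fun x hx => by have := h18.erase hc hx; omega) (by omega)
  intro x hx hxv
  rw [dg_erase G hv x, h4 x (Finset.mem_erase.2 ⟨hxv, hx⟩)]

lemma good_of_girth (hg : GirthAtLeast5 G) : Good G := by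
  constructor
  · intro a b c hab hbc hac
    have := hg (Walk.cons hab (Walk.cons hbc (Walk.cons hac.symm Walk.nil))) (by
      have := hab.ne
      have := hbc.ne
      have := hac.ne
      simp [Walk.cons_isCycle_iff, Walk.cons_isPath_iff]
      grind)
    simp at this
  · intro a b c d hab hac hbc had hbd
    by_contra hcd
    have := hg (Walk.cons hac (Walk.cons hbc.symm (Walk.cons hbd (Walk.cons had.symm Walk.nil)))) (by
      have := hac.ne
      have := hbc.ne
      have := had.ne
      have := hbd.ne
      simp [Walk.cons_isCycle_iff, Walk.cons_isPath_iff]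
      grind)
    simp at this

end Helpers

theorem stmt7 (G : SimpleGraph (Fin 20)) [DecidableRel G.Adj]
    (hg : GirthAtLeast5 G) (he : G.edgeFinset.card = 41) :
    G.minDegree = 3 ∧ G.maxDegree = 5 ∧ HasEmbeddedStar G 5 ![3, 3, 3, 3, 2] := by
  have hG : Good G := good_of_girth hg
  have hdeg : ∀ x, dg G Finset.univ x = G.degree x := by
    intro x
    rw [← G.card_neighborFinset_eq_degree, G.neighborFinset_eq_filter]
    rfl
  have hs : sg G Finset.univ = 82 := by
    unfold sg
    simp_rw [hdeg]
    rw [G.sum_degrees_eq_twice_card_edges, he]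
  obtain ⟨v, -, hv3, h4⟩ := main20 hG (A := Finset.univ) (by simp) hs
  simp only [hdeg] at hv3 h4
  have h4' : ∀ x, x ≠ v → G.degree x = 4 + if G.Adj x v then 1 else 0 :=
    fun x hx => h4 x (Finset.mem_univ x) hx
  obtain ⟨x, hx⟩ : (G.neighborFinset v).Nonempty := by
    apply Finset.card_pos.1
    rw [G.card_neighborFinset_eq_degree]
    omega
  rw [mem_neighborFinset] at hx
  have hx5 : G.degree x = 5 := by
    rw [h4' x hx.ne', if_pos hx.symm]
  refine ⟨?_, ?_, ?_⟩
  · apply le_antisymm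
    · rw [← hv3]; exact G.minDegree_le_degree v
    · apply G.le_minDegree_of_forall_le_degree
      intro w
      by_cases hw : w = v
      · rw [hw, hv3]
      · have := h4' w hw
        omega
  · apply le_antisymm
    · apply G.maxDegree_le_of_forall_degree_le
      intro w
      by_cases hw : w = v
      · rw [hw, hv3]; norm_num
      · rw [h4' w hw]
        split_ifs <;> norm_num
    · rw [← hx5]; exact G.degree_le_maxDegree x
  · have hvx : v ∈ G.neighborFinset x := by rw [mem_neighborFinset]; exact hx.symm
    have hc : ((G.neighborFinset x).erase v).card = 4 := by
      rw [Finset.card_erase_of_mem hvx, G.card_neighborFinset_eq_degree, hx5]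
    let f := ((G.neighborFinset x).erase v).orderEmbOfFin hc
    have hf : ∀ i, f i ≠ v ∧ G.Adj x (f i) := by
      intro i
      have := Finset.orderEmbOfFin_mem _ hc i
      rwa [Finset.mem_erase, mem_neighborFinset] at this
    refine ⟨x, Fin.snoc (α := fun _ => Fin 20) f v, hx5, ?_, ?_, ?_⟩
    · rw [Fin.snoc_injective_iff]
      refine ⟨f.injective, ?_⟩
      rintro ⟨i, hi⟩
      exact (hf i).1 hi
    · intro i
      refine Fin.lastCases ?_ (fun j => ?_) i
      · rw [Fin.snoc_last]; exact hx.symm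
      · rw [Fin.snoc_castSucc]; exact (hf j).2
    · intro i
      refine Fin.lastCases ?_ (fun j => ?_) i
      · rw [Fin.snoc_last, hv3]; decide
      · rw [Fin.snoc_castSucc]
        have h1 := h4' (f j) (hf j).1
        have h2 : (![3, 3, 3, 3, 2] : Fin 5 → ℕ) j.castSucc = 3 := by
          fin_cases j <;> rfl
        rw [h2]
        omega
end

section
/- If Γ is a graph of girth at least 5 on 21 vertices with 44 edges, then (δ(Γ), Δ(Γ)) = (3,5) or (δ(Γ), Δ(Γ)) = (4,5), and in either case Γ has an embedded S_{5,[3,3,3,3,3]} star; that is, Γ has a vertex of degree 5 all five of whose neighbours have degree at least 4. -/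
open SimpleGraph

namespace St8
open Finset

structure Good {V : Type*} (G : SimpleGraph V) : Prop where
  tri : ∀ a b c, G.Adj a b → G.Adj b c → ¬ G.Adj a c
  sq : ∀ a b x y, a ≠ b → G.Adj a x → G.Adj b x → G.Adj a y → G.Adj b y → x = y

def nb {V : Type*} (G : SimpleGraph V) [DecidableRel G.Adj] (S : Finset V) (x : V) : Finset V :=
  S.filter (fun y => G.Adj x y)

def dg {V : Type*} (G : SimpleGraph V) [DecidableRel G.Adj] (S : Finset V) (x : V) : ℕ :=
  (nb G S x).card

def E {V : Type*} (G : SimpleGraph V) [DecidableRel G.Adj] (S : Finset V) : ℕ :=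
  ∑ x ∈ S, dg G S x

variable {V : Type*} [DecidableEq V] {G : SimpleGraph V} [DecidableRel G.Adj]

theorem mem_nb {S : Finset V} {x y : V} : y ∈ nb G S x ↔ y ∈ S ∧ G.Adj x y := by
  simp [nb]

theorem nb_erase (S : Finset V) (x y : V) : nb G (S.erase x) y = (nb G S y).erase x := by
  ext z; simp only [mem_nb, mem_erase]; tauto

theorem dg_erase_adj {S : Finset V} {x y : V} (hx : x ∈ S) (h : G.Adj y x) :
    dg G (S.erase x) y + 1 = dg G S y := by
  unfold dg; rw [nb_erase]
  exact card_erase_add_one (mem_nb.2 ⟨hx, h⟩)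

theorem dg_erase_nadj {S : Finset V} {x y : V} (h : ¬ G.Adj y x) :
    dg G (S.erase x) y = dg G S y := by
  unfold dg; rw [nb_erase, erase_eq_of_notMem]
  intro h'; exact h (mem_nb.1 h').2

theorem E_erase {S : Finset V} {x : V} (hx : x ∈ S) : E G (S.erase x) + 2 * dg G S x = E G S := by
  have h1 : ∀ y ∈ S.erase x, dg G S y = dg G (S.erase x) y + if G.Adj x y then 1 else 0 := by
    intro y hy
    by_cases h : G.Adj x y
    · rw [if_pos h, dg_erase_adj hx h.symm]
    · rw [if_neg h, dg_erase_nadj (fun h' => h h'.symm), add_zero]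
  have h2 : E G S = dg G S x + ∑ y ∈ S.erase x, dg G S y := by
    unfold E; rw [add_sum_erase _ _ hx]
  rw [h2, sum_congr rfl h1, sum_add_distrib]
  have h3 : ∑ y ∈ S.erase x, (if G.Adj x y then 1 else 0) = dg G S x := by
    rw [← card_filter]; unfold dg
    congr 1; ext z; simp only [mem_filter, mem_erase, mem_nb]
    constructor
    · tauto
    · rintro ⟨a, b⟩; exact ⟨⟨b.ne', a⟩, b⟩
  rw [h3]; unfold E; ring

theorem E_even (S : Finset V) : Even (E G S) := by
  induction S using Finset.strongInduction with
  | H S ih =>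
    rcases S.eq_empty_or_nonempty with rfl | ⟨x, hx⟩
    · simp [E]
    · rw [← E_erase hx]
      exact (ih _ (erase_ssubset hx)).add (even_two_mul _)

/-- the part of the ball around `x` hanging at `y` -/
def pt (G : SimpleGraph V) [DecidableRel G.Adj] (S : Finset V) (x y : V) : Finset V :=
  insert y ((nb G S y).erase x)

theorem mem_pt {S : Finset V} {x y z : V} :
    z ∈ pt G S x y ↔ z = y ∨ (z ≠ x ∧ z ∈ S ∧ G.Adj y z) := by
  simp [pt, mem_nb]

theorem card_pt {S : Finset V} {x y : V} (hx : x ∈ S) (h : G.Adj x y) :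
    (pt G S x y).card = dg G S y := by
  unfold pt dg
  rw [card_insert_of_notMem, card_erase_add_one]
  · exact mem_nb.2 ⟨hx, h.symm⟩
  · simp [mem_nb]

theorem card_ball (hG : Good G) {S : Finset V} {x : V} (hx : x ∈ S) :
    ((nb G S x).biUnion (pt G S x)).card = ∑ y ∈ nb G S x, dg G S y := by
  rw [card_biUnion]
  · exact sum_congr rfl fun y hy => card_pt hx (mem_nb.1 hy).2
  · intro y hy y' hy' hne
    show Disjoint _ _
    rw [Finset.disjoint_left]
    intro z hz hz'
    have a := (mem_nb.1 hy).2
    have a' := (mem_nb.1 hy').2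
    rcases mem_pt.1 hz with rfl | ⟨h1, h2, h3⟩ <;> rcases mem_pt.1 hz' with h4 | ⟨h4, h5, h6⟩
    · exact hne h4
    · exact hG.tri _ _ _ a' h6 a
    · subst h4; exact hG.tri _ _ _ a h3 a'
    · exact hne (hG.sq x z _ _ h1.symm a h3.symm a' h6.symm)

theorem ball_sub {S : Finset V} {x : V} (hx : x ∈ S) :
    (nb G S x).biUnion (pt G S x) ⊆ S.erase x := by
  intro z hz
  obtain ⟨y, hy, hz⟩ := mem_biUnion.1 hz
  have a := mem_nb.1 hy
  rcases mem_pt.1 hz with rfl | ⟨h1, h2, h3⟩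
  · exact mem_erase.2 ⟨a.2.ne', a.1⟩
  · exact mem_erase.2 ⟨h1, h2⟩

theorem nbrsum (hG : Good G) {S : Finset V} {x : V} (hx : x ∈ S) :
    ∑ y ∈ nb G S x, dg G S y + 1 ≤ S.card := by
  rw [← card_ball hG hx]
  have := card_le_card (ball_sub (G := G) hx)
  rw [card_erase_of_mem hx] at this
  have := card_pos.2 ⟨x, hx⟩
  omega

theorem reach (hG : Good G) {S : Finset V} {x z : V} (hx : x ∈ S)
    (h : S.card ≤ ∑ y ∈ nb G S x, dg G S y + 1) (hz : z ∈ S) (hzx : z ≠ x) :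
    ∃ y ∈ S, G.Adj x y ∧ (z = y ∨ G.Adj y z) := by
  have h1 : (nb G S x).biUnion (pt G S x) = S.erase x := by
    apply eq_of_subset_of_card_le (ball_sub hx)
    rw [card_ball hG hx, card_erase_of_mem hx]; omega
  have : z ∈ S.erase x := mem_erase.2 ⟨hzx, hz⟩
  rw [← h1] at this
  obtain ⟨y, hy, hz⟩ := mem_biUnion.1 this
  have a := mem_nb.1 hy
  refine ⟨y, a.1, a.2, ?_⟩
  rcases mem_pt.1 hz with rfl | ⟨h1, h2, h3⟩
  · exact Or.inl rfl
  · exact Or.inr h3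

theorem sum_sq (hG : Good G) (S : Finset V) :
    ∑ x ∈ S, dg G S x ^ 2 + S.card ≤ S.card * S.card := by
  have h1 : ∑ x ∈ S, ∑ y ∈ nb G S x, dg G S y = ∑ x ∈ S, dg G S x ^ 2 := by
    have : ∀ x ∈ S, ∑ y ∈ nb G S x, dg G S y = ∑ y ∈ S, if G.Adj x y then dg G S y else 0 := by
      intro x _; unfold nb; rw [sum_filter]
    rw [sum_congr rfl this, sum_comm]
    apply sum_congr rfl
    intro y _
    rw [← sum_filter, sum_const, smul_eq_mul, sq]
    congr 1
    unfold dg nb; congr 1; ext z; simp [G.adj_comm]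
  rw [← h1]
  calc _ = ∑ x ∈ S, (∑ y ∈ nb G S x, dg G S y + 1) := by rw [sum_add_distrib]; simp
    _ ≤ ∑ x ∈ S, S.card := sum_le_sum fun x hx => nbrsum hG hx
    _ = _ := by simp

theorem cs (hG : Good G) (S : Finset V) :
    E G S ^ 2 + S.card * S.card ≤ S.card * (S.card * S.card) := by
  have h := sq_sum_le_card_mul_sum_sq (s := S) (f := dg G S)
  have h2 := Nat.mul_le_mul_left S.card (sum_sq hG S)
  unfold E; rw [mul_add] at h2; push_cast at h; linarith

def Bd (G : SimpleGraph V) [DecidableRel G.Adj] (n m : ℕ) : Prop :=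
  ∀ S : Finset V, S.card = n → E G S ≤ 2 * m

theorem dg_lb {n m : ℕ} (hb : Bd G n m) {S : Finset V} (hS : S.card = n + 1) {x : V}
    (hx : x ∈ S) : E G S ≤ 2 * m + 2 * dg G S x := by
  have := hb (S.erase x) (by rw [card_erase_of_mem hx]; omega)
  have := E_erase (G := G) hx
  omega

theorem avg {n m : ℕ} (hb : Bd G n m) {S : Finset V} (hS : S.card = n + 1) :
    (n + 1) * E G S ≤ (n + 1) * (2 * m) + 2 * E G S := by
  have h : ∑ x ∈ S, E G S ≤ ∑ x ∈ S, (2 * m + 2 * dg G S x) :=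
    sum_le_sum fun x hx => dg_lb hb hS hx
  rw [sum_add_distrib, ← mul_sum S (dg G S) 2] at h
  simp only [sum_const, smul_eq_mul, hS] at h
  exact h

theorem bd9 (hG : Good G) : Bd G 9 12 := by
  intro S hS
  have := cs hG S
  obtain ⟨k, hk⟩ := E_even (G := G) S
  rw [hS] at this
  by_contra hc
  have : 26 ≤ E G S := by omega
  nlinarith

theorem bd10 (hG : Good G) : Bd G 10 15 := by
  intro S hS
  have := cs hG S
  rw [hS] at this
  by_contra hc
  have : 31 ≤ E G S := by omega
  nlinarith

theorem E_ub {S : Finset V} {d : ℕ} (h : ∀ x ∈ S, dg G S x ≤ d) : E G S ≤ S.card * d := by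
  unfold E; simpa using sum_le_card_nsmul S (dg G S) d h

/-- `k` neighbours of degree three -/
theorem threes (hG : Good G) {S : Finset V} {t : ℕ} (h : ∀ y ∈ S, t ≤ dg G S y) {x : V} (hx : x ∈ S) :
    (t + 1) * dg G S x + 1 ≤ S.card + ((nb G S x).filter (fun y => dg G S y = t)).card := by
  have h1 := nbrsum hG hx
  have h2 : ∑ y ∈ nb G S x, (t + 1) ≤ ∑ y ∈ nb G S x, (dg G S y + if dg G S y = t then 1 else 0) := by
    apply sum_le_sum
    intro y hy
    have := h y (mem_nb.1 hy).1
    split_ifs <;> omega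
  rw [sum_add_distrib (f := dg G S), ← card_filter] at h2
  simp only [sum_const, smul_eq_mul] at h2
  have : (nb G S x).card * (t + 1) = (t + 1) * dg G S x := by unfold dg; ring
  omega

theorem lb_sum (hG : Good G) {S : Finset V} {t : ℕ} (h : ∀ y ∈ S, t ≤ dg G S y) {x : V} (hx : x ∈ S) :
    t * dg G S x + 1 ≤ S.card := by
  have h1 := nbrsum hG hx
  have h2 : ∑ y ∈ nb G S x, t ≤ ∑ y ∈ nb G S x, dg G S y :=
    sum_le_sum fun y hy => h y (mem_nb.1 hy).1
  simp only [sum_const, smul_eq_mul] at h2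
  have : (nb G S x).card * t = t * dg G S x := by unfold dg; ring
  omega

/-- erasing an independent set of vertices of degree t -/
theorem E_sdiff {S : Finset V} {t : ℕ} (T : Finset V) (hTS : T ⊆ S) (hd : ∀ x ∈ T, dg G S x = t)
    (hi : ∀ x ∈ T, ∀ y ∈ T, ¬ G.Adj x y) : E G (S \ T) + 2 * t * T.card = E G S := by
  induction T using Finset.induction_on with
  | empty => simp
  | insert a T ha ih =>
    have ih := ih (fun x hx => hTS (mem_insert_of_mem hx)) (fun x hx => hd x (mem_insert_of_mem hx))
      (fun x hx y hy => hi x (mem_insert_of_mem hx) y (mem_insert_of_mem hy))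
    have haS : a ∈ S \ T := mem_sdiff.2 ⟨hTS (mem_insert_self _ _), ha⟩
    have h1 := E_erase (G := G) haS
    have h2 : (S \ T).erase a = S \ insert a T := by
      ext z; simp only [mem_erase, mem_sdiff, mem_insert]; tauto
    have h3 : dg G (S \ T) a = dg G S a := by
      unfold dg; congr 1; ext z; simp only [mem_nb, mem_sdiff]
      constructor
      · tauto
      · rintro ⟨p, q⟩
        exact ⟨⟨p, fun hz => hi a (mem_insert_self _ _) z (mem_insert_of_mem hz) q⟩, q⟩
    rw [h2, h3, hd a (mem_insert_self _ _)] at h1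
    rw [card_insert_of_notMem ha]
    nlinarith

theorem dg_sdiff {S T : Finset V} {x : V} (h : T ⊆ nb G S x) :
    dg G (S \ T) x + T.card = dg G S x := by
  have : nb G (S \ T) x = nb G S x \ T := by
    ext z; simp only [mem_nb, mem_sdiff]; tauto
  unfold dg; rw [this]; exact card_sdiff_add_card_eq_card h

theorem indep_nb (hG : Good G) {S T : Finset V} {x : V} (h : T ⊆ nb G S x) :
    ∀ a ∈ T, ∀ b ∈ T, ¬ G.Adj a b := fun a ha b hb hab =>
  hG.tri _ _ _ (mem_nb.1 (h ha)).2 hab (mem_nb.1 (h hb)).2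

theorem nb_sub (S : Finset V) (x : V) : nb G S x ⊆ S := filter_subset _ _

/-- erase `k` neighbours of degree `t` of `x` -/
theorem star_erase (hG : Good G) {S : Finset V} {x : V} {t k : ℕ}
    (h : k ≤ ((nb G S x).filter (fun y => dg G S y = t)).card) :
    ∃ T ⊆ S, T.card = k ∧ E G (S \ T) + 2 * t * k = E G S ∧ dg G (S \ T) x + k = dg G S x ∧ x ∉ T := by
  obtain ⟨T, hT, hc⟩ := exists_subset_card_eq h
  have hT' : T ⊆ nb G S x := hT.trans (filter_subset _ _)
  refine ⟨T, hT'.trans (nb_sub _ _), hc, ?_, ?_, ?_⟩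
  · rw [← hc]
    exact E_sdiff T (hT'.trans (nb_sub _ _)) (fun y hy => (mem_filter.1 (hT hy)).2) (indep_nb hG hT')
  · rw [← hc]; exact dg_sdiff hT'
  · intro hx; exact (mem_nb.1 (hT' hx)).2.ne rfl

theorem bd11 (hG : Good G) : Bd G 11 16 := by
  intro S hS
  by_contra hc
  have hev := E_even (G := G) S
  have hE : 34 ≤ E G S := by obtain ⟨k, hk⟩ := hev; omega
  have h2 : ∀ x ∈ S, 2 ≤ dg G S x := fun x hx => by have := dg_lb (bd10 hG) hS hx; omega
  obtain ⟨x, hx, hd⟩ : ∃ x ∈ S, 4 ≤ dg G S x := by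
    by_contra! h
    have := E_ub (G := G) (S := S) (d := 3) fun x hx => by have := h x hx; omega
    omega
  have := threes hG h2 hx
  obtain ⟨T, hTS, hT, hE2, _⟩ := star_erase (k := 2) hG (x := x) (S := S) (t := 2) (by omega)
  have := bd9 hG (S \ T) (by rw [card_sdiff_of_subset hTS]; omega)
  omega

theorem bd12 (hG : Good G) : Bd G 12 18 := by
  intro S hS
  by_contra hc
  have hev := E_even (G := G) S
  have hE : 38 ≤ E G S := by obtain ⟨k, hk⟩ := hev; omega
  have h2 : ∀ x ∈ S, 3 ≤ dg G S x := fun x hx => by have := dg_lb (bd11 hG) hS hx; omega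
  have := E_ub (G := G) (S := S) (d := 3) fun x hx => by have := lb_sum hG h2 hx; omega
  omega

theorem bd13 (hG : Good G) : Bd G 13 21 := by
  intro S hS
  have := avg (bd12 hG) hS
  omega

theorem two_adj {n m t : ℕ} (hb : Bd G n m) {S : Finset V} (hS : S.card = n + 2)
    {x y : V} (hx : x ∈ S) (hy : y ∈ S) (h : G.Adj x y) :
    E G S + 2 ≤ 2 * m + 2 * dg G S x + 2 * dg G S y := by
  have h1 := E_erase (G := G) hx
  have hy' : y ∈ S.erase x := mem_erase.2 ⟨h.ne', hy⟩
  have h2 := E_erase (G := G) hy'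
  have h3 := dg_erase_adj (G := G) hx h.symm
  have := hb ((S.erase x).erase y) (by rw [card_erase_of_mem hy', card_erase_of_mem hx]; omega)
  omega

/-- degree count -/
theorem cnt {S : Finset V} (h : ∀ x ∈ S, dg G S x = 3 ∨ dg G S x = 4) :
    E G S + (S.filter (fun x => dg G S x = 3)).card = 4 * S.card := by
  unfold E
  rw [card_filter, ← sum_add_distrib, card_eq_sum_ones, mul_sum]
  apply sum_congr rfl
  intro x hx
  rcases h x hx with h | h <;> simp [h]

theorem bd14 (hG : Good G) : Bd G 14 23 := by
  intro S hS
  by_contra hc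
  have hE : E G S = 48 := by
    have := avg (bd13 hG) hS
    obtain ⟨k, hk⟩ := E_even (G := G) S; omega
  have h3 : ∀ x ∈ S, 3 ≤ dg G S x := fun x hx => by have := dg_lb (bd13 hG) hS hx; omega
  have h4 : ∀ x ∈ S, dg G S x = 3 ∨ dg G S x = 4 := fun x hx => by
    have := lb_sum hG h3 hx
    have := h3 x hx
    omega
  have hi : ∀ x ∈ S, ∀ y ∈ S, dg G S x = 3 → dg G S y = 3 → ¬ G.Adj x y := by
    intro x hx y hy h h' ha
    have := two_adj (t := 0) (bd12 hG) hS hx hy ha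
    omega
  have hc := cnt h4
  obtain ⟨w, hw, hd⟩ : ∃ x ∈ S, dg G S x = 4 := by
    by_contra! h
    have := E_ub (G := G) (S := S) (d := 3) fun x hx => by
      rcases h4 x hx with h' | h'
      · omega
      · exact absurd h' (h x hx)
    omega
  have hk := threes hG h3 hw
  set K := (nb G S w).filter (fun y => dg G S y = 3) with hK
  have hsub : K.biUnion (fun z => (nb G S z).erase w) ⊆ (S.filter (fun x => ¬ dg G S x = 3)).erase w := by
    intro y hy
    obtain ⟨z, hz, hy⟩ := mem_biUnion.1 hy
    obtain ⟨hz, hz3⟩ := mem_filter.1 hz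
    obtain ⟨hyw, hy⟩ := mem_erase.1 hy
    obtain ⟨hyS, hzy⟩ := mem_nb.1 hy
    exact mem_erase.2 ⟨hyw, mem_filter.2 ⟨hyS, fun h => hi z (mem_nb.1 hz).1 y hyS hz3 h hzy⟩⟩
  have hcard : (K.biUnion (fun z => (nb G S z).erase w)).card = ∑ z ∈ K, 2 := by
    rw [card_biUnion]
    · apply sum_congr rfl
      intro z hz
      obtain ⟨hz, hz3⟩ := mem_filter.1 hz
      rw [card_erase_of_mem (mem_nb.2 ⟨hw, (mem_nb.1 hz).2.symm⟩)]
      change dg G S z - 1 = 2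
      omega
    · intro z hz z' hz' hne
      show Disjoint _ _
      rw [Finset.disjoint_left]
      intro y hy hy'
      obtain ⟨hz, hz3⟩ := mem_filter.1 hz
      obtain ⟨hz', hz3'⟩ := mem_filter.1 hz'
      obtain ⟨hyw, hy⟩ := mem_erase.1 hy
      obtain ⟨hyw', hy'⟩ := mem_erase.1 hy'
      exact hne (hG.sq w y z z' hyw.symm (mem_nb.1 hz).2 (mem_nb.1 hy).2.symm (mem_nb.1 hz').2 (mem_nb.1 hy').2.symm)
  have h5 := card_le_card hsub
  rw [hcard, card_erase_of_mem (mem_filter.2 ⟨hw, by omega⟩)] at h5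
  have h6 := card_filter_add_card_filter_not (s := S) (fun x => dg G S x = 3)
  simp only [sum_const, smul_eq_mul] at h5
  omega

theorem bd15 (hG : Good G) : Bd G 15 26 := by
  intro S hS
  have := avg (bd14 hG) hS
  obtain ⟨k, hk⟩ := E_even (G := G) S
  omega

theorem bd16 (hG : Good G) : Bd G 16 29 := by
  intro S hS
  have := avg (bd15 hG) hS
  obtain ⟨k, hk⟩ := E_even (G := G) S
  omega

theorem four_cover {N : Finset V} (hN : N.card = 4) {i j k l m : V} (hi : i ∈ N) (hj : j ∈ N)
    (hk : k ∈ N) (hl : l ∈ N) (hm : m ∈ N) (h1 : i ≠ j) (h2 : i ≠ k) (h3 : i ≠ l) (h4 : j ≠ k)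
    (h5 : j ≠ l) (h6 : k ≠ l) : m = i ∨ m = j ∨ m = k ∨ m = l := by
  have : ({i, j, k, l} : Finset V) = N := by
    apply eq_of_subset_of_card_le
    · intro x hx; simp only [mem_insert, mem_singleton] at hx
      rcases hx with rfl | rfl | rfl | rfl <;> assumption
    · rw [hN, card_insert_of_notMem (by simp [*]), card_insert_of_notMem (by simp [*]), card_pair h6]
  rw [← this] at hm
  simpa using hm

theorem bd17 (hG : Good G) : Bd G 17 31 := by
  intro S hS
  by_contra hc
  have hE : E G S = 64 := by
    have := avg (bd16 hG) hS
    obtain ⟨k, hk⟩ := E_even (G := G) S; omega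
  clear hc
  have h3 : ∀ x ∈ S, 3 ≤ dg G S x := fun x hx => by have := dg_lb (bd16 hG) hS hx; omega
  have h4 : ∀ x ∈ S, dg G S x = 3 ∨ dg G S x = 4 := fun x hx => by
    have h1 := lb_sum hG h3 hx
    have h2 := h3 x hx
    by_contra hne
    have h5 : dg G S x = 5 := by omega
    have h6 := threes hG h3 hx
    obtain ⟨T, hTS, hT, hE2, hd, hxT⟩ := star_erase (k := 4) hG (x := x) (S := S) (t := 3) (by omega)
    have h7 := dg_lb (G := G) (bd12 hG) (S := S \ T) (by rw [card_sdiff_of_subset hTS]; omega)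
      (mem_sdiff.2 ⟨hx, hxT⟩)
    omega
  have hi : ∀ x ∈ S, ∀ y ∈ S, dg G S x = 3 → dg G S y = 3 → ¬ G.Adj x y := by
    intro x hx y hy h h' ha
    have := two_adj (t := 0) (bd15 hG) hS hx hy ha
    omega
  have hu : ∀ y ∈ S, ∀ z ∈ S, ∀ z' ∈ S, dg G S z = 3 → dg G S z' = 3 → G.Adj y z → G.Adj y z' →
      z = z' := by
    intro y hy z hz z' hz' hd hd' ha ha'
    by_contra hne
    have h5 : dg G S y ≤ 4 := by rcases h4 y hy with h | h <;> omega
    have h6 : ({z, z'} : Finset V) ⊆ (nb G S y).filter (fun y => dg G S y = 3) := by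
      intro x hx; simp only [mem_insert, mem_singleton] at hx
      rcases hx with rfl | rfl
      · exact mem_filter.2 ⟨mem_nb.2 ⟨hz, ha⟩, hd⟩
      · exact mem_filter.2 ⟨mem_nb.2 ⟨hz', ha'⟩, hd'⟩
    have h6 := card_le_card h6
    rw [card_pair hne] at h6
    obtain ⟨T, hTS, hT, hE2, hd, hxT⟩ := star_erase (k := 2) hG (x := y) (S := S) (t := 3) h6
    have h7 := dg_lb (G := G) (bd14 hG) (S := S \ T) (by rw [card_sdiff_of_subset hTS]; omega)
      (mem_sdiff.2 ⟨hy, hxT⟩)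
    omega
  have hc := cnt h4
  set A := S.filter (fun x => dg G S x = 3) with hA
  have hU : (A.biUnion (nb G S)).card = 12 := by
    rw [card_biUnion]
    · rw [sum_congr rfl (g := fun _ => 3)]
      · simp; omega
      · intro x hx; exact (mem_filter.1 hx).2
    · intro z hz z' hz' hne
      show Disjoint _ _
      rw [Finset.disjoint_left]
      intro y hy hy'
      obtain ⟨hz, hd⟩ := mem_filter.1 hz
      obtain ⟨hz', hd'⟩ := mem_filter.1 hz'
      obtain ⟨hy, ha⟩ := mem_nb.1 hy
      obtain ⟨_, ha'⟩ := mem_nb.1 hy'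
      exact hne (hu y hy z hz z' hz' hd hd' ha.symm ha'.symm)
  have hUA : Disjoint A (A.biUnion (nb G S)) := by
    rw [Finset.disjoint_left]
    intro y hy hy'
    obtain ⟨z, hz, hy'⟩ := mem_biUnion.1 hy'
    obtain ⟨hz, hd⟩ := mem_filter.1 hz
    obtain ⟨hy, hd'⟩ := mem_filter.1 hy
    exact hi z hz y hy hd hd' (mem_nb.1 hy').2
  have hUS : A ∪ A.biUnion (nb G S) ⊆ S := by
    apply union_subset (filter_subset _ _)
    intro y hy
    obtain ⟨z, hz, hy'⟩ := mem_biUnion.1 hy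
    exact (mem_nb.1 hy').1
  have h1 : (S \ (A ∪ A.biUnion (nb G S))).card = 1 := by
    rw [card_sdiff_of_subset hUS, card_union_of_disjoint hUA]; omega
  obtain ⟨o, ho⟩ := card_eq_one.1 h1
  have ho' : o ∈ S \ (A ∪ A.biUnion (nb G S)) := by rw [ho]; simp
  obtain ⟨hoS, ho2⟩ := mem_sdiff.1 ho'
  have ho3 : ¬ dg G S o = 3 := fun h => ho2 (mem_union_left _ (mem_filter.2 ⟨hoS, h⟩))
  have ho4 : dg G S o = 4 := (h4 o hoS).resolve_left ho3
  have hoz : ∀ z ∈ S, G.Adj o z → dg G S z = 4 := by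
    intro z hz ha
    refine (h4 z hz).resolve_left fun h => ho2 (mem_union_right _ (mem_biUnion.2 ⟨z, mem_filter.2 ⟨hz, h⟩, mem_nb.2 ⟨hoS, ha.symm⟩⟩))
  have hz : ∀ y, ∃ z, y ∈ S → y ≠ o → dg G S y = 4 → z ∈ S ∧ dg G S z = 3 ∧ G.Adj y z := by
    intro y
    by_cases hh : y ∈ S ∧ y ≠ o ∧ dg G S y = 4
    · obtain ⟨hy, hyo, hd⟩ := hh
      have : y ∈ A.biUnion (nb G S) := by
        by_contra hn
        have : y ∈ S \ (A ∪ A.biUnion (nb G S)) := by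
          refine mem_sdiff.2 ⟨hy, fun h => ?_⟩
          rcases mem_union.1 h with h | h
          · have := (mem_filter.1 h).2; omega
          · exact hn h
        rw [ho] at this
        exact hyo (mem_singleton.1 this)
      obtain ⟨z, hz, hy'⟩ := mem_biUnion.1 this
      obtain ⟨hz, hd⟩ := mem_filter.1 hz
      exact ⟨z, fun _ _ _ => ⟨hz, hd, (mem_nb.1 hy').2.symm⟩⟩
    · exact ⟨y, fun a b c => absurd ⟨a, b, c⟩ hh⟩
  choose zf hzf using hz
  have hsum : ∑ y ∈ nb G S o, dg G S y = 16 := by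
    rw [sum_congr rfl (g := fun _ => 4) fun y hy => hoz y (mem_nb.1 hy).1 (mem_nb.1 hy).2]
    simp; change dg G S o * 4 = 16; omega
  have hw : ∀ y, ∃ w, y ∈ S → y ≠ o → ¬ G.Adj o y → w ∈ S ∧ G.Adj o w ∧ G.Adj w y := by
    intro y
    by_cases hh : y ∈ S ∧ y ≠ o ∧ ¬ G.Adj o y
    · obtain ⟨w, hwS, how, hwy⟩ := reach hG hoS (by omega) hh.1 hh.2.1
      refine ⟨w, fun _ _ _ => ⟨hwS, how, hwy.resolve_left ?_⟩⟩
      rintro rfl; exact hh.2.2 how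
    · exact ⟨y, fun a b c => absurd ⟨a, b, c⟩ hh⟩
  choose wf hwf using hw
  -- the set Y
  have hY : ∃ Y : V → Prop, ∀ y, Y y ↔ y ∈ S ∧ y ≠ o ∧ ¬ G.Adj o y ∧ dg G S y = 4 := ⟨_, fun y => Iff.rfl⟩
  obtain ⟨Y, hY⟩ := hY
  have z1 : ∀ y, Y y → zf y ∈ S ∧ dg G S (zf y) = 3 ∧ G.Adj y (zf y) := fun y hy => by
    obtain ⟨a, b, c, d⟩ := (hY y).1 hy; exact hzf y a b d
  have w1 : ∀ y, Y y → wf y ∈ S ∧ G.Adj o (wf y) ∧ G.Adj (wf y) y := fun y hy => by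
    obtain ⟨a, b, c, d⟩ := (hY y).1 hy; exact hwf y a b c
  have wz1 : ∀ y, Y y → wf (zf y) ∈ S ∧ G.Adj o (wf (zf y)) ∧ G.Adj (wf (zf y)) (zf y) := fun y hy => by
    obtain ⟨a, b, c⟩ := z1 y hy
    refine hwf _ a ?_ ?_
    · intro h; rw [h] at b; omega
    · intro h; have := hoz _ a h; omega
  have F1 : ∀ y, Y y → wf y ≠ wf (zf y) := fun y hy h =>
    hG.tri _ _ _ (w1 y hy).2.2 (z1 y hy).2.2 (h ▸ (wz1 y hy).2.2)
  have zz : ∀ y y', Y y → Y y' → wf (zf y) = wf (zf y') → zf y = zf y' := fun y y' hy hy' h =>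
    hu _ (wz1 y hy).1 _ (z1 y hy).1 _ (z1 y' hy').1 (z1 y hy).2.1 (z1 y' hy').2.1 (wz1 y hy).2.2
      (h ▸ (wz1 y' hy').2.2)
  have F2a : ∀ y y', Y y → Y y' → G.Adj y y' → wf y ≠ wf y' := fun y y' hy hy' ha h =>
    hG.tri _ _ _ (w1 y hy).2.2 ha (h ▸ (w1 y' hy').2.2)
  have F2b : ∀ y y', Y y → Y y' → G.Adj y y' → wf (zf y) ≠ wf (zf y') := fun y y' hy hy' ha h =>
    hG.tri _ _ _ ha (z1 y' hy').2.2 (zz y y' hy hy' h ▸ (z1 y hy).2.2)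
  have F2c : ∀ y y', Y y → Y y' → G.Adj y y' → wf y ≠ wf (zf y') := fun y y' hy hy' ha h => by
    have h1 : wf y ≠ y' := by
      intro h'; have := (w1 y hy).2.1; rw [h'] at this; exact ((hY y').1 hy').2.2.1 this
    have h2 := hG.sq (wf y) y' y (zf y') h1 (w1 y hy).2.2 ha.symm (h ▸ (wz1 y' hy').2.2) (z1 y' hy').2.2
    have h3 := (z1 y' hy').2.1
    have h4 := ((hY y).1 hy).2.2.2
    rw [← h2] at h3; omega
  have comp : ∀ y y', Y y → Y y' → G.Adj y y' → ∀ m ∈ S, G.Adj o m →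
      m = wf y ∨ m = wf (zf y) ∨ m = wf y' ∨ m = wf (zf y') := fun y y' hy hy' ha m hm hom =>
    four_cover (N := nb G S o) ho4 (mem_nb.2 ⟨(w1 y hy).1, (w1 y hy).2.1⟩)
      (mem_nb.2 ⟨(wz1 y hy).1, (wz1 y hy).2.1⟩) (mem_nb.2 ⟨(w1 y' hy').1, (w1 y' hy').2.1⟩)
      (mem_nb.2 ⟨(wz1 y' hy').1, (wz1 y' hy').2.1⟩) (mem_nb.2 ⟨hm, hom⟩) (F1 y hy)
      (F2a y y' hy hy' ha) (F2c y y' hy hy' ha) (F2c y' y hy' hy ha.symm).symm (F2b y y' hy hy' ha)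
      (F1 y' hy')
  have F3 : ∀ x y y', Y x → Y y → Y y' → G.Adj x y → G.Adj x y' → y ≠ y' → wf y ≠ wf y' := by
    intro x y y' hx hy hy' ha ha' hne h
    have h1 : wf y ≠ x := by
      intro h'; have := (w1 y hy).2.1; rw [h'] at this; exact ((hY x).1 hx).2.2.1 this
    exact hne (hG.sq _ _ y y' h1 (w1 y hy).2.2 ha (h ▸ (w1 y' hy').2.2) ha')
  have F4 : ∀ y y', Y y → Y y' → wf y = wf y' → wf (zf y) = wf (zf y') → y = y' := by
    intro y y' hy hy' h h'
    have h2 := zz y y' hy hy' h'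
    have h1 : wf y ≠ zf y := by
      intro h'; have := hoz _ (w1 y hy).1 (w1 y hy).2.1; rw [h', (z1 y hy).2.1] at this; omega
    exact hG.sq _ _ y y' h1 (w1 y hy).2.2 (z1 y hy).2.2.symm (h ▸ (w1 y' hy').2.2) (h2 ▸ (z1 y' hy').2.2.symm)
  have F5 : ∀ y, Y y → ∀ p, ∃ q, Y q ∧ q ≠ p ∧ G.Adj y q := by
    intro y hy p
    have hy0 := (hY y).1 hy
    have : (({wf y, zf y, p} : Finset V)).card < (nb G S y).card := by
      have : (nb G S y).card = 4 := hy0.2.2.2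
      have := card_le_three (a := wf y) (b := zf y) (c := p)
      omega
    obtain ⟨q, hq, hq'⟩ := exists_mem_notMem_of_card_lt_card this
    simp only [mem_insert, mem_singleton, not_or] at hq'
    obtain ⟨hqS, hyq⟩ := mem_nb.1 hq
    refine ⟨q, (hY q).2 ⟨hqS, ?_, ?_, ?_⟩, hq'.2.2, hyq⟩
    · rintro rfl; exact hy0.2.2.1 hyq.symm
    · intro h
      exact hq'.1 (hG.sq o y q (wf y) hy0.2.1.symm h hyq (w1 y hy).2.1 (w1 y hy).2.2.symm)
    · exact (h4 q hqS).resolve_left fun h =>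
        hq'.2.1 (hu y hy0.1 q hqS (zf y) (z1 y hy).1 h (z1 y hy).2.1 hyq (z1 y hy).2.2)
  obtain ⟨y, hy⟩ : ∃ y, Y y := by
    have : (insert o (nb G S o ∪ A)).card < S.card := by
      have h1 := card_insert_le o (nb G S o ∪ A)
      have h2 := card_union_le (nb G S o) A
      have h3 : (nb G S o).card = 4 := ho4
      omega
    obtain ⟨q, hq, hq'⟩ := exists_mem_notMem_of_card_lt_card this
    simp only [mem_insert, mem_union, not_or] at hq'
    exact ⟨q, (hY q).2 ⟨hq, hq'.1, fun h => hq'.2.1 (mem_nb.2 ⟨hq, h⟩), (h4 q hq).resolve_left fun h =>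
      hq'.2.2 (mem_filter.2 ⟨hq, h⟩)⟩⟩
  obtain ⟨b, hb, _, hyb⟩ := F5 y hy y
  obtain ⟨c, hc', hcb, hyc⟩ := F5 y hy b
  obtain ⟨p, hp, hpy, hbp⟩ := F5 b hb y
  obtain ⟨q, hq, hqy, hcq⟩ := F5 c hc' y
  have e1 : wf c = wf (zf b) := by
    rcases comp y b hy hb hyb _ (w1 c hc').1 (w1 c hc').2.1 with h | h | h | h
    · exact absurd h (F2a y c hy hc' hyc).symm
    · exact absurd h (F2c c y hc' hy hyc.symm)
    · exact absurd h (F3 y c b hy hc' hb hyc hyb hcb)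
    · exact h
  have e2 : wf (zf c) = wf b := by
    rcases comp y b hy hb hyb _ (wz1 c hc').1 (wz1 c hc').2.1 with h | h | h | h
    · exact absurd h (F2c y c hy hc' hyc).symm
    · exact absurd h (F2b y c hy hc' hyc).symm
    · exact h
    · exact absurd (e1.trans h.symm) (F1 c hc')
  have gen : ∀ b p, Y b → Y p → G.Adj y b → G.Adj b p → p ≠ y → wf p = wf (zf y) ∧ wf (zf p) = wf y := by
    intro b p hb hp hyb hbp hpy
    have g1 : wf p = wf (zf y) := by
      rcases comp y b hy hb hyb _ (w1 p hp).1 (w1 p hp).2.1 with h | h | h | h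
      · exact absurd h (F3 b p y hb hp hy hbp hyb.symm hpy)
      · exact h
      · exact absurd h (F2a b p hb hp hbp).symm
      · exact absurd h (F2c p b hp hb hbp.symm)
    refine ⟨g1, ?_⟩
    rcases comp y b hy hb hyb _ (wz1 p hp).1 (wz1 p hp).2.1 with h | h | h | h
    · exact h
    · exact absurd (g1.trans h.symm) (F1 p hp)
    · exact absurd h (F2c b p hb hp hbp).symm
    · exact absurd h (F2b b p hb hp hbp).symm
  obtain ⟨p1, p2⟩ := gen b p hb hp hyb hbp hpy
  obtain ⟨q1, q2⟩ := gen c q hc' hq hyc hcq hqy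
  have hpq : p = q := F4 p q hp hq (p1.trans q1.symm) (p2.trans q2.symm)
  subst hpq
  exact hcb (hG.sq y p c b hpy.symm hyc hcq.symm hyb hbp.symm)

theorem bd18 (hG : Good G) : Bd G 18 34 := by
  intro S hS
  have := avg (bd17 hG) hS
  obtain ⟨k, hk⟩ := E_even (G := G) S
  omega

theorem bd19 (hG : Good G) : Bd G 19 38 := by
  intro S hS
  have := avg (bd18 hG) hS
  omega

theorem bd20 (hG : Good G) : Bd G 20 41 := by
  intro S hS
  by_contra hc
  have h4 : ∀ x ∈ S, 4 ≤ dg G S x := fun x hx => by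
    have := dg_lb (bd19 hG) hS hx
    obtain ⟨k, hk⟩ := E_even (G := G) S
    omega
  have := E_ub (G := G) (S := S) (d := 4) fun x hx => by
    have := lb_sum hG h4 hx; omega
  omega

theorem comm_nb (hG : Good G) {H : Finset V} {u : V} (hu : u ∉ H) {t t' y : V}
    (ht : t ∈ nb G H u) (ht' : t' ∈ nb G H u) (hy : y ∈ H) (h : G.Adj t y) (h' : G.Adj t' y) : t = t' :=
  hG.sq u y t t' (fun h => hu (h ▸ hy)) (mem_nb.1 ht).2 h.symm (mem_nb.1 ht').2 h'.symm

def Rch (G : SimpleGraph V) (H : Finset V) (x z : V) : Prop :=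
  G.Adj x z ∨ ∃ y ∈ H, G.Adj x y ∧ G.Adj y z

theorem Rch.symm {H : Finset V} {x z : V} (h : Rch G H x z) : Rch G H z x := by
  rcases h with h | ⟨y, hy, h1, h2⟩
  · exact Or.inl h.symm
  · exact Or.inr ⟨y, hy, h2.symm, h1.symm⟩

theorem ball_iff {H : Finset V} {x z : V} (hz : z ∈ H) (hzx : z ≠ x) :
    z ∈ (nb G H x).biUnion (pt G H x) ↔ Rch G H x z := by
  constructor
  · intro h
    obtain ⟨y, hy, h⟩ := mem_biUnion.1 h
    obtain ⟨hy, ha⟩ := mem_nb.1 hy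
    rcases mem_pt.1 h with rfl | ⟨_, _, h⟩
    · exact Or.inl ha
    · exact Or.inr ⟨y, hy, ha, h⟩
  · rintro (h | ⟨y, hy, h1, h2⟩)
    · exact mem_biUnion.2 ⟨z, mem_nb.2 ⟨hz, h⟩, mem_pt.2 (Or.inl rfl)⟩
    · exact mem_biUnion.2 ⟨y, mem_nb.2 ⟨hy, h1⟩, mem_pt.2 (Or.inr ⟨hzx, hz, h2⟩)⟩

theorem far_card (hG : Good G) {H : Finset V} (h19 : H.card = 19) (h4 : ∀ x ∈ H, dg G H x = 4)
    {x : V} (hx : x ∈ H) : (H.erase x \ (nb G H x).biUnion (pt G H x)).card = 2 := by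
  rw [card_sdiff_of_subset (ball_sub hx), card_ball hG hx, card_erase_of_mem hx,
    sum_congr rfl (g := fun _ => 4) fun y hy => h4 y (mem_nb.1 hy).1]
  have : (nb G H x).card = 4 := h4 x hx
  simp [this, h19]

theorem far_ex (hG : Good G) {H : Finset V} (h19 : H.card = 19) (h4 : ∀ x ∈ H, dg G H x = 4)
    {x : V} (hx : x ∈ H) : ∃ p ∈ H, p ≠ x ∧ ¬ Rch G H x p := by
  have := far_card hG h19 h4 hx
  obtain ⟨p, hp⟩ := card_pos.1 (by omega : 0 < (H.erase x \ (nb G H x).biUnion (pt G H x)).card)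
  obtain ⟨hp, hp'⟩ := mem_sdiff.1 hp
  obtain ⟨h1, h2⟩ := mem_erase.1 hp
  exact ⟨p, h2, h1, fun h => hp' ((ball_iff h2 h1).2 h)⟩

theorem T_far (hG : Good G) {H : Finset V} {u t t' : V} (hu : u ∉ H)
    (ht : t ∈ nb G H u) (ht' : t' ∈ nb G H u) (hne : t ≠ t') : ¬ Rch G H t t' := by
  rintro (h | ⟨y, hy, h1, h2⟩)
  · exact hG.tri _ _ _ (mem_nb.1 ht).2 h (mem_nb.1 ht').2
  · exact hne (comm_nb hG hu ht ht' hy h1 h2.symm)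

theorem T_reach (hG : Good G) {H : Finset V} (h19 : H.card = 19) (h4 : ∀ x ∈ H, dg G H x = 4)
    {u t : V} (hu : u ∉ H) (h3 : (nb G H u).card = 3) (ht : t ∈ nb G H u) {z : V} (hz : z ∈ H)
    (hzT : z ∉ nb G H u) : Rch G H t z := by
  have htH := (mem_nb.1 ht).1
  have hsub : (nb G H u).erase t ⊆ H.erase t \ (nb G H t).biUnion (pt G H t) := by
    intro t' ht'
    obtain ⟨hne, ht'⟩ := mem_erase.1 ht'
    have := (mem_nb.1 ht').1
    exact mem_sdiff.2 ⟨mem_erase.2 ⟨hne, this⟩, fun h =>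
      T_far hG hu ht ht' hne.symm ((ball_iff this hne).1 h)⟩
  have heq := eq_of_subset_of_card_le hsub (by
    rw [far_card hG h19 h4 htH, card_erase_of_mem ht, h3])
  have hzt : z ≠ t := by rintro rfl; exact hzT ht
  by_contra hn
  have : z ∈ (nb G H u).erase t := by
    rw [heq]
    exact mem_sdiff.2 ⟨mem_erase.2 ⟨hzt, hz⟩, fun h => hn ((ball_iff hz hzt).1 h)⟩
  exact hzT (mem_erase.1 this).2

theorem key (hG : Good G) {H : Finset V} (h19 : H.card = 19) (h4 : ∀ x ∈ H, dg G H x = 4)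
    {u : V} (hu : u ∉ H) (h3 : (nb G H u).card = 3) {x : V} (hx : x ∈ H)
    (hf : ∀ t ∈ nb G H u, ¬ G.Adj t x) {p : V} (hp : p ∈ H) (hfar : ¬ Rch G H x p) :
    ∀ t ∈ nb G H u, ¬ G.Adj t p := by
  intro t ht htp
  have hex : ∀ b, ∃ y, b ∈ nb G H x → y ∈ nb G H t ∧ (y = b ∨ G.Adj b y) := by
    intro b
    by_cases hb : b ∈ nb G H x
    · have hb' := mem_nb.1 hb
      rcases T_reach hG h19 h4 hu h3 ht hb'.1 (fun h => hf b h hb'.2.symm) with h | ⟨y, hy, h1, h2⟩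
      · exact ⟨b, fun _ => ⟨mem_nb.2 ⟨hb'.1, h⟩, Or.inl rfl⟩⟩
      · exact ⟨y, fun _ => ⟨mem_nb.2 ⟨hy, h1⟩, Or.inr h2.symm⟩⟩
    · exact ⟨b, fun h => absurd h hb⟩
  choose g hg using hex
  have hinj : Set.InjOn g (nb G H x) := by
    intro b hb b' hb' heq
    have hb := Finset.mem_coe.1 hb
    have hb' := Finset.mem_coe.1 hb'
    have a := (mem_nb.1 hb).2
    have a' := (mem_nb.1 hb').2
    have hxy : x ≠ g b := by
      intro h; have := (mem_nb.1 (hg b hb).1).2; rw [← h] at this; exact hf t ht this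
    rcases (hg b hb).2 with h | h <;> rcases (hg b' hb').2 with h' | h'
    · rw [← h, ← h', heq]
    · exfalso; rw [← heq, h] at h'; exact hG.tri _ _ _ a' h' a
    · exfalso; rw [heq, h'] at h; exact hG.tri _ _ _ a h a'
    · rw [← heq] at h'; exact hG.sq x (g b) b b' hxy a h.symm a' h'.symm
  have himg : (nb G H x).image g = nb G H t := by
    apply eq_of_subset_of_card_le
    · intro y hy
      obtain ⟨b, hb, rfl⟩ := mem_image.1 hy
      exact (hg b hb).1
    · rw [card_image_of_injOn hinj]
      exact (h4 t (mem_nb.1 ht).1).trans (h4 x hx).symm |>.le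
  have : p ∈ (nb G H x).image g := by rw [himg]; exact mem_nb.2 ⟨hp, htp⟩
  obtain ⟨b, hb, hbp⟩ := mem_image.1 this
  obtain ⟨hbH, hxb⟩ := mem_nb.1 hb
  apply hfar
  rcases (hg b hb).2 with h | h
  · rw [← hbp, h]; exact Or.inl hxb
  · rw [hbp] at h; exact Or.inr ⟨b, hbH, hxb, h⟩

theorem nonbr (hG : Good G) {H : Finset V} (h19 : H.card = 19) (h4 : ∀ x ∈ H, dg G H x = 4)
    {u : V} (hu : u ∉ H) (h3 : (nb G H u).card = 3) {v : V} (hv : v ∉ H) {t0 t1 : V}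
    (h0 : t0 ∈ nb G H v) (h1 : t1 ∈ nb G H v) (hf : ∀ t ∈ nb G H u, ¬ G.Adj t t0) :
    ∀ t ∈ nb G H u, ¬ G.Adj t t1 := by
  by_cases h : t0 = t1
  · exact h ▸ hf
  · exact key hG h19 h4 hu h3 (mem_nb.1 h0).1 hf (mem_nb.1 h1).1 (T_far hG hv h0 h1 h)

theorem card_S1 (hG : Good G) {H : Finset V} (h4 : ∀ x ∈ H, dg G H x = 4)
    {u : V} (hu : u ∉ H) (h3 : (nb G H u).card = 3) : ((nb G H u).biUnion (nb G H)).card = 12 := by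
  rw [card_biUnion]
  · change ∑ y ∈ nb G H u, dg G H y = 12
    rw [sum_congr rfl (g := fun _ => 4) fun y hy => h4 y (mem_nb.1 hy).1]; simp [h3]
  · intro z hz z' hz' hne
    show Disjoint _ _
    rw [Finset.disjoint_left]
    intro y hy hy'
    exact hne (comm_nb hG hu hz hz' (mem_nb.1 hy).1 (mem_nb.1 hy).2 (mem_nb.1 hy').2)

theorem card_I (hG : Good G) {H : Finset V} (h19 : H.card = 19) (h4 : ∀ x ∈ H, dg G H x = 4)
    {u v : V} (hu : u ∉ H) (hv : v ∉ H) (h3 : (nb G H u).card = 3) (h3' : (nb G H v).card = 3)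
    (hd : Disjoint (nb G H u) (nb G H v)) :
    ((nb G H u).biUnion (nb G H) ∩ (nb G H v).biUnion (nb G H)).card =
      ((nb G H u ×ˢ nb G H v).filter (fun p => ¬ G.Adj p.1 p.2)).card := by
  have hex : ∀ p : V × V, ∃ y, p.1 ∈ nb G H u → p.2 ∈ nb G H v → ¬ G.Adj p.1 p.2 →
      y ∈ H ∧ G.Adj p.1 y ∧ G.Adj p.2 y := by
    rintro ⟨t, t'⟩
    by_cases hh : t ∈ nb G H u ∧ t' ∈ nb G H v ∧ ¬ G.Adj t t'
    · obtain ⟨a, b, c⟩ := hh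
      rcases T_reach hG h19 h4 hu h3 a (mem_nb.1 b).1 (fun h => Finset.disjoint_left.1 hd h b) with h | ⟨y, hy, h1, h2⟩
      · exact absurd h c
      · exact ⟨y, fun _ _ _ => ⟨hy, h1, h2.symm⟩⟩
    · exact ⟨t, fun a b c => absurd ⟨a, b, c⟩ hh⟩
  choose g hg using hex
  symm
  apply card_bij (fun p _ => g p)
  · intro p hp
    obtain ⟨hp, hn⟩ := mem_filter.1 hp
    obtain ⟨a, b⟩ := mem_product.1 hp
    obtain ⟨c, d, e⟩ := hg p a b hn
    exact mem_inter.2 ⟨mem_biUnion.2 ⟨_, a, mem_nb.2 ⟨c, d⟩⟩, mem_biUnion.2 ⟨_, b, mem_nb.2 ⟨c, e⟩⟩⟩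
  · intro p hp p' hp' heq
    obtain ⟨hp, hn⟩ := mem_filter.1 hp
    obtain ⟨a, b⟩ := mem_product.1 hp
    obtain ⟨c, d, e⟩ := hg p a b hn
    obtain ⟨hp', hn'⟩ := mem_filter.1 hp'
    obtain ⟨a', b'⟩ := mem_product.1 hp'
    obtain ⟨c', d', e'⟩ := hg p' a' b' hn'
    rw [← heq] at d' e'
    exact Prod.ext (comm_nb hG hu a a' c d d') (comm_nb hG hv b b' c e e')
  · intro y hy
    obtain ⟨h1, h2⟩ := mem_inter.1 hy
    obtain ⟨t, ht, h1⟩ := mem_biUnion.1 h1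
    obtain ⟨t', ht', h2⟩ := mem_biUnion.1 h2
    obtain ⟨hyH, h1⟩ := mem_nb.1 h1
    obtain ⟨_, h2⟩ := mem_nb.1 h2
    have hn : ¬ G.Adj t t' := fun h => hG.tri _ _ _ h h2 h1
    refine ⟨(t, t'), mem_filter.2 ⟨mem_product.2 ⟨ht, ht'⟩, hn⟩, ?_⟩
    obtain ⟨c, d, e⟩ := hg (t, t') ht ht' hn
    exact hG.sq t t' _ _ (fun h => Finset.disjoint_left.1 hd ht (h ▸ ht')) d e h1 h2

theorem rob (hG : Good G) {H : Finset V} (h19 : H.card = 19) (h4 : ∀ x ∈ H, dg G H x = 4)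
    {u v : V} (hu : u ∉ H) (hv : v ∉ H) (h3 : (nb G H u).card = 3) (h3' : (nb G H v).card = 3)
    (hd : Disjoint (nb G H u) (nb G H v)) : False := by
  have c1 := card_S1 hG h4 hu h3
  have c2 := card_S1 hG h4 hv h3'
  have c3 := card_I hG h19 h4 hu hv h3 h3' hd
  have c4 := card_union_add_card_inter ((nb G H u).biUnion (nb G H)) ((nb G H v).biUnion (nb G H))
  have c5 := card_filter_add_card_filter_not (s := nb G H u ×ˢ nb G H v) (fun p => G.Adj p.1 p.2)
  rw [card_product, h3, h3'] at c5
  set S1 := (nb G H u).biUnion (nb G H) with hS1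
  set S2 := (nb G H v).biUnion (nb G H) with hS2
  have m1 : ∀ x ∈ H, x ∉ S1 → ∀ t ∈ nb G H u, ¬ G.Adj t x := fun x hx h t ht ha =>
    h (mem_biUnion.2 ⟨t, ht, mem_nb.2 ⟨hx, ha⟩⟩)
  have m2 : ∀ x ∈ H, x ∉ S2 → ∀ t ∈ nb G H v, ¬ G.Adj t x := fun x hx h t ht ha =>
    h (mem_biUnion.2 ⟨t, ht, mem_nb.2 ⟨hx, ha⟩⟩)
  have n1 : ∀ x, (∀ t ∈ nb G H u, ¬ G.Adj t x) → x ∉ S1 := fun x hf h => by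
    obtain ⟨t, ht, h⟩ := mem_biUnion.1 h; exact hf t ht (mem_nb.1 h).2
  have n2 : ∀ x, (∀ t ∈ nb G H v, ¬ G.Adj t x) → x ∉ S2 := fun x hf h => by
    obtain ⟨t, ht, h⟩ := mem_biUnion.1 h; exact hf t ht (mem_nb.1 h).2
  have sub : S1 ∪ S2 ⊆ H := by
    intro x hx
    rcases mem_union.1 hx with h | h <;> obtain ⟨t, ht, h⟩ := mem_biUnion.1 h <;> exact (mem_nb.1 h).1
  by_cases hT : ∃ t ∈ nb G H u, ∃ t' ∈ nb G H v, G.Adj t t'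
  · obtain ⟨t, ht, t', ht', hadj⟩ := hT
    have a1 : ∀ s ∈ nb G H v, s ∈ S1 := by
      intro s hs
      by_contra hn
      exact nonbr hG h19 h4 hu h3 hv hs ht' (m1 s (mem_nb.1 hs).1 hn) t ht hadj
    have a2 : ∀ s ∈ nb G H u, s ∈ S2 := by
      intro s hs
      by_contra hn
      exact nonbr hG h19 h4 hv h3' hu hs ht (m2 s (mem_nb.1 hs).1 hn) t' ht' hadj.symm
    have e3 : ((nb G H u ×ˢ nb G H v).filter (fun p => G.Adj p.1 p.2)).card = (nb G H v).card := by
      apply card_bij (fun p _ => p.2)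
      · intro p hp; exact (mem_product.1 (mem_filter.1 hp).1).2
      · intro p hp p' hp' heq
        obtain ⟨hp, hn⟩ := mem_filter.1 hp
        obtain ⟨a, b⟩ := mem_product.1 hp
        obtain ⟨hp', hn'⟩ := mem_filter.1 hp'
        obtain ⟨a', b'⟩ := mem_product.1 hp'
        rw [← heq] at hn'
        exact Prod.ext (comm_nb hG hu a a' (mem_nb.1 b).1 hn hn') heq
      · intro s hs
        obtain ⟨t, ht, h⟩ := mem_biUnion.1 (a1 s hs)
        exact ⟨(t, s), mem_filter.2 ⟨mem_product.2 ⟨ht, hs⟩, (mem_nb.1 h).2⟩, rfl⟩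
    have c6 : (H \ (S1 ∪ S2)).card = 1 := by
      rw [card_sdiff_of_subset sub]; omega
    obtain ⟨x, hx⟩ := card_eq_one.1 c6
    have hxm : x ∈ H \ (S1 ∪ S2) := by rw [hx]; simp
    obtain ⟨hxH, hxS⟩ := mem_sdiff.1 hxm
    obtain ⟨p, hp, hpx, hfar⟩ := far_ex hG h19 h4 hxH
    have p1 := n1 p (key hG h19 h4 hu h3 hxH (m1 x hxH fun h => hxS (mem_union_left _ h)) hp hfar)
    have p2 := n2 p (key hG h19 h4 hv h3' hxH (m2 x hxH fun h => hxS (mem_union_right _ h)) hp hfar)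
    have : p ∈ H \ (S1 ∪ S2) := mem_sdiff.2 ⟨hp, fun h => (mem_union.1 h).elim p1 p2⟩
    rw [hx] at this
    exact hpx (mem_singleton.1 this)
  · push Not at hT
    have e0 : ((nb G H u ×ˢ nb G H v).filter (fun p => G.Adj p.1 p.2)).card = 0 := by
      rw [card_eq_zero, filter_eq_empty_iff]
      intro p hp
      exact hT _ (mem_product.1 hp).1 _ (mem_product.1 hp).2
    have hsub : nb G H u ∪ nb G H v ⊆ H \ (S1 ∪ S2) := by
      intro x hx
      refine mem_sdiff.2 ⟨?_, fun h => ?_⟩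
      · rcases mem_union.1 hx with h | h <;> exact (mem_nb.1 h).1
      · rcases mem_union.1 hx with hx | hx <;> rcases mem_union.1 h with h | h
        · exact n1 x (fun t ht => indep_nb hG subset_rfl t ht x hx) h
        · exact n2 x (fun t ht h => hT x hx t ht h.symm) h
        · exact n1 x (fun t ht h => hT t ht x hx h) h
        · exact n2 x (fun t ht => indep_nb hG subset_rfl t ht x hx) h
    have := card_le_card hsub
    rw [card_union_of_disjoint hd, card_sdiff_of_subset sub] at this
    omega

theorem core (hG : Good G) {S : Finset V} (hS : S.card = 21) (hE : E G S = 88) :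
    (∀ x ∈ S, 3 ≤ dg G S x) ∧ (∀ x ∈ S, dg G S x ≤ 5) ∧
      ∃ x ∈ S, dg G S x = 5 ∧ ∀ y ∈ S, G.Adj x y → 4 ≤ dg G S y := by
  have h3 : ∀ x ∈ S, 3 ≤ dg G S x := fun x hx => by have := dg_lb (bd20 hG) hS hx; omega
  have h5 : ∀ x ∈ S, dg G S x ≤ 5 := fun x hx => by
    have h1 := lb_sum hG h3 hx
    by_contra hne
    have h6 := threes hG h3 hx
    obtain ⟨T, hTS, hT, hE2, hd, hxT⟩ := star_erase (k := 4) hG (x := x) (S := S) (t := 3) (by omega)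
    have h7 := bd17 hG (S \ T) (by rw [card_sdiff_of_subset hTS]; omega)
    omega
  refine ⟨h3, h5, ?_⟩
  have hi : ∀ x ∈ S, ∀ y ∈ S, dg G S x = 3 → dg G S y = 3 → ¬ G.Adj x y := by
    intro x hx y hy h h' ha
    have := two_adj (t := 0) (bd19 hG) hS hx hy ha
    omega
  by_contra! hc
  set A := S.filter (fun x => dg G S x = 3) with hA
  set C := S.filter (fun x => dg G S x = 5) with hC
  have hA2 : A.card ≤ 2 := by
    by_contra hn
    obtain ⟨T, hT, hTc⟩ := exists_subset_card_eq (by omega : 3 ≤ A.card)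
    have hTS : T ⊆ S := hT.trans (filter_subset _ _)
    have := E_sdiff (G := G) (t := 3) T hTS (fun x hx => (mem_filter.1 (hT hx)).2)
      (fun x hx y hy => hi x (hTS hx) y (hTS hy) (mem_filter.1 (hT hx)).2 (mem_filter.1 (hT hy)).2)
    have h7 := bd18 hG (S \ T) (by rw [card_sdiff_of_subset hTS]; omega)
    omega
  have hcnt : E G S + A.card = 4 * S.card + C.card := by
    unfold E
    rw [hA, hC, card_filter, card_filter, ← sum_add_distrib, card_eq_sum_ones S, mul_sum, ← sum_add_distrib]
    apply sum_congr rfl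
    intro x hx
    have := h3 x hx
    have := h5 x hx
    split_ifs <;> omega
  have hCU : C ⊆ A.biUnion (nb G S) := by
    intro x hx
    obtain ⟨hx, hd⟩ := mem_filter.1 hx
    obtain ⟨y, hy, hxy, hdy⟩ := hc x hx hd
    have := h3 y hy
    exact mem_biUnion.2 ⟨y, mem_filter.2 ⟨hy, by omega⟩, mem_nb.2 ⟨hx, hxy.symm⟩⟩
  have hU : (A.biUnion (nb G S)).card ≤ A.card * 3 :=
    card_biUnion_le_card_mul _ _ _ fun x hx => (mem_filter.1 hx).2.le
  have hCU' := card_le_card hCU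
  have hA2' : A.card = 2 := by omega
  have hCeq := eq_of_subset_of_card_le hCU (by omega)
  obtain ⟨u, v, huv, hAe⟩ := card_eq_two.1 hA2'
  have huA : u ∈ A := by rw [hAe]; simp
  have hvA : v ∈ A := by rw [hAe]; simp
  obtain ⟨huS, hdu⟩ := mem_filter.1 huA
  obtain ⟨hvS, hdv⟩ := mem_filter.1 hvA
  have hCe : C = nb G S u ∪ nb G S v := by rw [hCeq, hAe]; simp [biUnion_insert]
  have hdisj : Disjoint (nb G S u) (nb G S v) := by
    rw [← card_union_eq_card_add_card, ← hCe]
    change _ = dg G S u + dg G S v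
    omega
  have hnH : ∀ x, nb G (S \ A) x = nb G S x \ A := by
    intro x; ext z; simp only [mem_nb, mem_sdiff]; tauto
  have nbe : ∀ x ∈ A, nb G (S \ A) x = nb G S x := by
    intro x hx
    rw [hnH]
    apply sdiff_eq_self_of_disjoint
    rw [Finset.disjoint_left]
    intro y hy hyA
    exact hi x (mem_filter.1 hx).1 y (mem_nb.1 hy).1 (mem_filter.1 hx).2 (mem_filter.1 hyA).2 (mem_nb.1 hy).2
  apply rob hG (H := S \ A) (u := u) (v := v)
  · rw [card_sdiff_of_subset (show A ⊆ S from filter_subset _ _)]; omega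
  · intro x hx
    obtain ⟨hxS, hxA⟩ := mem_sdiff.1 hx
    have hH : S \ A = (S.erase u).erase v := by
      rw [hAe]; ext z; simp only [mem_sdiff, mem_insert, mem_singleton, mem_erase]; tauto
    have hvS' : v ∈ S.erase u := mem_erase.2 ⟨huv.symm, hvS⟩
    have hx3 : dg G S x ≠ 3 := fun h => hxA (mem_filter.2 ⟨hxS, h⟩)
    have hx3' := h3 x hxS
    have hx5 := h5 x hxS
    have hCx : dg G S x = 5 ↔ (G.Adj x u ∨ G.Adj x v) := by
      have : x ∈ C ↔ x ∈ nb G S u ∪ nb G S v := by rw [hCe]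
      simpa [hC, mem_nb, hxS, G.adj_comm] using this
    rw [hH]
    by_cases a : G.Adj x u <;> by_cases b : G.Adj x v
    · exact absurd (mem_nb.2 ⟨hxS, b.symm⟩) (Finset.disjoint_left.1 hdisj (mem_nb.2 ⟨hxS, a.symm⟩))
    · have := hCx.2 (Or.inl a)
      rw [dg_erase_nadj b]
      have := dg_erase_adj huS a
      omega
    · have := hCx.2 (Or.inr b)
      have h1 := dg_erase_adj hvS' b
      have h2 := dg_erase_nadj (S := S) a
      omega
    · have : ¬ dg G S x = 5 := fun h => (hCx.1 h).elim a b
      rw [dg_erase_nadj b, dg_erase_nadj a]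
      omega
  · exact fun h => (mem_sdiff.1 h).2 huA
  · exact fun h => (mem_sdiff.1 h).2 hvA
  · rw [nbe u huA]; exact hdu
  · rw [nbe v hvA]; exact hdv
  · rw [nbe u huA, nbe v hvA]; exact hdisj

end St8

theorem good_of_girth_s8 {V : Type*} (G : SimpleGraph V) (hg : GirthAtLeast5 G) : St8.Good G := by
  constructor
  · intro a b c h1 h2 h3
    have := hg (Walk.cons h1 (Walk.cons h2 (Walk.cons h3.symm Walk.nil))) (by
      rw [Walk.isCycle_def, Walk.isTrail_def]
      have := h1.ne; have := h2.ne; have := h3.ne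
      simp_all [Sym2.eq_iff, eq_comm])
    simp at this
  · intro a b x y hab h1 h2 h3 h4
    by_contra hxy
    have := hg (Walk.cons h1 (Walk.cons h2.symm (Walk.cons h4 (Walk.cons h3.symm Walk.nil)))) (by
      rw [Walk.isCycle_def, Walk.isTrail_def]
      have := h1.ne; have := h2.ne; have := h3.ne; have := h4.ne
      simp_all [Sym2.eq_iff, eq_comm])
    simp at this

theorem stmt8 (G : SimpleGraph (Fin 21)) [DecidableRel G.Adj]
    (hg : GirthAtLeast5 G) (he : G.edgeFinset.card = 44) :
    ((G.minDegree, G.maxDegree) = (3, 5) ∨ (G.minDegree, G.maxDegree) = (4, 5)) ∧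
    HasEmbeddedStar G 5 ![3, 3, 3, 3, 3] := by
  have hdg : ∀ x, St8.dg G Finset.univ x = G.degree x := by
    intro x
    rw [← G.card_neighborFinset_eq_degree]
    unfold St8.dg; congr 1; ext y; simp [St8.mem_nb]
  have hE : St8.E G Finset.univ = 88 := by
    unfold St8.E
    rw [Finset.sum_congr rfl fun x _ => hdg x, G.sum_degrees_eq_twice_card_edges, he]
  obtain ⟨h3, h5, x, _, hx, hy⟩ := St8.core (good_of_girth_s8 G hg) (by simp) hE
  simp only [hdg, Finset.mem_univ, forall_true_left] at h3 h5 hx hy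
  constructor
  · have m1 : 3 ≤ G.minDegree := G.le_minDegree_of_forall_le_degree 3 h3
    have m2 : G.maxDegree ≤ 5 := G.maxDegree_le_of_forall_degree_le 5 h5
    have m3 : 5 ≤ G.maxDegree := hx ▸ G.degree_le_maxDegree x
    have m4 : G.minDegree ≤ 4 := by
      by_contra hn
      have h1 : ∑ v : Fin 21, 5 ≤ ∑ v, G.degree v :=
        Finset.sum_le_sum fun v _ => by have := G.minDegree_le_degree v; omega
      rw [G.sum_degrees_eq_twice_card_edges, he] at h1
      simp at h1
    simp only [Prod.mk.injEq]
    omega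
  · have hc : (G.neighborFinset x).card = 5 := by rw [G.card_neighborFinset_eq_degree, hx]
    let e := ((G.neighborFinset x).equivFin.trans (finCongr hc)).symm
    refine ⟨x, fun i => (e i : Fin 21), hx, ?_, ?_, ?_⟩
    · exact Subtype.val_injective.comp e.injective
    · intro i; exact (G.mem_neighborFinset _ _).1 (e i).2
    · intro i
      have := hy _ ((G.mem_neighborFinset _ _).1 (e i).2)
      fin_cases i <;> simpa using this
end

section
/- If Γ is a graph of girth at least 5 on 22 vertices with 47 edges, then (δ(Γ), Δ(Γ)) = (3,5) or (δ(Γ), Δ(Γ)) = (4,5), and in either case Γ has an embedded S_{5,[4,3,3,3,3]} star; that is, Γ has a vertex of degree 5 with one neighbour of degree at least 5 and four neighbours of degree at least 4. -/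
open SimpleGraph

set_option linter.unusedSectionVars false

namespace Girth

structure Good {V : Type*} (A : V → V → Prop) : Prop where
  symm : ∀ {a b}, A a b → A b a
  irr : ∀ {a}, A a a → False
  tri : ∀ {a b c}, A a b → A b c → A a c → False
  c4 : ∀ {a b c d}, A a c → A a d → A b c → A b d → a ≠ b → c = d

section
variable {V : Type*} [DecidableEq V] (A : V → V → Prop) [DecidableRel A]

def nb (S : Finset V) (x : V) : Finset V := S.filter (fun y => A x y)
def dg (S : Finset V) (x : V) : ℕ := (nb A S x).card
def E (S : Finset V) : ℕ := ∑ x ∈ S, dg A S x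

variable {A}

theorem mem_nb {S : Finset V} {x y : V} : y ∈ nb A S x ↔ y ∈ S ∧ A x y := by
  simp [nb]

theorem dg_eq_sum (S : Finset V) (x : V) : dg A S x = ∑ y ∈ S, if A x y then 1 else 0 := by
  simp [dg, nb]

theorem dg_sdiff {S T : Finset V} (h : T ⊆ S) (x : V) :
    dg A (S \ T) x + dg A T x = dg A S x := by
  simp only [dg_eq_sum]
  exact Finset.sum_sdiff h

theorem dg_erase {S : Finset V} {v : V} (h : v ∈ S) (x : V) :
    dg A (S.erase v) x + (if A x v then 1 else 0) = dg A S x := by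
  simp only [dg_eq_sum]
  exact Finset.sum_erase_add _ _ h

theorem dg_mono {S T : Finset V} (h : T ⊆ S) (x : V) : dg A T x ≤ dg A S x :=
  Finset.card_le_card (Finset.filter_subset_filter _ h)

theorem dg_swap (hA : Good A) (S T : Finset V) :
    ∑ x ∈ S, dg A T x = ∑ y ∈ T, dg A S y := by
  simp only [dg_eq_sum]
  rw [Finset.sum_comm]
  refine Finset.sum_congr rfl fun y _ => Finset.sum_congr rfl fun x _ => ?_
  have : A x y ↔ A y x := ⟨hA.symm, hA.symm⟩
  simp [this]

theorem E_sdiff (hA : Good A) {S T : Finset V} (h : T ⊆ S) :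
    E A S = E A (S \ T) + E A T + 2 * ∑ t ∈ T, dg A (S \ T) t := by
  have h1 : E A S = ∑ x ∈ S \ T, dg A S x + ∑ x ∈ T, dg A S x := (Finset.sum_sdiff h).symm
  have h2 : ∀ x, dg A S x = dg A (S \ T) x + dg A T x := fun x => (dg_sdiff h x).symm
  simp only [h2, Finset.sum_add_distrib] at h1
  rw [dg_swap hA (S \ T) T] at h1
  rw [h1]; unfold E; ring

theorem E_indep (hA : Good A) {S T : Finset V} (h : T ⊆ S)
    (hi : ∀ a ∈ T, ∀ b ∈ T, ¬ A a b) :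
    E A S = E A (S \ T) + 2 * ∑ t ∈ T, dg A S t := by
  have h0 : ∀ t ∈ T, dg A T t = 0 := by
    intro t ht
    rw [dg, Finset.card_eq_zero, nb, Finset.filter_eq_empty_iff]
    exact fun b hb => hi t ht b hb
  have h1 := E_sdiff hA h
  have h2 : E A T = 0 := Finset.sum_eq_zero h0
  have h3 : ∑ t ∈ T, dg A S t = ∑ t ∈ T, dg A (S \ T) t := by
    refine Finset.sum_congr rfl fun t ht => ?_
    have := dg_sdiff (A := A) h t
    rw [h0 t ht] at this; omega
  rw [h3]; omega

theorem E_erase (hA : Good A) {S : Finset V} {v : V} (h : v ∈ S) :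
    E A S = E A (S.erase v) + 2 * dg A S v := by
  have := E_indep hA (S := S) (T := {v}) (by simpa using h) (by
    intro a ha b hb hab
    simp only [Finset.mem_singleton] at ha hb
    subst ha; subst hb; exact hA.irr hab)
  simpa [Finset.sdiff_singleton_eq_erase] using this

theorem E_even (hA : Good A) (S : Finset V) : ∃ m, E A S = 2 * m := by
  induction S using Finset.induction_on with
  | empty => exact ⟨0, by simp [E]⟩
  | insert v S hv ih =>
    obtain ⟨m, hm⟩ := ih
    have := E_erase hA (Finset.mem_insert_self v S)
    rw [Finset.erase_insert hv] at this
    exact ⟨m + dg A (insert v S) v, by omega⟩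

theorem exmin {S : Finset V} (h : 0 < S.card) :
    ∃ v ∈ S, (∀ x ∈ S, dg A S v ≤ dg A S x) ∧ S.card * dg A S v ≤ E A S := by
  obtain ⟨v, hv, hm⟩ := Finset.exists_min_image S (dg A S) (Finset.card_pos.1 h)
  exact ⟨v, hv, hm, by simpa [E] using Finset.card_nsmul_le_sum S _ _ hm⟩

/-- double counting -/
theorem reach (hA : Good A) {x : V} {P T : Finset V} (hx : x ∉ P) (hT : ∀ y ∈ T, A x y) :
    (∑ y ∈ T, dg A P y + dg A P x ≤ P.card) ∧
    (∑ y ∈ T, dg A P y + dg A P x = P.card → ∀ p ∈ P, ¬ A x p → ∃ y ∈ T, A y p) := by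
  have hd : (T : Set V).PairwiseDisjoint (nb A P) := by
    intro a ha b hb hab
    rw [Function.onFun, Finset.disjoint_left]
    intro p hp hq
    rw [mem_nb] at hp hq
    have := hA.c4 (hT a ha) (hT b hb) (hA.symm hp.2) (hA.symm hq.2) (by rintro rfl; exact hx hp.1)
    exact hab this
  have hc : (T.biUnion (nb A P)).card = ∑ y ∈ T, dg A P y := Finset.card_biUnion hd
  have hd2 : Disjoint (T.biUnion (nb A P)) (nb A P x) := by
    rw [Finset.disjoint_left]
    intro p hp hq
    rw [Finset.mem_biUnion] at hp
    obtain ⟨y, hy, hp⟩ := hp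
    rw [mem_nb] at hp hq
    exact hA.tri (hT y hy) hp.2 hq.2
  have hs : T.biUnion (nb A P) ∪ nb A P x ⊆ P := by
    intro p hp
    simp only [Finset.mem_union, Finset.mem_biUnion, mem_nb] at hp
    rcases hp with ⟨_, _, h, _⟩ | h
    · exact h
    · exact h.1
  have hcc := Finset.card_union_of_disjoint hd2
  rw [hc] at hcc
  change _ = _ + dg A P x at hcc
  refine ⟨hcc ▸ Finset.card_le_card hs, fun he p hp hn => ?_⟩
  have := Finset.eq_of_subset_of_card_le hs (by omega)
  rw [← this] at hp
  simp only [Finset.mem_union, Finset.mem_biUnion, mem_nb] at hp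
  rcases hp with ⟨y, hy, _, h⟩ | h
  · exact ⟨y, hy, h⟩
  · exact absurd h.2 hn

theorem ball (hA : Good A) {x : V} {S : Finset V} (hx : x ∈ S) :
    (∑ y ∈ nb A S x, dg A S y + 1 ≤ S.card) ∧
    (∑ y ∈ nb A S x, dg A S y + 1 = S.card → ∀ p ∈ S, p ≠ x → ¬ A x p → ∃ y ∈ S, A x y ∧ A y p) := by
  have h := reach hA (x := x) (P := S.erase x) (T := nb A S x) (by simp)
    (fun y hy => (mem_nb.1 hy).2)
  have h1 : ∑ y ∈ nb A S x, dg A S y = ∑ y ∈ nb A S x, dg A (S.erase x) y + dg A S x := by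
    rw [dg, Finset.card_eq_sum_ones, ← Finset.sum_add_distrib]
    refine Finset.sum_congr rfl fun y hy => ?_
    rw [← dg_erase hx y, if_pos (hA.symm (mem_nb.1 hy).2)]
  have h2 : dg A (S.erase x) x = dg A S x := by
    have := dg_erase (A := A) hx x
    rwa [if_neg (fun h => hA.irr h), add_zero] at this
  have h3 := Finset.card_erase_add_one hx
  rw [h2] at h
  refine ⟨by omega, fun he p hp hne hn => ?_⟩
  obtain ⟨y, hy, hyp⟩ := h.2 (by omega) p (by simp [hp, hne]) hn
  rw [mem_nb] at hy
  exact ⟨y, hy.1, hy.2, hyp⟩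

/-- crude form of the ball bound -/
theorem ball_low (hA : Good A) {x : V} {S : Finset V} (hx : x ∈ S) (k : ℕ)
    (hk : ∀ y ∈ S, A x y → k ≤ dg A S y) : dg A S x * k + 1 ≤ S.card := by
  have h := (ball hA hx).1
  have : (nb A S x).card • k ≤ ∑ y ∈ nb A S x, dg A S y :=
    Finset.card_nsmul_le_sum _ _ _ fun y hy => hk y (mem_nb.1 hy).1 (mem_nb.1 hy).2
  rw [smul_eq_mul] at this
  unfold dg at *
  omega

/-- the set of vertices of given degree -/
def D (A : V → V → Prop) [DecidableRel A] (S : Finset V) (k : ℕ) : Finset V :=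
  S.filter (fun x => dg A S x = k)

theorem mem_D {S : Finset V} {k : ℕ} {x : V} : x ∈ D A S k ↔ x ∈ S ∧ dg A S x = k := by
  simp [D]

theorem counts {S : Finset V} (h : ∀ x ∈ S, 3 ≤ dg A S x ∧ dg A S x ≤ 5) :
    (D A S 3).card + (D A S 4).card + (D A S 5).card = S.card ∧
    3 * (D A S 3).card + 4 * (D A S 4).card + 5 * (D A S 5).card = E A S := by
  have h3 : ∀ k, (D A S k).card = ∑ x ∈ S, if dg A S x = k then 1 else 0 := by
    intro k; simp [D]
  simp only [h3, Finset.mul_sum, ← Finset.sum_add_distrib, E]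
  constructor
  · rw [Finset.card_eq_sum_ones]
    refine Finset.sum_congr rfl fun x hx => ?_
    have := h x hx
    have : dg A S x = 3 ∨ dg A S x = 4 ∨ dg A S x = 5 := by omega
    rcases this with h | h | h <;> simp [h]
  · refine Finset.sum_congr rfl fun x hx => ?_
    have := h x hx
    have : dg A S x = 3 ∨ dg A S x = 4 ∨ dg A S x = 5 := by omega
    rcases this with h | h | h <;> simp [h]

theorem two_of {T : Finset V} (h : 2 ≤ T.card) : ∃ a ∈ T, ∃ b ∈ T, a ≠ b := by
  obtain ⟨a, ha, b, hb, h⟩ := Finset.one_lt_card.1 h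
  exact ⟨a, ha, b, hb, h⟩

/-- two distinct vertices have at most one common neighbour -/
theorem codeg (hA : Good A) {a b : V} (hab : a ≠ b) {T : Finset V}
    (ha : ∀ t ∈ T, A a t) (hb : ∀ t ∈ T, A b t) : T.card ≤ 1 := by
  rw [Finset.card_le_one]
  exact fun c hc d hd => hA.c4 (ha c hc) (ha d hd) (hb c hc) (hb d hd) hab

theorem exlt {S : Finset V} {k : ℕ} (h : E A S < S.card * k) : ∃ v ∈ S, dg A S v < k := by
  by_contra hc
  push Not at hc
  have := Finset.card_nsmul_le_sum S _ _ hc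
  rw [smul_eq_mul] at this; exact absurd h (not_lt.2 this)

theorem exgt {S : Finset V} {k : ℕ} (h : S.card * k < E A S) : ∃ v ∈ S, k < dg A S v := by
  by_contra hc
  push Not at hc
  have := Finset.sum_le_card_nsmul S _ _ hc
  rw [smul_eq_mul] at this; exact absurd h (not_lt.2 this)

theorem sum_dg_sq (hA : Good A) (S : Finset V) :
    ∑ x ∈ S, ∑ y ∈ nb A S x, dg A S y = ∑ y ∈ S, dg A S y * dg A S y := by
  have h1 : ∀ x ∈ S, ∑ y ∈ nb A S x, dg A S y = ∑ y ∈ S, if A y x then dg A S y else 0 := by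
    intro x _
    rw [nb, Finset.sum_filter]
    refine Finset.sum_congr rfl fun y _ => ?_
    have : A x y ↔ A y x := ⟨hA.symm, hA.symm⟩
    simp [this]
  rw [Finset.sum_congr rfl h1, Finset.sum_comm]
  refine Finset.sum_congr rfl fun y _ => ?_
  rw [← Finset.sum_filter, Finset.sum_const, smul_eq_mul]
  rfl

theorem B10 (hA : Good A) {S : Finset V} (hS : S.card = 10) :
    E A S ≤ 30 ∧ (E A S = 30 → ∀ x ∈ S, dg A S x = 3) := by
  have h1 : ∑ x ∈ S, ∑ y ∈ nb A S x, dg A S y ≤ ∑ x ∈ S, 9 :=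
    Finset.sum_le_sum fun x hx => by have := (ball hA hx).1; omega
  rw [sum_dg_sq hA] at h1
  simp only [Finset.sum_const, hS, smul_eq_mul] at h1
  have h2 : ∑ y ∈ S, ((dg A S y : ℤ) - 3) ^ 2 = (∑ y ∈ S, dg A S y * dg A S y : ℕ) - 6 * (E A S : ℤ) + 90 := by
    have : ∀ y ∈ S, ((dg A S y : ℤ) - 3) ^ 2 = (dg A S y : ℤ) * dg A S y - 6 * dg A S y + 9 := by
      intro y _; ring
    rw [Finset.sum_congr rfl this, Finset.sum_add_distrib, Finset.sum_sub_distrib, ← Finset.mul_sum]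
    simp [hS, E]
  have h3 : 0 ≤ ∑ y ∈ S, ((dg A S y : ℤ) - 3) ^ 2 := Finset.sum_nonneg fun _ _ => sq_nonneg _
  refine ⟨by omega, fun he x hx => ?_⟩
  have h4 : ∑ y ∈ S, ((dg A S y : ℤ) - 3) ^ 2 = 0 := by omega
  have := (Finset.sum_eq_zero_iff_of_nonneg (fun _ _ => sq_nonneg _)).1 h4 x hx
  have := pow_eq_zero_iff (two_ne_zero) |>.1 this
  omega

/-- deleting one vertex -/
theorem del {m n : ℕ} (hA : Good A) (hB : ∀ T : Finset V, T.card = n → E A T ≤ m) {S : Finset V}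
    (hS : S.card = n + 1) {v : V} (hv : v ∈ S) : E A S ≤ m + 2 * dg A S v := by
  have := E_erase hA hv
  have := hB (S.erase v) (by rw [Finset.card_erase_of_mem hv]; omega)
  omega

theorem card_er {n : ℕ} {S : Finset V} (hS : S.card = n + 1) {v : V} (hv : v ∈ S) :
    (S.erase v).card = n := by rw [Finset.card_erase_of_mem hv]; omega

theorem dg_er_adj {S : Finset V} {v x : V} (h : v ∈ S) (hx : A x v) :
    dg A (S.erase v) x + 1 = dg A S x := by
  have := dg_erase (A := A) h x
  rwa [if_pos hx] at this

theorem dg_er_nadj {S : Finset V} {v x : V} (h : v ∈ S) (hx : ¬ A x v) :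
    dg A (S.erase v) x = dg A S x := by
  have := dg_erase (A := A) h x
  rwa [if_neg hx] at this

theorem B11 (hA : Good A) (S : Finset V) (hS : S.card = 11) : E A S ≤ 32 := by
  obtain ⟨m, hm⟩ := E_even hA S
  by_contra hc
  have hd := fun v (hv : v ∈ S) => del hA (fun T hT => (B10 hA hT).1) hS hv
  obtain ⟨v, hv, hmin, hE⟩ := exmin (A := A) (S := S) (by omega)
  have hdv := hd v hv
  rw [hS] at hE
  by_cases h3 : dg A S v = 3
  · obtain ⟨x, hx, h4⟩ := exgt (A := A) (S := S) (k := 3) (by rw [hS]; omega)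
    have := ball_low hA hx 3 (fun y hy _ => h3 ▸ hmin y hy)
    omega
  · have h2 : dg A S v = 2 := by omega
    have hr := (B10 hA (card_er hS hv)).2 (by have := E_erase hA hv; omega)
    have : 0 < (nb A S v).card := by change 0 < dg A S v; omega
    obtain ⟨x, hx⟩ := Finset.card_pos.1 this
    rw [mem_nb] at hx
    have hxv : x ∈ S.erase v := by
      refine Finset.mem_erase.2 ⟨?_, hx.1⟩
      rintro rfl; exact hA.irr hx.2
    have hx4 := dg_er_adj hv (hA.symm hx.2)
    rw [hr x hxv] at hx4
    have hb := (ball hA hx.1).1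
    have hv' : v ∈ nb A S x := mem_nb.2 ⟨hv, hA.symm hx.2⟩
    rw [← Finset.add_sum_erase _ _ hv'] at hb
    have hlow : ((nb A S x).erase v).card • 3 ≤ ∑ y ∈ (nb A S x).erase v, dg A S y := by
      refine Finset.card_nsmul_le_sum _ _ _ fun y hy => ?_
      rw [Finset.mem_erase, mem_nb] at hy
      have := hr y (Finset.mem_erase.2 ⟨hy.1, hy.2.1⟩)
      have := dg_mono (A := A) (Finset.erase_subset v S) y
      omega
    rw [Finset.card_erase_of_mem hv', smul_eq_mul] at hlow
    change (dg A S x - 1) * 3 ≤ _ at hlow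
    omega

theorem B12 (hA : Good A) (S : Finset V) (hS : S.card = 12) : E A S ≤ 36 := by
  obtain ⟨m, hm⟩ := E_even hA S
  by_contra hc
  have hd := fun v (hv : v ∈ S) => del hA (B11 hA) hS hv
  obtain ⟨x, hx, h4⟩ := exgt (A := A) (S := S) (k := 3) (by rw [hS]; omega)
  have := ball_low hA hx 3 (fun y hy _ => by have := hd y hy; omega)
  omega

theorem B13 (hA : Good A) (S : Finset V) (hS : S.card = 13) : E A S ≤ 42 := by
  obtain ⟨m, hm⟩ := E_even hA S
  have hd := fun v (hv : v ∈ S) => del hA (B12 hA) hS hv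
  obtain ⟨v, hv, hmin, hE⟩ := exmin (A := A) (S := S) (by omega)
  have hdv := hd v hv
  rw [hS] at hE
  omega

theorem B14 (hA : Good A) (S : Finset V) (hS : S.card = 14) : E A S ≤ 46 := by
  obtain ⟨m, hm⟩ := E_even hA S
  by_contra hc
  have hd := fun v (hv : v ∈ S) => del hA (B13 hA) hS hv
  obtain ⟨v, hv, hmin, hE⟩ := exmin (A := A) (S := S) (by omega)
  have hdv := hd v hv
  rw [hS] at hE
  have h48 : E A S = 48 := by omega
  have h3 : ∀ x ∈ S, 3 ≤ dg A S x := fun x hx => by have := hd x hx; omega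
  have h4 : ∀ x ∈ S, dg A S x ≤ 4 := fun x hx => by
    have := ball_low hA hx 3 (fun y hy _ => h3 y hy); omega
  have hct := counts (A := A) (S := S) (fun x hx => ⟨h3 x hx, (h4 x hx).trans (by norm_num)⟩)
  have h5 : (D A S 5).card = 0 := by
    rw [Finset.card_eq_zero, Finset.eq_empty_iff_forall_notMem]
    intro x hx; rw [mem_D] at hx; have := h4 x hx.1; omega
  -- 3s are independent
  have hind : ∀ x ∈ S, dg A S x = 3 → ∀ y ∈ S, A x y → dg A S y = 4 := by
    intro x hx hx3 y hy hxy
    have hyx : y ∈ S.erase x := by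
      refine Finset.mem_erase.2 ⟨?_, hy⟩
      rintro rfl; exact hA.irr hxy
    have h1 := del hA (B12 hA) (card_er hS hx) hyx
    have h2 := E_erase hA hx
    have h6 := dg_er_adj hx (hA.symm hxy)
    have := h4 y hy
    omega
  obtain ⟨x, hx, h4x⟩ := exgt (A := A) (S := S) (k := 3) (by rw [hS]; omega)
  have hx4 : dg A S x = 4 := by have := h4 x hx; omega
  have hb := (ball hA hx).1
  have hr := (reach hA (x := x) (P := (D A S 4).erase x) (T := nb A S x) (by simp)
    (fun y hy => (mem_nb.1 hy).2)).1
  have hxD : x ∈ D A S 4 := mem_D.2 ⟨hx, hx4⟩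
  rw [Finset.card_erase_of_mem hxD] at hr
  -- each neighbour y has 2 dg P y ≥ ... 
  have key : ∀ y ∈ nb A S x, 8 ≤ dg A ((D A S 4).erase x) y + 2 * dg A S y := by
    intro y hy
    rw [mem_nb] at hy
    have h33 := h3 y hy.1
    have h44 := h4 y hy.1
    rcases (show dg A S y = 3 ∨ dg A S y = 4 by omega) with h | h
    · have : dg A (S.erase x) y ≤ dg A ((D A S 4).erase x) y := by
        refine Finset.card_le_card fun z hz => ?_
        rw [mem_nb, Finset.mem_erase] at hz ⊢
        exact ⟨⟨hz.1.1, mem_D.2 ⟨hz.1.2, hind y hy.1 h z hz.1.2 hz.2⟩⟩, hz.2⟩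
      have := dg_er_adj hx (hA.symm hy.2)
      omega
    · omega
  have := Finset.card_nsmul_le_sum _ _ _ key
  rw [Finset.sum_add_distrib, ← Finset.mul_sum, smul_eq_mul] at this
  change dg A S x * 8 ≤ _ at this
  omega

theorem B15 (hA : Good A) (S : Finset V) (hS : S.card = 15) : E A S ≤ 52 ∧
    (E A S = 52 → ∀ x ∈ S, 3 ≤ dg A S x ∧ dg A S x ≤ 4) := by
  obtain ⟨m, hm⟩ := E_even hA S
  have hd := fun v (hv : v ∈ S) => del hA (B14 hA) hS hv
  obtain ⟨v, hv, hmin, hE⟩ := exmin (A := A) (S := S) (by omega)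
  have hdv := hd v hv
  rw [hS] at hE
  refine ⟨by omega, fun he => ?_⟩
  have h3 : ∀ x ∈ S, 3 ≤ dg A S x := fun x hx => by have := hd x hx; omega
  intro x hx
  have := ball_low hA hx 3 (fun y hy _ => h3 y hy)
  have := h3 x hx
  omega

/-- common step: all vertex-deleted subgraphs at 3-vertices have degrees in {3,4} -/
theorem step (hA : Good A) {S : Finset V} {v : V} (hv : v ∈ S) (hv3 : dg A S v = 3)
    (hdel : ∀ u ∈ S, dg A S u = 3 → ∀ x ∈ S.erase u, 3 ≤ dg A (S.erase u) x ∧ dg A (S.erase u) x ≤ 4) :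
    (∀ x ∈ S, 3 ≤ dg A S x ∧ dg A S x ≤ 5) ∧
    (∀ x ∈ S, dg A S x = 3 → ∀ y ∈ S, dg A S y = 3 → ¬ A x y) ∧
    (∀ x ∈ S, dg A S x = 5 → ∀ y ∈ S, dg A S y = 3 → A x y) ∧
    (2 ≤ (D A S 3).card → (D A S 5).card ≤ 1) := by
  have h3 : ∀ x ∈ S, dg A S x = 5 → ∀ y ∈ S, dg A S y = 3 → A x y := by
    intro x hx h5 y hy hy3
    by_contra hxy
    have hxe : x ∈ S.erase y := Finset.mem_erase.2 ⟨by rintro rfl; omega, hx⟩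
    have := hdel y hy hy3 x hxe
    rw [dg_er_nadj hy hxy] at this
    omega
  refine ⟨?_, ?_, h3, ?_⟩
  · intro x hx
    by_cases hxv : x = v
    · subst hxv; omega
    have := hdel v hv hv3 x (Finset.mem_erase.2 ⟨hxv, hx⟩)
    have := dg_erase (A := A) hv x
    split_ifs at this <;> omega
  · intro x hx hx3 y hy hy3 hxy
    have hyx : y ∈ S.erase x := by
      refine Finset.mem_erase.2 ⟨?_, hy⟩
      rintro rfl; exact hA.irr hxy
    have h1 := hdel x hx hx3 y hyx
    have := dg_er_adj hx (hA.symm hxy)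
    omega
  · intro h
    by_contra hc
    obtain ⟨a, ha, b, hb, hab⟩ := two_of (T := D A S 5) (by omega)
    rw [mem_D] at ha hb
    have := codeg hA hab (T := D A S 3)
      (fun t ht => h3 a ha.1 ha.2 t (mem_D.1 ht).1 (mem_D.1 ht).2)
      (fun t ht => h3 b hb.1 hb.2 t (mem_D.1 ht).1 (mem_D.1 ht).2)
    omega

theorem le4_of {S : Finset V} (h5 : (D A S 5).card = 0)
    (h : ∀ x ∈ S, 3 ≤ dg A S x ∧ dg A S x ≤ 5) :
    ∀ x ∈ S, 3 ≤ dg A S x ∧ dg A S x ≤ 4 := by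
  intro x hx
  have := h x hx
  refine ⟨this.1, ?_⟩
  by_contra hc
  have : x ∈ D A S 5 := mem_D.2 ⟨hx, by omega⟩
  rw [Finset.card_eq_zero] at h5
  simp [h5] at this

theorem B16 (hA : Good A) (S : Finset V) (hS : S.card = 16) : E A S ≤ 58 ∧
    (E A S = 58 → (∀ x ∈ S, 3 ≤ dg A S x ∧ dg A S x ≤ 4) ∧
      (∀ x ∈ S, dg A S x = 3 → ∀ y ∈ S, dg A S y = 3 → ¬ A x y) ∧ (D A S 3).card = 6) := by
  obtain ⟨m, hm⟩ := E_even hA S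
  have hd := fun v (hv : v ∈ S) => del hA (fun T hT => (B15 hA T hT).1) hS hv
  obtain ⟨v, hv, hmin, hE⟩ := exmin (A := A) (S := S) (by omega)
  have hdv := hd v hv
  rw [hS] at hE
  refine ⟨by omega, fun he => ?_⟩
  obtain ⟨s1, s2, s3, s4⟩ := step hA hv (by omega) (fun u hu hu3 =>
    (B15 hA _ (card_er hS hu)).2 (by have := E_erase hA hu; omega))
  have hct := counts s1
  have h5 : (D A S 5).card = 0 := by
    by_contra h
    obtain ⟨x, hx⟩ := Finset.card_pos.1 (Nat.pos_of_ne_zero h)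
    rw [mem_D] at hx
    have hle : (D A S 3).card ≤ dg A S x := Finset.card_le_card fun y hy => by
      rw [mem_D] at hy
      exact mem_nb.2 ⟨hy.1, s3 x hx.1 hx.2 y hy.1 hy.2⟩
    omega
  exact ⟨le4_of h5 s1, s2, by omega⟩

theorem B17 (hA : Good A) (S : Finset V) (hS : S.card = 17) : E A S ≤ 64 ∧
    (E A S = 64 → (∀ x ∈ S, 3 ≤ dg A S x ∧ dg A S x ≤ 4) ∧
      (∀ x ∈ S, dg A S x = 3 → ∀ y ∈ S, dg A S y = 3 → ¬ A x y) ∧ (D A S 3).card = 4) := by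
  obtain ⟨m, hm⟩ := E_even hA S
  have hd := fun v (hv : v ∈ S) => del hA (fun T hT => (B16 hA T hT).1) hS hv
  obtain ⟨v, hv, hmin, hE⟩ := exmin (A := A) (S := S) (by omega)
  have hdv := hd v hv
  rw [hS] at hE
  refine ⟨by omega, fun he => ?_⟩
  obtain ⟨s1, s2, s3, s4⟩ := step hA hv (by omega) (fun u hu hu3 =>
    ((B16 hA _ (card_er hS hu)).2 (by have := E_erase hA hu; omega)).1)
  have hct := counts s1
  have h5 : (D A S 5).card = 0 := by
    by_contra h
    obtain ⟨x, hx⟩ := Finset.card_pos.1 (Nat.pos_of_ne_zero h)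
    rw [mem_D] at hx
    have hadj : ∀ y ∈ D A S 3, A x y := fun y hy => by
      rw [mem_D] at hy
      exact s3 x hx.1 hx.2 y hy.1 hy.2
    -- delete the five 3-vertices, then x
    have hsub : D A S 3 ⊆ S := Finset.filter_subset _ _
    have h1 := E_indep hA hsub (fun a ha b hb => by
      rw [mem_D] at ha hb; exact s2 a ha.1 ha.2 b hb.1 hb.2)
    have h2 : ∑ t ∈ D A S 3, dg A S t = ∑ t ∈ D A S 3, 3 :=
      Finset.sum_congr rfl fun t ht => (mem_D.1 ht).2
    rw [Finset.sum_const, smul_eq_mul] at h2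
    have hx' : x ∈ S \ D A S 3 := Finset.mem_sdiff.2 ⟨hx.1, fun h => by
      have := (mem_D.1 h).2; omega⟩
    have h3 := E_erase hA hx'
    have h4 := dg_sdiff (A := A) hsub x
    have h6 : dg A (D A S 3) x = (D A S 3).card := by
      rw [dg, nb, Finset.filter_true_of_mem hadj]
    have h7 := Finset.card_sdiff_of_subset hsub
    have h8 := Finset.card_erase_of_mem hx'
    have := B11 hA ((S \ D A S 3).erase x) (by omega)
    omega
  exact ⟨le4_of h5 s1, s2, by omega⟩

theorem uniq {T : Finset V} {n : ℕ} (hT : T.card = n + 1) {f : V → ℕ} (h1 : ∀ x ∈ T, f x ≤ 1)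
    (hs : ∑ x ∈ T, f x = n) : ∃ w ∈ T, f w = 0 ∧ ∀ l ∈ T, l ≠ w → f l = 1 := by
  have : ∃ w ∈ T, f w = 0 := by
    by_contra hc
    push Not at hc
    have := Finset.card_nsmul_le_sum T f 1 (fun x hx => Nat.one_le_iff_ne_zero.2 (hc x hx))
    have this' : T.card • 1 ≤ ∑ x ∈ T, f x := this
    rw [smul_eq_mul] at this'; omega
  obtain ⟨w, hw, hw0⟩ := this
  refine ⟨w, hw, hw0, fun l hl hlw => ?_⟩
  by_contra hc
  have hl0 : f l = 0 := by have := h1 l hl; omega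
  have hl' : l ∈ T.erase w := Finset.mem_erase.2 ⟨hlw, hl⟩
  rw [← Finset.add_sum_erase _ _ hw, ← Finset.add_sum_erase _ _ hl', hw0, hl0] at hs
  have : ∑ x ∈ (T.erase w).erase l, f x ≤ _ := Finset.sum_le_card_nsmul ((T.erase w).erase l) f 1 (fun x hx =>
    h1 x (Finset.mem_of_mem_erase (Finset.mem_of_mem_erase hx)))
  rw [Finset.card_erase_of_mem hl', Finset.card_erase_of_mem hw, smul_eq_mul] at this
  have : 0 < (T.erase w).card := Finset.card_pos.2 ⟨l, hl'⟩
  rw [Finset.card_erase_of_mem hw] at this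
  omega

theorem pigeon {T : Finset V} (hT : T.card = 3) {p q x y : V} (hp : p ∈ T) (hq : q ∈ T)
    (hx : x ∈ T) (hy : y ∈ T) (hpq : p ≠ q) (hxp : x ≠ p) (hxq : x ≠ q) (hyp : y ≠ p)
    (hyq : y ≠ q) : x = y := by
  by_contra hxy
  have hs : ({p, q, x, y} : Finset V) ⊆ T := by
    intro z hz
    simp only [Finset.mem_insert, Finset.mem_singleton] at hz
    rcases hz with rfl | rfl | rfl | rfl <;> assumption
  have := Finset.card_le_card hs
  have h4 : ({p, q, x, y} : Finset V).card = 4 := by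
    rw [Finset.card_insert_of_notMem, Finset.card_insert_of_notMem, Finset.card_insert_of_notMem,
      Finset.card_singleton]
    · simpa using hxy
    · simp [hxq.symm, hyq.symm]
    · simp [hpq, hxp.symm, hyp.symm]
  omega

theorem dg_pos {P : Finset V} {x : V} (h : 0 < dg A P x) : ∃ y ∈ P, A x y := by
  obtain ⟨y, hy⟩ := Finset.card_pos.1 h
  exact ⟨y, (mem_nb.1 hy).1, (mem_nb.1 hy).2⟩

theorem dg_zero {P : Finset V} {x : V} (h : dg A P x = 0) : ∀ y ∈ P, ¬ A x y := by
  intro y hy hxy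
  have : y ∈ nb A P x := mem_nb.2 ⟨hy, hxy⟩
  rw [dg, Finset.card_eq_zero] at h
  simp [h] at this

theorem pos_dg {P : Finset V} {x y : V} (hy : y ∈ P) (h : A x y) : 0 < dg A P x :=
  Finset.card_pos.2 ⟨y, mem_nb.2 ⟨hy, h⟩⟩

theorem dg_le_one (hA : Good A) {P : Finset V} {v x : V} (hP : ∀ p ∈ P, A v p) (h : x ≠ v) :
    dg A P x ≤ 1 :=
  codeg hA h (fun _ ht => (mem_nb.1 ht).2) (fun t ht => hP t (mem_nb.1 ht).1)

theorem exu {P : Finset V} {x y : V} (h : dg A P x = 2) (hy : y ∈ P) (hxy : A x y) :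
    ∃ z ∈ P, A x z ∧ z ≠ y := by
  have hy' : y ∈ nb A P x := mem_nb.2 ⟨hy, hxy⟩
  have : 0 < ((nb A P x).erase y).card := by
    rw [Finset.card_erase_of_mem hy']; change 0 < dg A P x - 1; omega
  obtain ⟨z, hz⟩ := Finset.card_pos.1 this
  rw [Finset.mem_erase, mem_nb] at hz
  exact ⟨z, hz.2.1, hz.2.2, hz.1⟩

theorem grid (hA : Good A) {H : Finset V} (hH : H.card = 16) (hE : E A H = 58) {v1 v2 : V}
    (hv1 : v1 ∉ H) (hv2 : v2 ∉ H) (h1 : dg A H v1 = 3) (h2 : dg A H v2 = 3)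
    (hdis : ∀ x ∈ H, A v1 x → A v2 x → False)
    (ha3 : ∀ x ∈ H, A v1 x → dg A H x = 3) (hb3 : ∀ x ∈ H, A v2 x → dg A H x = 3) : False := by
  obtain ⟨h34, hind, hn3⟩ := (B16 hA H hH).2 hE
  obtain ⟨A1, hA1⟩ : ∃ X, X = nb A H v1 := ⟨_, rfl⟩
  obtain ⟨B1, hB1⟩ : ∃ X, X = nb A H v2 := ⟨_, rfl⟩
  have mA : ∀ x, x ∈ A1 ↔ x ∈ H ∧ A v1 x := fun x => by rw [hA1]; exact mem_nb
  have mB : ∀ x, x ∈ B1 ↔ x ∈ H ∧ A v2 x := fun x => by rw [hB1]; exact mem_nb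
  have cA : A1.card = 3 := by rw [hA1]; exact h1
  have cB : B1.card = 3 := by rw [hB1]; exact h2
  have dAB : Disjoint A1 B1 := Finset.disjoint_left.2 fun x hx hy =>
    hdis x ((mA x).1 hx).1 ((mA x).1 hx).2 ((mB x).1 hy).2
  have sAB : A1 ∪ B1 ⊆ H := fun x hx => by
    rcases Finset.mem_union.1 hx with h | h
    · exact ((mA x).1 h).1
    · exact ((mB x).1 h).1
  have cAB : (A1 ∪ B1).card = 6 := by rw [Finset.card_union_of_disjoint dAB]; omega
  have eD : A1 ∪ B1 = D A H 3 := by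
    apply Finset.eq_of_subset_of_card_le
    · intro x hx
      refine mem_D.2 ⟨sAB hx, ?_⟩
      rcases Finset.mem_union.1 hx with h | h
      · exact ha3 x (sAB hx) ((mA x).1 h).2
      · exact hb3 x (sAB hx) ((mB x).1 h).2
    · omega
  obtain ⟨L, hL⟩ : ∃ X, X = H \ (A1 ∪ B1) := ⟨_, rfl⟩
  have cL : L.card = 10 := by rw [hL, Finset.card_sdiff_of_subset sAB]; omega
  have mL : ∀ x ∈ L, x ∈ H ∧ dg A H x = 4 := by
    intro x hx
    rw [hL, Finset.mem_sdiff] at hx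
    refine ⟨hx.1, ?_⟩
    have := h34 x hx.1
    rcases (show dg A H x = 3 ∨ dg A H x = 4 by omega) with h | h
    · exact absurd (eD ▸ mem_D.2 ⟨hx.1, h⟩) hx.2
    · exact h
  have split : ∀ x, dg A L x + dg A A1 x + dg A B1 x = dg A H x := by
    intro x
    have e1 := dg_sdiff (A := A) sAB x
    have e2 := dg_sdiff (A := A) (Finset.subset_union_left (s₁ := A1) (s₂ := B1)) x
    rw [Finset.union_sdiff_cancel_left dAB] at e2
    rw [hL]; omega
  have kA : ∀ l ∈ L, dg A A1 l ≤ 1 := fun l hl =>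
    dg_le_one hA (v := v1) (fun p hp => ((mA p).1 hp).2) (by rintro rfl; exact hv1 (mL _ hl).1)
  have kB : ∀ l ∈ L, dg A B1 l ≤ 1 := fun l hl =>
    dg_le_one hA (v := v2) (fun p hp => ((mB p).1 hp).2) (by rintro rfl; exact hv2 (mL _ hl).1)
  have k1 : ∀ l ∈ L, 1 ≤ dg A A1 l + dg A B1 l := by
    intro l hl
    by_contra hc
    have hs := split l
    have := ball_low hA (mL l hl).1 4 (fun y hy hly => by
      by_cases hyL : y ∈ L
      · exact (mL y hyL).2.ge
      · have : y ∈ A1 ∪ B1 := by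
          by_contra h; exact hyL (by rw [hL]; exact Finset.mem_sdiff.2 ⟨hy, h⟩)
        rcases Finset.mem_union.1 this with h | h
        · have := pos_dg h hly; omega
        · have := pos_dg h hly; omega)
    have := (mL l hl).2
    omega
  have d3L : ∀ a ∈ A1 ∪ B1, dg A L a = 3 := by
    intro a ha
    have ha' := mem_D.1 (eD ▸ ha)
    have hz : ∀ P : Finset V, P ⊆ A1 ∪ B1 → dg A P a = 0 := by
      intro P hP
      by_contra hc
      obtain ⟨y, hy, hay⟩ := dg_pos (Nat.pos_of_ne_zero hc)
      have hy' := mem_D.1 (eD ▸ hP hy)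
      exact hind a ha'.1 ha'.2 y hy'.1 hy'.2 hay
    have := split a
    have := hz A1 Finset.subset_union_left
    have := hz B1 Finset.subset_union_right
    omega
  have sA : ∑ l ∈ L, dg A A1 l = 9 := by
    rw [dg_swap hA, Finset.sum_congr rfl (fun a ha => d3L a (Finset.mem_union_left _ ha))]
    simp [cA]
  have sB : ∑ l ∈ L, dg A B1 l = 9 := by
    rw [dg_swap hA, Finset.sum_congr rfl (fun a ha => d3L a (Finset.mem_union_right _ ha))]
    simp [cB]
  obtain ⟨w, hwL, hwA, hα⟩ := uniq cL kA sA
  obtain ⟨w', hwL', hwB, hβ⟩ := uniq cL kB sB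
  have hww : w ≠ w' := by
    rintro rfl; have := k1 w hwL; omega
  obtain ⟨b1, hb1, hwb1⟩ := dg_pos (A := A) (P := B1) (x := w) (by rw [hβ w hwL hww]; norm_num)
  obtain ⟨a1, ha1, hwa1⟩ := dg_pos (A := A) (P := A1) (x := w') (by rw [hα w' hwL' hww.symm]; norm_num)
  have exA : ∀ l ∈ L, l ≠ w → ∃ a ∈ A1, A l a := fun l hl h => dg_pos (by rw [hα l hl h]; norm_num)
  have exB : ∀ l ∈ L, l ≠ w' → ∃ a ∈ B1, A l a := fun l hl h => dg_pos (by rw [hβ l hl h]; norm_num)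
  have adjw : A w w' := by
    by_contra hc
    have hr := (reach hA (x := w) (P := B1.erase b1) (T := nb A L w)
      (fun h => by
        have h := Finset.mem_of_mem_erase h
        have := (mL w hwL).2
        have := hb3 w ((mB w).1 h).1 ((mB w).1 h).2
        omega)
      (fun y hy => (mem_nb.1 hy).2)).1
    have := Finset.card_nsmul_le_sum (nb A L w) (fun y => dg A (B1.erase b1) y) 1 (fun y hy => by
      rw [mem_nb] at hy
      obtain ⟨b, hb, hyb⟩ := exB y hy.1 (by rintro rfl; exact hc hy.2)
      exact pos_dg (Finset.mem_erase.2 ⟨by rintro rfl; exact hA.tri hy.2 hyb hwb1, hb⟩) hyb)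
    rw [Finset.card_erase_of_mem hb1] at hr
    have e := split w
    rw [hwA, hβ w hwL hww, (mL w hwL).2] at e
    rw [smul_eq_mul, mul_one] at this
    change dg A L w ≤ _ at this
    omega
  have nwAB : ∀ l ∈ L, l ∉ A1 ∪ B1 := fun l hl => by
    rw [hL, Finset.mem_sdiff] at hl; exact hl.2
  have nwA : ∀ a ∈ A1, ¬ A w a := dg_zero hwA
  have nwB : ∀ a ∈ B1, ¬ A w' a := dg_zero hwB
  -- the cell c
  have exc : ∃ c ∈ L, A a1 c ∧ c ≠ w' ∧ ¬ A c b1 := by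
    by_contra hc
    push Not at hc
    have hw1 : w' ∈ nb A L a1 := mem_nb.2 ⟨hwL', hA.symm hwa1⟩
    have := codeg hA (a := a1) (b := b1) (T := (nb A L a1).erase w')
      (by rintro rfl; exact (Finset.disjoint_left.1 dAB) ha1 hb1)
      (fun t ht => (mem_nb.1 (Finset.mem_of_mem_erase ht)).2)
      (fun t ht => by
        rw [Finset.mem_erase, mem_nb] at ht
        exact hA.symm (hc t ht.2.1 ht.2.2 ht.1))
    rw [Finset.card_erase_of_mem hw1] at this
    have := d3L a1 (Finset.mem_union_left _ ha1)
    unfold dg at this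
    omega
  obtain ⟨c, hc, hac, hcw', hcb⟩ := exc
  have hcw : c ≠ w := by rintro rfl; exact nwA a1 ha1 (hA.symm hac)
  have ncw : ¬ A c w := fun h => by
    have := hA.c4 (hA.symm h) adjw hac (hA.symm hwa1) (fun e => nwAB w hwL (Finset.mem_union_left _ (e ▸ ha1)))
    exact hcw' this
  have ncw' : ¬ A c w' := fun h => hA.tri hac h (hA.symm hwa1)
  have two : ∀ l ∈ L, l ≠ w → l ≠ w' → dg A L l = 2 := by
    intro l hl e1 e2
    have := split l
    rw [hα l hl e1, hβ l hl e2, (mL l hl).2] at this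
    omega
  have hc2 := two c hc hcw hcw'
  obtain ⟨m1, hm1, hcm1⟩ := dg_pos (A := A) (P := L) (x := c) (by omega)
  obtain ⟨m2, hm2, hcm2, h21⟩ := exu hc2 hm1 hcm1
  obtain ⟨bc, hbc, hcbc⟩ := exB c hc hcw'
  have exm : ∃ m ∈ L, ∃ m' ∈ L, m ≠ m' ∧ A c m ∧ A c m' ∧ A m b1 := by
    obtain ⟨x1, hx1, hmx1⟩ := exB m1 hm1 (by rintro rfl; exact ncw' hcm1)
    obtain ⟨x2, hx2, hmx2⟩ := exB m2 hm2 (by rintro rfl; exact ncw' hcm2)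
    by_cases e1 : b1 = x1
    · exact ⟨m1, hm1, m2, hm2, h21.symm, hcm1, hcm2, e1 ▸ hmx1⟩
    · refine ⟨m2, hm2, m1, hm1, h21, hcm2, hcm1, ?_⟩
      have := pigeon cB hbc hx1 hb1 hx2 (by rintro rfl; exact hA.tri hcm1 hmx1 hcbc)
        (by rintro rfl; exact hcb hcbc) e1 (by rintro rfl; exact hA.tri hcm2 hmx2 hcbc)
        (by
          rintro rfl
          exact h21 (hA.c4 hcm2 hcm1 (hA.symm hmx2) (hA.symm hmx1)
            (fun e => nwAB c hc (Finset.mem_union_right _ (e ▸ hx1)))))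
      rw [this]; exact hmx2
  obtain ⟨m, hm, m', hm', hmm, hcm, hcm', hmb⟩ := exm
  have hmw : m ≠ w := by rintro rfl; exact ncw hcm
  have hmw' : m ≠ w' := by rintro rfl; exact ncw' hcm
  have hm1w : m' ≠ w := by rintro rfl; exact ncw hcm'
  have hm1w' : m' ≠ w' := by rintro rfl; exact ncw' hcm'
  obtain ⟨n, hn, hmn, hnc⟩ := exu (two m hm hmw hmw') hc (hA.symm hcm)
  have hnw : n ≠ w := by rintro rfl; exact hA.tri hmn hwb1 hmb
  have hnw' : n ≠ w' := by
    rintro rfl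
    exact hmw (hA.c4 (hA.symm hmn) (hA.symm adjw) (hA.symm hmb) (hA.symm hwb1)
      (fun e => nwAB _ hn (Finset.mem_union_right _ (e ▸ hb1))))
  have same : ∀ Q : Finset V, Q.card = 3 → Q ⊆ A1 ∪ B1 →
      (∀ l ∈ L, l ≠ w → l ≠ w' → ∃ q ∈ Q, A l q) → ∃ q ∈ Q, A m' q ∧ A n q := by
    intro Q hQ hsub hex
    obtain ⟨p, hp, hp'⟩ := hex c hc hcw hcw'
    obtain ⟨q, hq, hq'⟩ := hex m hm hmw hmw'
    obtain ⟨x, hx, hx'⟩ := hex m' hm' hm1w hm1w'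
    obtain ⟨y, hy, hy'⟩ := hex n hn hnw hnw'
    have hne : ∀ l ∈ L, ∀ z ∈ Q, l ≠ z := fun l hl z hz e => nwAB l hl (hsub (e ▸ hz))
    have := pigeon hQ hp hq hx hy (by rintro rfl; exact hA.tri hcm hq' hp')
      (by rintro rfl; exact hA.tri hcm' hx' hp')
      (by
        rintro rfl
        exact hmm (hA.c4 hcm hcm' (hA.symm hq') (hA.symm hx') (hne c hc _ hx)))
      (by
        rintro rfl
        exact hnc (hA.c4 hmn (hA.symm hcm) (hA.symm hy') (hA.symm hp') (hne m hm _ hy)))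
      (by rintro rfl; exact hA.tri hmn hy' hq')
    exact ⟨x, hx, hx', this ▸ hy'⟩
  obtain ⟨a, ha, ham, han⟩ := same A1 cA Finset.subset_union_left (fun l hl e _ => exA l hl e)
  obtain ⟨b, hb, hbm, hbn⟩ := same B1 cB Finset.subset_union_right (fun l hl _ e => exB l hl e)
  have : m' = n := by
    refine hA.c4 (hA.symm ham) (hA.symm han) (hA.symm hbm) (hA.symm hbn) ?_
    rintro rfl; exact (Finset.disjoint_left.1 dAB) ha hb
  subst this
  exact hA.tri hcm hmn hcm'

theorem reg {T : Finset V} {f : V → ℕ} {k : ℕ} (h : ∀ x ∈ T, k ≤ f x)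
    (hs : ∑ x ∈ T, f x ≤ T.card * k) : ∀ x ∈ T, f x = k := by
  intro x hx
  by_contra hc
  have h1 : ∑ y ∈ T, k < ∑ y ∈ T, f y :=
    Finset.sum_lt_sum h ⟨x, hx, lt_of_le_of_ne (h x hx) (Ne.symm hc)⟩
  rw [Finset.sum_const, smul_eq_mul] at h1
  omega

/-- deleting an independent set of 3-vertices -/
theorem E_del3 (hA : Good A) {S T : Finset V} (h : T ⊆ S) (h3 : ∀ t ∈ T, dg A S t = 3)
    (hi : ∀ a ∈ T, ∀ b ∈ T, ¬ A a b) :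
    E A S = E A (S \ T) + 6 * T.card ∧ (S \ T).card + T.card = S.card := by
  have h1 := E_indep hA h hi
  rw [Finset.sum_congr rfl h3, Finset.sum_const, smul_eq_mul] at h1
  exact ⟨by omega, Finset.card_sdiff_add_card_eq_card h⟩

theorem B18 (hA : Good A) (S : Finset V) (hS : S.card = 18) : E A S ≤ 68 := by
  obtain ⟨m, hm⟩ := E_even hA S
  by_contra hcon
  have hd := fun v (hv : v ∈ S) => del hA (fun T hT => (B17 hA T hT).1) hS hv
  obtain ⟨v, hv, hmin, hE⟩ := exmin (A := A) (S := S) (by omega)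
  have hdv := hd v hv
  rw [hS] at hE
  have hcase : (E A S = 72 ∧ dg A S v = 4) ∨ (E A S = 70 ∧ dg A S v = 3) := by omega
  rcases hcase with ⟨hE72, hv4⟩ | ⟨hE70, hv3⟩
  · have hr : ∀ x ∈ S, dg A S x = 4 := reg (fun x hx => hv4 ▸ hmin x hx)
      (by rw [hS]; change E A S ≤ _; omega)
    obtain ⟨u, hu, hvu⟩ := dg_pos (A := A) (P := S) (x := v) (by omega)
    have huv : u ≠ v := by rintro rfl; exact hA.irr hvu
    have hu' : u ∈ S.erase v := Finset.mem_erase.2 ⟨huv, hu⟩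
    have e1 := E_erase hA hv
    have e2 := E_erase hA hu'
    have e3 := dg_er_adj hv (hA.symm hvu)
    have e4 := dg_er_nadj (A := A) hv (x := v) (fun h => hA.irr h)
    have e5 := dg_er_nadj (A := A) hu' (x := u) (fun h => hA.irr h)
    have e6 := dg_er_adj hu' hvu
    have hur := hr u hu
    refine grid hA (H := (S.erase v).erase u) (v1 := v) (v2 := u)
      (card_er (card_er hS hv) hu') (by omega) (by simp) (by simp) (by omega) (by omega) ?_ ?_ ?_
    · intro x _ h1 h2; exact hA.tri hvu h2 h1
    · intro x hx h1
      have hxS : x ∈ S := Finset.mem_of_mem_erase (Finset.mem_of_mem_erase hx)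
      have f1 := dg_er_adj hv (hA.symm h1)
      have f2 := dg_er_nadj (A := A) hu' (x := x) (fun h => hA.tri hvu (hA.symm h) h1)
      have := hr x hxS
      omega
    · intro x hx h1
      have hxS : x ∈ S := Finset.mem_of_mem_erase (Finset.mem_of_mem_erase hx)
      have f1 := dg_er_nadj (A := A) hv (x := x) (fun h => hA.tri (hA.symm hvu) (hA.symm h) h1)
      have f2 := dg_er_adj hu' (hA.symm h1)
      have := hr x hxS
      omega
  · have h17 : ∀ u ∈ S, dg A S u = 3 → _ := fun u hu hu3 =>
      ((B17 hA _ (card_er hS hu)).2 (by have := E_erase hA hu; omega))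
    obtain ⟨s1, s2, s3, s4⟩ := step hA hv hv3 (fun u hu hu3 => (h17 u hu hu3).1)
    have hct := counts s1
    have hsub : D A S 3 ⊆ S := Finset.filter_subset _ _
    have h5 : (D A S 5).card = 0 := by
      by_contra h
      obtain ⟨x, hx⟩ := Finset.card_pos.1 (Nat.pos_of_ne_zero h)
      rw [mem_D] at hx
      have hadj : ∀ y ∈ D A S 3, A x y := fun y hy => by
        rw [mem_D] at hy
        exact s3 x hx.1 hx.2 y hy.1 hy.2
      have h1 := E_del3 hA hsub (fun t ht => (mem_D.1 ht).2) (fun a ha b hb => by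
        rw [mem_D] at ha hb; exact s2 a ha.1 ha.2 b hb.1 hb.2)
      have hx' : x ∈ S \ D A S 3 := Finset.mem_sdiff.2 ⟨hx.1, fun h => by
        have := (mem_D.1 h).2; omega⟩
      have h3 := E_erase hA hx'
      have h4 := dg_sdiff (A := A) hsub x
      have h6 : dg A (D A S 3) x = (D A S 3).card := by
        rw [dg, nb, Finset.filter_true_of_mem hadj]
      have h8 := Finset.card_erase_of_mem hx'
      have := B14 hA ((S \ D A S 3).erase x) (by omega)
      omega
    have s14 := le4_of h5 s1
    obtain ⟨a, ha, b, hb, hab⟩ := two_of (T := D A S 3) (by omega)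
    rw [mem_D] at ha hb
    have nab : ¬ A a b := s2 a ha.1 ha.2 b hb.1 hb.2
    have nba : ¬ A b a := fun h => nab (hA.symm h)
    have hb' : b ∈ S.erase a := Finset.mem_erase.2 ⟨hab.symm, hb.1⟩
    have e1 := E_erase hA ha.1
    have e2 := E_erase hA hb'
    have e3 := dg_er_nadj ha.1 nba
    have e4 := dg_er_nadj (A := A) ha.1 (x := a) (fun h => hA.irr h)
    have e5 := dg_er_nadj (A := A) hb' (x := b) (fun h => hA.irr h)
    have e6 := dg_er_nadj hb' nab
    have nc : ∀ x ∈ S, A a x → A b x → False := by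
      intro x hx h1 h2
      have hxa : x ∈ S.erase a := Finset.mem_erase.2 ⟨by rintro rfl; exact hA.irr h1, hx⟩
      have f1 := dg_er_adj ha.1 (hA.symm h1)
      have f2 := s14 x hx
      have f3 := (h17 a ha.1 ha.2).1 x hxa
      exact (h17 a ha.1 ha.2).2.1 b hb' (by omega) x hxa (by omega) h2
    refine grid hA (H := (S.erase a).erase b) (v1 := a) (v2 := b)
      (card_er (card_er hS ha.1) hb') (by omega) (by simp) (by simp) (by omega) (by omega) ?_ ?_ ?_
    · intro x hx h1 h2
      exact nc x (Finset.mem_of_mem_erase (Finset.mem_of_mem_erase hx)) h1 h2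
    · intro x hx h1
      have hxS : x ∈ S := Finset.mem_of_mem_erase (Finset.mem_of_mem_erase hx)
      have f1 := dg_er_adj ha.1 (hA.symm h1)
      have f2 := dg_er_nadj (A := A) hb' (x := x) (fun h => nc x hxS h1 (hA.symm h))
      have := s14 x hxS
      have : dg A S x ≠ 3 := fun h => s2 a ha.1 ha.2 x hxS h h1
      omega
    · intro x hx h1
      have hxS : x ∈ S := Finset.mem_of_mem_erase (Finset.mem_of_mem_erase hx)
      have f1 := dg_er_nadj (A := A) ha.1 (x := x) (fun h => nc x hxS (hA.symm h) h1)
      have f2 := dg_er_adj hb' (hA.symm h1)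
      have := s14 x hxS
      have : dg A S x ≠ 3 := fun h => s2 b hb.1 hb.2 x hxS h h1
      omega

theorem B19 (hA : Good A) (S : Finset V) (hS : S.card = 19) : E A S ≤ 76 ∧
    (E A S = 76 → ∀ x ∈ S, dg A S x = 4) := by
  obtain ⟨m, hm⟩ := E_even hA S
  have hd := fun v (hv : v ∈ S) => del hA (B18 hA) hS hv
  obtain ⟨v, hv, hmin, hE⟩ := exmin (A := A) (S := S) (by omega)
  have hdv := hd v hv
  rw [hS] at hE
  refine ⟨by omega, fun he => reg (fun x hx => ?_) (by rw [hS]; change E A S ≤ _; omega)⟩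
  have := hd x hx; omega

theorem B20 (hA : Good A) (S : Finset V) (hS : S.card = 20) : E A S ≤ 82 ∧
    (E A S = 82 → ∃ u ∈ S, dg A S u = 3 ∧ ∀ x ∈ S, x ≠ u →
      dg A S x = 4 + if A x u then 1 else 0) := by
  obtain ⟨m, hm⟩ := E_even hA S
  have hd := fun v (hv : v ∈ S) => del hA (fun T hT => (B19 hA T hT).1) hS hv
  have hr : ∀ v ∈ S, E A S = 76 + 2 * dg A S v → ∀ x ∈ S, x ≠ v →
      dg A S x = 4 + if A x v then 1 else 0 := by
    intro v hv he x hx hxv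
    have h1 := (B19 hA _ (card_er hS hv)).2 (by have := E_erase hA hv; omega) x
      (Finset.mem_erase.2 ⟨hxv, hx⟩)
    have := dg_erase (A := A) hv x
    omega
  obtain ⟨v, hv, hmin, hE⟩ := exmin (A := A) (S := S) (by omega)
  have hdv := hd v hv
  rw [hS] at hE
  constructor
  · by_contra hc
    have hv4 : dg A S v = 4 := by omega
    have hrv := hr v hv (by omega)
    -- a vertex at distance 2 or more
    have : 0 < ((S.erase v) \ nb A S v).card := by
      have := Finset.le_card_sdiff (nb A S v) (S.erase v)
      rw [card_er hS hv] at this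
      unfold dg at hv4
      omega
    obtain ⟨w, hw⟩ := Finset.card_pos.1 this
    rw [Finset.mem_sdiff, Finset.mem_erase, mem_nb] at hw
    have hvw : ¬ A v w := fun h => hw.2 ⟨hw.1.2, h⟩
    have hw4 := hrv w hw.1.2 hw.1.1
    rw [if_neg (fun h => hvw (hA.symm h))] at hw4
    have hrw := hr w hw.1.2 (by omega)
    have := codeg hA (a := v) (b := w) (T := nb A S w) hw.1.1.symm (fun t ht => by
      rw [mem_nb] at ht
      by_contra hvt
      have htw : t ≠ w := by rintro rfl; exact hA.irr ht.2
      have htv : t ≠ v := by rintro rfl; exact hvw (hA.symm ht.2)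
      have f1 := hrw t ht.1 htw
      have f2 := hrv t ht.1 htv
      rw [if_pos (hA.symm ht.2)] at f1
      rw [if_neg (fun h => hvt (hA.symm h))] at f2
      omega) (fun t ht => (mem_nb.1 ht).2)
    unfold dg at hw4
    omega
  · intro he
    have hv3 : dg A S v = 3 := by
      by_contra hc
      have hv4 : dg A S v = 4 := by omega
      obtain ⟨x, hx, h4⟩ := exgt (A := A) (S := S) (k := 4) (by rw [hS]; omega)
      have := ball_low hA hx 4 (fun y hy _ => hv4 ▸ hmin y hy)
      omega
    exact ⟨v, hv, hv3, hr v hv (by omega)⟩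

theorem T6 (hA : Good A) {P L : Finset V} (hP : P.card = 6) (hLP : ∀ l ∈ L, l ∉ P) {y y1 : V}
    (hy : y ∈ L) (hy1 : y1 ∈ L) (hyy : A y y1) (hL : dg A L y = 2) (hL1 : dg A L y1 = 2)
    (hk1 : dg A P y1 = 2)
    (hn : ∀ z ∈ L, A y z → dg A P z = 2) (hn1 : ∀ z ∈ L, A y1 z → dg A P z = 2) : False := by
  obtain ⟨y2, hy2, hyy2, h21⟩ := exu hL hy1 hyy
  have hr := (reach hA (x := y1) (P := P) (T := nb A L y1) (hLP y1 hy1)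
    (fun z hz => (mem_nb.1 hz).2)).2 (by
      rw [Finset.sum_congr rfl (fun z hz => hn1 z (mem_nb.1 hz).1 (mem_nb.1 hz).2),
        Finset.sum_const, smul_eq_mul]
      change dg A L y1 * 2 + _ = _
      omega)
  obtain ⟨p, hp, q, hq, hpq⟩ := two_of (T := nb A P y2) (by
    change 2 ≤ dg A P y2; rw [hn y2 hy2 hyy2])
  rw [mem_nb] at hp hq
  have hyP : ∀ p ∈ P, p ≠ y := fun p hp e => hLP y hy (e ▸ hp)
  have hex : ∀ p ∈ P, A y2 p → ∃ z ∈ (nb A L y1).erase y, A z p := by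
    intro p hp hpy
    obtain ⟨z, hz, hzp⟩ := hr p hp (fun h => h21 (hA.c4 hyy2 hyy (hA.symm hpy) (hA.symm h)
      (hyP p hp).symm))
    refine ⟨z, Finset.mem_erase.2 ⟨?_, hz⟩, hzp⟩
    rintro rfl; exact hA.tri hyy2 hpy hzp
  obtain ⟨z, hz, hzp⟩ := hex p hp.1 hp.2
  obtain ⟨z', hz', hzq⟩ := hex q hq.1 hq.2
  have hc : ((nb A L y1).erase y).card ≤ 1 := by
    rw [Finset.card_erase_of_mem (mem_nb.2 ⟨hy, hA.symm hyy⟩)]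
    change dg A L y1 - 1 ≤ 1; omega
  have : z = z' := Finset.card_le_one.1 hc z hz z' hz'
  subst this
  have hz2 : z = y2 := hA.c4 (hA.symm hzp) (hA.symm hp.2) (hA.symm hzq) (hA.symm hq.2) hpq
  subst hz2
  rw [Finset.mem_erase, mem_nb] at hz
  exact hA.tri hyy hz.2.2 hyy2

theorem sum_nb_weight (hA : Good A) (P L : Finset V) (f : V → ℕ) :
    ∑ p ∈ P, ∑ l ∈ nb A L p, f l = ∑ l ∈ L, dg A P l * f l := by
  have h1 : ∀ x ∈ P, ∑ y ∈ nb A L x, f y = ∑ y ∈ L, if A y x then f y else 0 := by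
    intro x _
    rw [nb, Finset.sum_filter]
    refine Finset.sum_congr rfl fun y _ => ?_
    have : A x y ↔ A y x := ⟨hA.symm, hA.symm⟩
    simp [this]
  rw [Finset.sum_congr rfl h1, Finset.sum_comm]
  refine Finset.sum_congr rfl fun y _ => ?_
  rw [← Finset.sum_filter, Finset.sum_const, smul_eq_mul]
  rfl

theorem K (hA : Good A) {P L : Finset V} (h5 : ∀ p ∈ P, dg A L p = 5) :
    ∑ l ∈ L, dg A P l = 5 * P.card ∧
    ∑ l ∈ L, dg A P l * dg A P l ≤ P.card * (P.card + 4) := by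
  constructor
  · rw [dg_swap hA, Finset.sum_congr rfl h5, Finset.sum_const, smul_eq_mul, mul_comm]
  · rw [← sum_nb_weight hA]
    rw [← smul_eq_mul]
    refine Finset.sum_le_card_nsmul _ _ _ fun p hp => ?_
    have hr := (reach hA (x := p) (P := P.erase p) (T := nb A L p) (by simp)
      (fun z hz => (mem_nb.1 hz).2)).1
    have h1 : ∑ l ∈ nb A L p, dg A P l = ∑ l ∈ nb A L p, dg A (P.erase p) l + dg A L p := by
      rw [dg, Finset.card_eq_sum_ones, ← Finset.sum_add_distrib]
      refine Finset.sum_congr rfl fun y hy => ?_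
      rw [← dg_erase hp y, if_pos (hA.symm (mem_nb.1 hy).2)]
    have := Finset.card_erase_add_one hp
    have := h5 p hp
    omega

/-- if all neighbours are in a subset, the degrees agree -/
theorem dg_all {S L : Finset V} (hL : L ⊆ S) {x : V} (h : ∀ y ∈ S, A x y → y ∈ L) :
    dg A L x = dg A S x := by
  refine le_antisymm (dg_mono hL x) (Finset.card_le_card fun y hy => ?_)
  rw [mem_nb] at hy ⊢
  exact ⟨h y hy.1 hy.2, hy.2⟩

theorem quad (T : Finset V) (f : V → ℕ) (a b : ℤ) :
    ∑ x ∈ T, ((f x : ℤ) - a) * ((f x : ℤ) - b) = ((∑ x ∈ T, f x * f x : ℕ) : ℤ)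
      - (a + b) * ((∑ x ∈ T, f x : ℕ) : ℤ) + a * b * (T.card : ℤ) := by
  have h : ∀ x ∈ T, ((f x : ℤ) - a) * ((f x : ℤ) - b) =
      (f x : ℤ) * (f x : ℤ) - (a + b) * (f x : ℤ) + a * b := by
    intro x _; ring
  rw [Finset.sum_congr rfl h, Finset.sum_add_distrib, Finset.sum_sub_distrib, ← Finset.mul_sum,
    Finset.sum_const, nsmul_eq_mul]
  push_cast
  ring

theorem B21 (hA : Good A) (S : Finset V) (hS : S.card = 21) : E A S ≤ 88 := by
  obtain ⟨m, hm⟩ := E_even hA S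
  by_contra hcon
  have hd := fun v (hv : v ∈ S) => del hA (fun T hT => (B20 hA T hT).1) hS hv
  obtain ⟨v, hv, hmin, hE⟩ := exmin (A := A) (S := S) (by omega)
  have hdv := hd v hv
  rw [hS] at hE
  have h4 : ∀ x ∈ S, 4 ≤ dg A S x := fun x hx => by have := hd x hx; omega
  have h5 : ∀ x ∈ S, dg A S x ≤ 5 := fun x hx => by
    have := ball_low hA hx 4 (fun y hy _ => h4 y hy); omega
  have hct := counts (A := A) (S := S) (fun x hx => ⟨(by norm_num : 3 ≤ 4).trans (h4 x hx), h5 x hx⟩)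
  have h30 : (D A S 3).card = 0 := by
    rw [Finset.card_eq_zero, Finset.eq_empty_iff_forall_notMem]
    intro x hx; rw [mem_D] at hx; have := h4 x hx.1; omega
  have hsubL : D A S 4 ⊆ S := Finset.filter_subset _ _
  have hp5 : ∀ p ∈ D A S 5, dg A (D A S 4) p = 5 := by
    intro p hp
    rw [mem_D] at hp
    have hr := reg (T := nb A S p) (f := dg A S) (k := 4) (fun y hy => h4 y (mem_nb.1 hy).1) (by
      have := (ball hA hp.1).1
      change _ ≤ dg A S p * 4
      omega)
    rw [dg_all hsubL (fun y hy hpy => mem_D.2 ⟨hy, hr y (mem_nb.2 ⟨hy, hpy⟩)⟩)]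
    exact hp.2
  obtain ⟨k1, k2⟩ := K hA hp5
  have c5 : (D A S 5).card = 6 := by omega
  have c4 : (D A S 4).card = 15 := by omega
  rw [c5] at k1 k2
  have hk : ∀ l ∈ D A S 4, dg A (D A S 5) l = 2 := by
    have hq := quad (D A S 4) (dg A (D A S 5)) 2 2
    rw [k1, c4] at hq
    have hq0 : ∑ l ∈ D A S 4, ((dg A (D A S 5) l : ℤ) - 2) * ((dg A (D A S 5) l : ℤ) - 2) = 0 :=
      le_antisymm (by omega) (Finset.sum_nonneg fun _ _ => mul_self_nonneg _)
    intro l hl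
    have := (Finset.sum_eq_zero_iff_of_nonneg (fun _ _ => mul_self_nonneg _)).1 hq0 l hl
    have := mul_self_eq_zero.1 this
    omega
  have hu : S \ D A S 4 = D A S 5 := by
    ext x
    rw [Finset.mem_sdiff, mem_D, mem_D]
    constructor
    · rintro ⟨h1, h2⟩
      have a1 := h4 x h1
      have a2 := h5 x h1
      have : dg A S x ≠ 4 := fun h => h2 ⟨h1, h⟩
      exact ⟨h1, by omega⟩
    · rintro ⟨h1, h2⟩
      exact ⟨h1, fun h => by omega⟩
  have hl2 : ∀ l ∈ D A S 4, dg A (D A S 4) l = 2 := by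
    intro l hl
    have := dg_sdiff (A := A) hsubL l
    rw [hu, hk l hl, (mem_D.1 hl).2] at this
    omega
  obtain ⟨y, hy⟩ := Finset.card_pos.1 (show 0 < (D A S 4).card by omega)
  obtain ⟨y1, hy1, hyy⟩ := dg_pos (A := A) (P := D A S 4) (x := y) (by rw [hl2 y hy]; norm_num)
  exact T6 hA c5 (fun l hl h => by rw [mem_D] at hl h; omega) hy hy1 hyy (hl2 y hy) (hl2 y1 hy1)
    (hk y1 hy1) (fun z hz _ => hk z hz) (fun z hz _ => hk z hz)

theorem N0 (hA : Good A) {S : Finset V} (hS : S.card = 22) (hE : E A S = 94)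
    (h45 : ∀ x ∈ S, 4 ≤ dg A S x ∧ dg A S x ≤ 5)
    (hp5 : ∀ p ∈ D A S 5, dg A (D A S 4) p = 5) : False := by
  have hct := counts (A := A) (S := S) (fun x hx => ⟨by have := h45 x hx; omega, (h45 x hx).2⟩)
  have h30 : (D A S 3).card = 0 := by
    rw [Finset.card_eq_zero, Finset.eq_empty_iff_forall_notMem]
    intro x hx; rw [mem_D] at hx; have := h45 x hx.1; omega
  have hsubL : D A S 4 ⊆ S := Finset.filter_subset _ _
  have hu : S \ D A S 4 = D A S 5 := by
    ext x
    rw [Finset.mem_sdiff, mem_D, mem_D]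
    constructor
    · rintro ⟨h1, h2⟩
      have a1 := h45 x h1
      have : dg A S x ≠ 4 := fun h => h2 ⟨h1, h⟩
      exact ⟨h1, by omega⟩
    · rintro ⟨h1, h2⟩
      exact ⟨h1, fun h => by omega⟩
  have hkl : ∀ l ∈ D A S 4, dg A (D A S 5) l + dg A (D A S 4) l = 4 := by
    intro l hl
    have := dg_sdiff (A := A) hsubL l
    rw [hu, (mem_D.1 hl).2] at this
    exact this
  obtain ⟨k1, k2⟩ := K hA hp5
  have c5 : (D A S 5).card = 6 := by omega
  have c4 : (D A S 4).card = 16 := by omega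
  rw [c5] at k1 k2
  have hLP : ∀ l ∈ D A S 4, l ∉ D A S 5 := fun l hl h => by rw [mem_D] at hl h; omega
  generalize D A S 4 = L at *
  generalize D A S 5 = P at *
  have hq := quad L (dg A P) 2 2
  rw [k1, c4] at hq
  have hlow : ∀ l ∈ L, dg A P l ≤ 1 → ∃ m ∈ L, A l m ∧ dg A P m ≤ 1 := by
    intro l hl h1
    by_contra hc
    push Not at hc
    have h2 : (nb A L l).card • 2 ≤ ∑ y ∈ nb A L l, dg A P y := Finset.card_nsmul_le_sum _ _ _ (fun m hm => by
      rw [mem_nb] at hm; exact hc m hm.1 hm.2)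
    have h3 := (reach hA (x := l) (P := P) (T := nb A L l) (hLP l hl)
      (fun z hz => (mem_nb.1 hz).2)).1
    have h4 := hkl l hl
    rw [smul_eq_mul] at h2
    change dg A L l * 2 ≤ _ at h2
    omega
  obtain ⟨Y, hY⟩ : ∃ Y, Y = L.filter (fun l => dg A P l = 2) := ⟨_, rfl⟩
  have mY : ∀ l, l ∈ Y ↔ l ∈ L ∧ dg A P l = 2 := by intro l; rw [hY, Finset.mem_filter]
  have hYL : Y ⊆ L := hY ▸ Finset.filter_subset _ _
  have hX : (((L \ Y).card : ℕ) : ℤ) ≤ ∑ x ∈ L, ((dg A P x : ℤ) - 2) * ((dg A P x : ℤ) - 2) := by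
    rw [Finset.card_eq_sum_ones, Nat.cast_sum]
    refine le_trans (Finset.sum_le_sum (g := fun x => ((dg A P x : ℤ) - 2) * ((dg A P x : ℤ) - 2)) ?_)
      (Finset.sum_le_sum_of_subset_of_nonneg Finset.sdiff_subset fun _ _ _ => mul_self_nonneg _)
    intro x hx
    rw [Finset.mem_sdiff, mY] at hx
    have hne : (dg A P x : ℤ) - 2 ≠ 0 := fun h => hx.2 ⟨hx.1, by omega⟩
    have := mul_self_pos.2 hne
    rw [Nat.cast_one]; exact this
  have hXc : (((∑ x ∈ L \ Y, 2 * dg A Y x) : ℕ) : ℤ) ≤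
      ∑ x ∈ L, (3 * (((dg A P x : ℤ) - 2) * ((dg A P x : ℤ) - 2)) - ((dg A P x : ℤ) - 2)) := by
    rw [← Finset.sum_sdiff hYL]
    have h0 : ∑ x ∈ Y, (3 * (((dg A P x : ℤ) - 2) * ((dg A P x : ℤ) - 2)) - ((dg A P x : ℤ) - 2)) = 0 := by
      refine Finset.sum_eq_zero fun x hx => ?_
      rw [((mY x).1 hx).2]; norm_num
    rw [h0, add_zero, Nat.cast_sum]
    refine Finset.sum_le_sum fun x hx => ?_
    rw [Finset.mem_sdiff, mY] at hx
    have h1 := hkl x hx.1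
    have h2 := dg_mono (A := A) hYL x
    have h3 : dg A P x ≤ 1 → dg A Y x + 1 ≤ dg A L x := by
      intro h
      obtain ⟨m, hm, hlm, hm1⟩ := hlow x hx.1 h
      have h4 := dg_er_adj hm hlm
      have h5 := dg_mono (A := A) (S := L.erase m) (T := Y) (fun y hy => Finset.mem_erase.2
        ⟨by rintro rfl; have := ((mY y).1 hy).2; omega, hYL hy⟩) x
      omega
    have h4 : dg A P x ≠ 2 := fun h => hx.2 ⟨hx.1, h⟩
    have : dg A P x ≤ 4 := by omega
    generalize dg A P x = k at *
    have : k = 0 ∨ k = 1 ∨ k = 3 ∨ k = 4 := by omega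
    push_cast
    rcases this with rfl | rfl | rfl | rfl <;> norm_num <;> omega
  rw [Finset.sum_sub_distrib, ← Finset.mul_sum, Finset.sum_sub_distrib, ← Nat.cast_sum, k1,
    Finset.sum_const, c4, ← Finset.mul_sum] at hXc
  have hc7 : ∑ x ∈ L \ Y, dg A Y x ≤ 7 := by
    rw [nsmul_eq_mul] at hXc
    omega
  have hX4 : (L \ Y).card ≤ 4 := by omega
  have hYc := Finset.card_sdiff_add_card_eq_card hYL
  rw [dg_swap hA] at hc7
  have hY2 : ∀ y ∈ Y, dg A (L \ Y) y + dg A Y y = 2 := by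
    intro y hy
    have h1 := dg_sdiff (A := A) hYL y
    have h2 := hkl y (hYL hy)
    have h3 := ((mY y).1 hy).2
    omega
  obtain ⟨F, hF⟩ : ∃ F, F = Y.filter (fun l => dg A (L \ Y) l = 0) := ⟨_, rfl⟩
  have mF : ∀ l, l ∈ F ↔ l ∈ Y ∧ dg A (L \ Y) l = 0 := by intro l; rw [hF, Finset.mem_filter]
  have hFY : F ⊆ Y := hF ▸ Finset.filter_subset _ _
  have hW1 : ∀ w ∈ Y \ F, 1 ≤ dg A (L \ Y) w := by
    intro w hw
    rw [Finset.mem_sdiff, mF] at hw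
    exact Nat.one_le_iff_ne_zero.2 fun h => hw.2 ⟨hw.1, h⟩
  have hW7 : (Y \ F).card ≤ 7 := by
    have h1 : (Y \ F).card • 1 ≤ ∑ x ∈ Y \ F, dg A (L \ Y) x := Finset.card_nsmul_le_sum _ _ _ hW1
    have h2 := Finset.sum_le_sum_of_subset (f := dg A (L \ Y)) (Finset.sdiff_subset (s := Y) (t := F))
    rw [smul_eq_mul] at h1
    omega
  have hFc := Finset.card_sdiff_add_card_eq_card hFY
  by_cases hex : ∃ y ∈ F, ∃ y1 ∈ F, A y y1
  · obtain ⟨y, hy, y1, hy1, hyy⟩ := hex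
    rw [mF] at hy hy1
    have hn : ∀ y, y ∈ Y → dg A (L \ Y) y = 0 → ∀ z ∈ L, A y z → dg A P z = 2 := by
      intro y hy h0 z hz hyz
      by_contra hc
      exact dg_zero h0 z (Finset.mem_sdiff.2 ⟨hz, fun h => hc ((mY z).1 h).2⟩) hyz
    have m1 := (mY y).1 hy.1
    have m2 := (mY y1).1 hy1.1
    have e1 := hkl y m1.1
    have e2 := hkl y1 m2.1
    exact T6 hA c5 hLP m1.1 m2.1 hyy (by omega) (by omega) m2.2 (hn y hy.1 hy.2) (hn y1 hy1.1 hy1.2)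
  · push Not at hex
    have h1 : ∀ y ∈ F, dg A (Y \ F) y = 2 := by
      intro y hy
      have h1 := hY2 y (hFY hy)
      have h2 := ((mF y).1 hy).2
      rw [dg_all Finset.sdiff_subset (fun z hz hyz => Finset.mem_sdiff.2
        ⟨hz, fun h => hex y hy z h hyz⟩)]
      omega
    have h2 := dg_swap hA F (Y \ F)
    rw [Finset.sum_congr rfl h1, Finset.sum_const, smul_eq_mul] at h2
    have h3 : ∑ y ∈ Y \ F, dg A F y ≤ (Y \ F).card • 1 := Finset.sum_le_card_nsmul _ _ _ fun w hw => by
      have h1 := hW1 w hw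
      have h2 := hY2 w (Finset.sdiff_subset hw)
      have h3 := dg_mono (A := A) hFY w
      omega
    rw [smul_eq_mul] at h3
    omega

theorem N1 (hA : Good A) {S : Finset V} (hS : S.card = 22) (hE : E A S = 94)
    (h35 : ∀ x ∈ S, 3 ≤ dg A S x ∧ dg A S x ≤ 5) {v : V} (hv : v ∈ S) (hv3 : dg A S v = 3)
    (hvu : ∀ x ∈ S, dg A S x = 3 → x = v)
    (hns : ∀ x ∈ S, dg A S x = 5 → ¬ A x v → ∀ y ∈ S, A x y → dg A S y = 4) : False := by
  have hct := counts h35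
  have h31 : (D A S 3).card = 1 := by
    rw [Finset.card_eq_one]
    refine ⟨v, ?_⟩
    ext x; rw [mem_D, Finset.mem_singleton]
    exact ⟨fun h => hvu x h.1 h.2, fun h => h ▸ ⟨hv, hv3⟩⟩
  have c5 : (D A S 5).card = 7 := by omega
  have c4 : (D A S 4).card = 14 := by omega
  have hsub5 : D A S 5 ⊆ S := Finset.filter_subset _ _
  obtain ⟨L, hL⟩ : ∃ L, L = D A S 4 := ⟨_, rfl⟩
  obtain ⟨A', hA'⟩ : ∃ L, L = nb A (D A S 5) v := ⟨_, rfl⟩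
  obtain ⟨B, hB⟩ : ∃ L, L = D A S 5 \ A' := ⟨_, rfl⟩
  have mA : ∀ x, x ∈ A' ↔ (x ∈ S ∧ dg A S x = 5) ∧ A v x := by
    intro x; rw [hA', mem_nb, mem_D]
  have mB : ∀ x, x ∈ B ↔ (x ∈ S ∧ dg A S x = 5) ∧ ¬ A v x := by
    intro x; rw [hB, Finset.mem_sdiff, mem_D, mA]; tauto
  have mL : ∀ x, x ∈ L ↔ x ∈ S ∧ dg A S x = 4 := by intro x; rw [hL, mem_D]
  have hLS : L ⊆ S := fun x hx => ((mL x).1 hx).1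
  have hAB : B.card + A'.card = 7 := by
    rw [← c5, hB]
    refine Finset.card_sdiff_add_card_eq_card ?_
    rw [hA']; exact Finset.filter_subset _ _
  have hA3 : A'.card ≤ 3 := by
    rw [hA', ← hv3]; exact dg_mono hsub5 v
  have hBn : ∀ p ∈ B, ∀ y ∈ S, A p y → y ∈ L := fun p hp y hy hpy => by
    rw [mB] at hp
    exact (mL y).2 ⟨hy, hns p hp.1.1 hp.1.2 (fun h => hp.2 (hA.symm h)) y hy hpy⟩
  have hB5 : ∀ p ∈ B, dg A L p = 5 := fun p hp => by
    rw [dg_all hLS (hBn p hp)]; exact ((mB p).1 hp).1.2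
  obtain ⟨k1, k2⟩ := K hA hB5
  have hLc : L.card = 14 := hL ▸ c4
  have q1 := quad L (dg A B) 1 2
  have q2 := quad L (dg A B) 2 3
  have nn1 : ∀ x ∈ L, (0 : ℤ) ≤ ((dg A B x : ℤ) - 1) * ((dg A B x : ℤ) - 2) := by
    intro x _
    rcases le_or_gt (dg A B x) 1 with h | h
    · exact mul_nonneg_of_nonpos_of_nonpos (by omega) (by omega)
    · exact mul_nonneg (by omega) (by omega)
  have nn2 : ∀ x ∈ L, (0 : ℤ) ≤ ((dg A B x : ℤ) - 2) * ((dg A B x : ℤ) - 3) := by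
    intro x _
    rcases le_or_gt (dg A B x) 2 with h | h
    · exact mul_nonneg_of_nonpos_of_nonpos (by omega) (by omega)
    · exact mul_nonneg (by omega) (by omega)
  have s1 := Finset.sum_nonneg nn1
  have s2 := Finset.sum_nonneg nn2
  rw [k1, hLc] at q1 q2
  have hb : B.card = 4 ∨ B.card = 5 ∨ B.card = 6 ∨ B.card = 7 := by omega
  rcases hb with hb | hb | hb | hb <;> rw [hb] at k1 k2 q1 q2
  · have hz := (Finset.sum_eq_zero_iff_of_nonneg nn1).1 (by omega)
    have hk2 : ∀ l ∈ L, dg A B l ≤ 2 := by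
      intro l hl
      rcases mul_eq_zero.1 (hz l hl) with h | h <;> omega
    have hAn : ∀ a ∈ A', dg A L a = 4 := by
      intro a ha
      rw [mA] at ha
      have h1 := dg_er_adj hv (hA.symm ha.2)
      rw [dg_all (S := S.erase v) (L := L)]
      · omega
      · intro x hx
        rw [mL] at hx
        exact Finset.mem_erase.2 ⟨by rintro rfl; omega, hx.1⟩
      · intro y hy hay
        rw [Finset.mem_erase] at hy
        have h2 := h35 y hy.2
        have h3 : dg A S y ≠ 3 := fun h => hy.1 (hvu y hy.2 h)
        refine (mL y).2 ⟨hy.2, ?_⟩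
        by_contra h4
        have := hns y hy.2 (by omega) (fun h => hA.tri ha.2 hay (hA.symm h)) a ha.1.1 (hA.symm hay)
        omega
    have hA3 : A'.card = 3 := by omega
    have j1 : ∑ l ∈ L, dg A A' l = 12 := by
      rw [dg_swap hA, Finset.sum_congr rfl hAn, Finset.sum_const, hA3, smul_eq_mul]
    have j2 : ∑ l ∈ L, dg A A' l * dg A B l ≤ 12 := by
      rw [← sum_nb_weight hA]
      have : ∑ p ∈ A', ∑ l ∈ nb A L p, dg A B l ≤ A'.card • 4 := by
        refine Finset.sum_le_card_nsmul _ _ _ fun a ha => ?_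
        have := (reach hA (x := a) (P := B) (T := nb A L a)
          (fun h => ((mB a).1 h).2 ((mA a).1 ha).2) (fun z hz => (mem_nb.1 hz).2)).1
        omega
      rwa [hA3] at this
    have j3 : ∀ l ∈ L, (0 : ℤ) ≤ (1 - (dg A A' l : ℤ)) * (2 - (dg A B l : ℤ)) := by
      intro l hl
      have h1 := dg_le_one hA (P := A') (v := v) (x := l) (fun p hp => ((mA p).1 hp).2)
        (by rintro rfl; have := ((mL l).1 hl).2; omega)
      have h2 := hk2 l hl
      exact mul_nonneg (by omega) (by omega)
    have j4 := Finset.sum_nonneg j3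
    have j5 : ∑ l ∈ L, (1 - (dg A A' l : ℤ)) * (2 - (dg A B l : ℤ)) = 2 * (L.card : ℤ)
        - ((∑ l ∈ L, dg A B l : ℕ) : ℤ) - 2 * ((∑ l ∈ L, dg A A' l : ℕ) : ℤ)
        + ((∑ l ∈ L, dg A A' l * dg A B l : ℕ) : ℤ) := by
      push_cast
      rw [Finset.card_eq_sum_ones, Nat.cast_sum, Finset.mul_sum, Finset.mul_sum,
        ← Finset.sum_sub_distrib, ← Finset.sum_sub_distrib, ← Finset.sum_add_distrib]
      refine Finset.sum_congr rfl fun l _ => ?_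
      push_cast; ring
    omega
  · omega
  · omega
  · omega

theorem N2 (hA : Good A) {S : Finset V} (hS : S.card = 22) (hE : E A S = 94)
    (h35 : ∀ x ∈ S, 3 ≤ dg A S x ∧ dg A S x ≤ 5) (h2 : (D A S 3).card = 2)
    (hi : ∀ a ∈ D A S 3, ∀ b ∈ D A S 3, ¬ A a b)
    (hns : ∀ x ∈ S, dg A S x = 5 → dg A (D A S 3) x = 0 →
      ∀ y ∈ S, A x y → dg A S y = 4) : False := by
  have hsub : D A S 3 ⊆ S := Finset.filter_subset _ _
  have h3 : ∀ t ∈ D A S 3, dg A S t = 3 := fun t ht => (mem_D.1 ht).2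
  have h4 : ∀ x ∈ S, x ∉ D A S 3 → 4 ≤ dg A S x := fun x hx hn => by
    have h1 := h35 x hx
    have : dg A S x ≠ 3 := fun h => hn (mem_D.2 ⟨hx, h⟩)
    omega
  obtain ⟨d1, d2⟩ := E_del3 hA hsub h3 hi
  generalize D A S 3 = T at *
  obtain ⟨H, hH⟩ : ∃ H, H = S \ T := ⟨_, rfl⟩
  rw [← hH] at d1 d2
  have mH : ∀ x, x ∈ H ↔ x ∈ S ∧ x ∉ T := by intro x; rw [hH, Finset.mem_sdiff]
  obtain ⟨u, hu, hu3, hr⟩ := (B20 hA H (by omega)).2 (by omega)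
  have hdec : ∀ x, dg A H x + dg A T x = dg A S x := fun x => hH ▸ dg_sdiff hsub x
  have hX : ∀ x ∈ H, A u x → dg A H x = 5 ∧ dg A T x = 0 ∧ ∀ y ∈ S, A x y → dg A S y = 4 := by
    intro x hx hux
    have e1 := hr x hx (by rintro rfl; exact hA.irr hux)
    rw [if_pos (hA.symm hux)] at e1
    have e2 := hdec x
    have e3 := h35 x ((mH x).1 hx).1
    exact ⟨e1, by omega, hns x ((mH x).1 hx).1 (by omega) (by omega)⟩
  have hu4 : dg A T u = 1 := by
    obtain ⟨x, hx, hux⟩ := dg_pos (A := A) (P := H) (x := u) (by omega)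
    have := (hX x hx hux).2.2 u ((mH u).1 hu).1 (hA.symm hux)
    have := hdec u
    omega
  have ht1 : ∀ x ∈ H, dg A T x ≤ 1 := by
    intro x hx
    by_cases hxu : x = u
    · rw [hxu]; omega
    · have e1 := hr x hx hxu
      have e2 := hdec x
      have e3 := h35 x ((mH x).1 hx).1
      omega
  have hsum : ∑ x ∈ H, dg A T x = 6 := by
    rw [dg_swap hA]
    have : ∀ t ∈ T, dg A H t = 3 := by
      intro t ht
      rw [hH, dg_all Finset.sdiff_subset (fun y hy hty => Finset.mem_sdiff.2
        ⟨hy, fun h => hi t ht y h hty⟩)]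
      exact h3 t ht
    rw [Finset.sum_congr rfl this, Finset.sum_const, h2, smul_eq_mul]
  obtain ⟨P, hP⟩ : ∃ P, P = H.filter (fun x => dg A T x = 0) := ⟨_, rfl⟩
  have mP : ∀ x, x ∈ P ↔ x ∈ H ∧ dg A T x = 0 := by intro x; rw [hP, Finset.mem_filter]
  have hPH : P ⊆ H := hP ▸ Finset.filter_subset _ _
  have hPc : P.card + ∑ x ∈ H, dg A T x ≤ H.card := by
    rw [hP, Finset.card_filter, ← Finset.sum_add_distrib, Finset.card_eq_sum_ones]
    refine Finset.sum_le_sum fun x hx => ?_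
    have := ht1 x hx
    split_ifs <;> omega
  have hr1 := (reach hA (x := u) (P := P) (T := nb A H u) (fun h => by
    have := ((mP u).1 h).2; omega) (fun z hz => (mem_nb.1 hz).2)).1
  have f1 : dg A P u = 3 := by
    rw [dg_all hPH (fun y hy huy => (mP y).2 ⟨hy, (hX y hy huy).2.1⟩)]
    exact hu3
  have f2 : ∀ x ∈ nb A H u, dg A P x = 4 := by
    intro x hx
    rw [mem_nb] at hx
    obtain ⟨x5, x0, xn⟩ := hX x hx.1 hx.2
    have e1 := dg_er_adj hu (hA.symm hx.2)
    rw [dg_all (S := H.erase u) (L := P)]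
    · omega
    · intro p hp
      rw [mP] at hp
      exact Finset.mem_erase.2 ⟨by rintro rfl; omega, hp.1⟩
    · intro y hy hxy
      rw [Finset.mem_erase] at hy
      have e2 := hr y hy.2 hy.1
      rw [if_neg (fun h => hA.tri hx.2 hxy (hA.symm h))] at e2
      have e3 := xn y ((mH y).1 hy.2).1 hxy
      have e4 := hdec y
      exact (mP y).2 ⟨hy.2, by omega⟩
  rw [Finset.sum_congr rfl f2, Finset.sum_const, smul_eq_mul] at hr1
  change dg A H u * 4 + _ ≤ _ at hr1
  omega

def Fs (A : V → V → Prop) [DecidableRel A] (H : Finset V) (z : V) : Finset V :=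
  H.filter (fun w => w ≠ z ∧ ¬ A z w ∧ ∀ c ∈ H, A z c → ¬ A w c)

theorem mem_Fs {H : Finset V} {z w : V} :
    w ∈ Fs A H z ↔ w ∈ H ∧ w ≠ z ∧ ¬ A z w ∧ ∀ c ∈ H, A z c → ¬ A w c := by
  simp [Fs]

theorem Fs_card (hA : Good A) {H : Finset V} (hH : H.card = 19) (h4 : ∀ x ∈ H, dg A H x = 4)
    {z : V} (hz : z ∈ H) : (Fs A H z).card ≤ 2 := by
  have hsub : Fs A H z ⊆ H.erase z := fun w hw => by
    rw [mem_Fs] at hw; exact Finset.mem_erase.2 ⟨hw.2.1, hw.1⟩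
  have hc := Finset.card_sdiff_add_card_eq_card hsub
  have hce := Finset.card_erase_add_one hz
  have hr := (reach hA (x := z) (P := H.erase z \ Fs A H z) (T := nb A H z) (by simp)
    (fun y hy => (mem_nb.1 hy).2)).1
  have f1 : dg A (H.erase z \ Fs A H z) z = 4 := by
    rw [dg_all (S := H) (Finset.sdiff_subset.trans (Finset.erase_subset _ _)), h4 z hz]
    intro y hy hzy
    rw [Finset.mem_sdiff, Finset.mem_erase, mem_Fs]
    exact ⟨⟨by rintro rfl; exact hA.irr hzy, hy⟩, fun h => h.2.2.1 hzy⟩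
  have f2 : ∀ y ∈ nb A H z, dg A (H.erase z \ Fs A H z) y = 3 := by
    intro y hy
    rw [mem_nb] at hy
    rw [dg_all (S := H.erase z) Finset.sdiff_subset]
    · have := dg_er_adj hz (hA.symm hy.2)
      have := h4 y hy.1
      omega
    · intro w hw hyw
      rw [Finset.mem_sdiff, mem_Fs]
      exact ⟨hw, fun h => h.2.2.2 y hy.1 hy.2 (hA.symm hyw)⟩
  rw [Finset.sum_congr rfl f2, Finset.sum_const, smul_eq_mul] at hr
  change dg A H z * 3 + _ ≤ _ at hr
  have := h4 z hz
  omega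

theorem T_far (hA : Good A) {H : Finset V} {v x y : V} (hv : v ∉ H) (hx : x ∈ H) (hy : y ∈ H)
    (hvx : A v x) (hvy : A v y) (hxy : y ≠ x) : y ∈ Fs A H x := by
  rw [mem_Fs]
  refine ⟨hy, hxy, fun h => hA.tri hvx h hvy, fun c hc h1 h2 => ?_⟩
  have := hA.c4 (hA.symm hvx) h1 (hA.symm hvy) h2 hxy.symm
  exact hv (this ▸ hc)

theorem T_cov (hA : Good A) {H : Finset V} (hH : H.card = 19) (h4 : ∀ x ∈ H, dg A H x = 4)
    {v x p : V} (hv : v ∉ H) (hv3 : dg A H v = 3) (hx : x ∈ H) (hvx : A v x) (hp : p ∈ H)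
    (hvp : ¬ A v p) (hpx : ¬ A p x) : ∃ c ∈ H, A x c ∧ A p c := by
  by_contra hc
  push Not at hc
  have h1 : p ∈ Fs A H x := mem_Fs.2 ⟨hp, by rintro rfl; exact hvp hvx, fun h => hpx (hA.symm h), hc⟩
  have h2 : insert p ((nb A H v).erase x) ⊆ Fs A H x := by
    intro y hy
    rw [Finset.mem_insert, Finset.mem_erase, mem_nb] at hy
    rcases hy with rfl | ⟨h, h', h''⟩
    · exact h1
    · exact T_far hA hv hx h' hvx h'' h
  have h3 := Finset.card_le_card h2
  rw [Finset.card_insert_of_notMem (by simp [mem_nb, hvp]),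
    Finset.card_erase_of_mem (mem_nb.2 ⟨hx, hvx⟩)] at h3
  have := Fs_card hA hH h4 hx
  change dg A H v - 1 + 1 ≤ _ at h3
  omega

def Zs (A : V → V → Prop) [DecidableRel A] (H : Finset V) (v : V) : Finset V :=
  H.filter (fun z => ¬ A v z ∧ dg A (nb A H v) z = 0)

theorem mem_Zs {H : Finset V} {v z : V} :
    z ∈ Zs A H v ↔ z ∈ H ∧ ¬ A v z ∧ dg A (nb A H v) z = 0 := by
  simp [Zs]

/-- every vertex outside the triple has exactly one neighbour in `Zs` -/
theorem Z_one (hA : Good A) {H : Finset V} (hH : H.card = 19) (h4 : ∀ x ∈ H, dg A H x = 4)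
    {v p : V} (hv : v ∉ H) (hv3 : dg A H v = 3) (hp : p ∈ H) (hvp : ¬ A v p) :
    dg A (Zs A H v) p = 1 := by
  obtain ⟨T, hT⟩ : ∃ T, T = nb A H v := ⟨_, rfl⟩
  have mT : ∀ x, x ∈ T ↔ x ∈ H ∧ A v x := fun x => by rw [hT, mem_nb]
  have mZ : ∀ x, x ∈ Zs A H v ↔ x ∈ H ∧ ¬ A v x ∧ dg A T x = 0 := fun x => by rw [hT, mem_Zs]
  have hTc : T.card = 3 := by rw [hT]; exact hv3
  have hTv : ∀ q ∈ T, A v q := fun q hq => ((mT q).1 hq).2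
  have hpT : p ∉ T := fun h => hvp (hTv p h)
  have hpv : p ≠ v := fun h => hv (h ▸ hp)
  -- the total number of reached triple vertices is 3
  have hle := (reach hA (x := p) (P := T) (T := nb A H p) hpT (fun z hz => (mem_nb.1 hz).2)).1
  have hge : 3 ≤ ∑ y ∈ nb A H p, dg A T y + dg A T p := by
    rw [dg_swap hA, dg_eq_sum T p, ← Finset.sum_add_distrib]
    have : T.card • 1 ≤ ∑ x ∈ T, (dg A (nb A H p) x + if A p x then 1 else 0) := by
      refine Finset.card_nsmul_le_sum _ _ _ fun x hx => ?_
      rw [mT] at hx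
      by_cases h : A p x
      · simp [h]
      · obtain ⟨c, hc, h1, h2⟩ := T_cov hA hH h4 hv hv3 hx.1 hx.2 hp hvp h
        have := pos_dg (mem_nb.2 ⟨hc, h2⟩) h1
        omega
    rw [hTc] at this
    exact this
  -- each neighbour is of exactly one of three kinds
  have hkind : ∀ y ∈ nb A H p, (if y ∈ Zs A H v then 1 else 0) + (if A v y then 1 else 0)
      + dg A T y = 1 := by
    intro y hy
    rw [mem_nb] at hy
    have h1 := dg_le_one hA hTv (x := y) (fun h => hv (h ▸ hy.1))
    by_cases hvy : A v y
    · have h0 : dg A T y = 0 := by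
        rw [dg, Finset.card_eq_zero, Finset.eq_empty_iff_forall_notMem]
        intro q hq
        rw [mem_nb] at hq
        exact hA.tri hvy hq.2 (hTv q hq.1)
      rw [if_pos hvy, if_neg (fun h => ((mZ y).1 h).2.1 hvy), h0]
    · by_cases h0 : dg A T y = 0
      · rw [if_pos ((mZ y).2 ⟨hy.1, hvy, h0⟩), if_neg hvy, h0]
      · rw [if_neg (fun h => h0 ((mZ y).1 h).2.2), if_neg hvy]; omega
  have hsum := Finset.sum_congr rfl hkind
  rw [Finset.sum_add_distrib, Finset.sum_add_distrib, ← Finset.card_filter, ← Finset.card_filter,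
    ← Finset.card_eq_sum_ones] at hsum
  have g1 : (nb A H p).filter (fun y => y ∈ Zs A H v) = nb A (Zs A H v) p := by
    ext y; rw [Finset.mem_filter, mem_nb, mem_nb]
    exact ⟨fun h => ⟨h.2, h.1.2⟩, fun h => ⟨⟨((mZ y).1 h.1).1, h.2⟩, h.1⟩⟩
  have g2 : (nb A H p).filter (fun y => A v y) = nb A T p := by
    ext y; rw [Finset.mem_filter, mem_nb, mem_nb, mT]; tauto
  rw [g1, g2] at hsum
  change dg A (Zs A H v) p + dg A T p + _ = dg A H p at hsum
  have := h4 p hp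
  omega

theorem Z_card (hA : Good A) {H : Finset V} (hH : H.card = 19) (h4 : ∀ x ∈ H, dg A H x = 4)
    {v : V} (hv : v ∉ H) (hv3 : dg A H v = 3) : (Zs A H v).card = 4 := by
  obtain ⟨T, hT⟩ : ∃ T, T = nb A H v := ⟨_, rfl⟩
  have mT : ∀ x, x ∈ T ↔ x ∈ H ∧ A v x := fun x => by rw [hT, mem_nb]
  have mZ : ∀ x, x ∈ Zs A H v ↔ x ∈ H ∧ ¬ A v x ∧ dg A T x = 0 := fun x => by rw [hT, mem_Zs]
  have hTc : T.card = 3 := by rw [hT]; exact hv3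
  have hTv : ∀ q ∈ T, A v q := fun q hq => ((mT q).1 hq).2
  have hkind : ∀ y ∈ H, (if y ∈ Zs A H v then 1 else 0) + (if A v y then 1 else 0)
      + dg A T y = 1 := by
    intro y hy
    have h1 := dg_le_one hA hTv (x := y) (fun h => hv (h ▸ hy))
    by_cases hvy : A v y
    · have h0 : dg A T y = 0 := by
        rw [dg, Finset.card_eq_zero, Finset.eq_empty_iff_forall_notMem]
        intro q hq
        rw [mem_nb] at hq
        exact hA.tri hvy hq.2 (hTv q hq.1)
      rw [if_pos hvy, if_neg (fun h => ((mZ y).1 h).2.1 hvy), h0]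
    · by_cases h0 : dg A T y = 0
      · rw [if_pos ((mZ y).2 ⟨hy, hvy, h0⟩), if_neg hvy, h0]
      · rw [if_neg (fun h => h0 ((mZ y).1 h).2.2), if_neg hvy]; omega
  have hsum := Finset.sum_congr rfl hkind
  rw [Finset.sum_add_distrib, Finset.sum_add_distrib, ← Finset.card_filter, ← Finset.card_filter,
    ← Finset.card_eq_sum_ones, dg_swap hA, Finset.sum_congr rfl (fun x hx => h4 x ((mT x).1 hx).1),
    Finset.sum_const, hTc, smul_eq_mul] at hsum
  have g1 : H.filter (fun y => y ∈ Zs A H v) = Zs A H v := by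
    ext y; rw [Finset.mem_filter]
    exact ⟨fun h => h.2, fun h => ⟨((mZ y).1 h).1, h⟩⟩
  rw [g1] at hsum
  change _ + dg A H v + _ = _ at hsum
  omega

theorem Z_far (hA : Good A) {H : Finset V} (hH : H.card = 19) (h4 : ∀ x ∈ H, dg A H x = 4)
    {v z : V} (hv : v ∉ H) (hv3 : dg A H v = 3) (hz : z ∈ Zs A H v) :
    (∀ w ∈ Fs A H z, w ∈ Zs A H v) ∧ 0 < (Fs A H z).card := by
  have hzz := mem_Zs.1 hz
  have hone := fun p hp hvp => Z_one hA hH h4 (v := v) (p := p) hv hv3 hp hvp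
  have h1 := hone z hzz.1 hzz.2.1
  have hsub : (Zs A H v).erase z \ nb A (Zs A H v) z ⊆ Fs A H z := by
    intro w hw
    rw [Finset.mem_sdiff, Finset.mem_erase, mem_nb] at hw
    have hww := mem_Zs.1 hw.1.2
    refine mem_Fs.2 ⟨hww.1, hw.1.1, fun h => hw.2 ⟨hw.1.2, h⟩, fun c hc h2 h3 => ?_⟩
    have hvc : ¬ A v c := fun h => dg_zero hzz.2.2 c (mem_nb.2 ⟨hc, h⟩) h2
    have h5 := hone c hc hvc
    exact hw.1.1 (Finset.card_le_one.1 (le_of_eq h5) w (mem_nb.2 ⟨hw.1.2, hA.symm h3⟩) z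
      (mem_nb.2 ⟨hz, hA.symm h2⟩))
  have hc : 2 ≤ ((Zs A H v).erase z \ nb A (Zs A H v) z).card := by
    have := Finset.le_card_sdiff (nb A (Zs A H v) z) ((Zs A H v).erase z)
    rw [Finset.card_erase_of_mem hz, Z_card hA hH h4 hv hv3] at this
    unfold dg at h1
    omega
  have h2 := Fs_card hA hH h4 hzz.1
  have heq := Finset.eq_of_subset_of_card_le hsub (by omega)
  refine ⟨fun w hw => ?_, by rw [← heq]; omega⟩
  rw [← heq, Finset.mem_sdiff, Finset.mem_erase] at hw
  exact hw.1.2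

theorem N3 (hA : Good A) {H : Finset V} (hH : H.card = 19) (h4 : ∀ x ∈ H, dg A H x = 4)
    {v w : V} (hv : v ∉ H) (hv3 : dg A H v = 3) (hw : w ∉ H) (hw3 : dg A H w = 3)
    (hd : ∀ x ∈ H, A v x → A w x → False) : False := by
  obtain ⟨T, hT⟩ : ∃ T, T = nb A H w := ⟨_, rfl⟩
  have mT : ∀ x, x ∈ T ↔ x ∈ H ∧ A w x := fun x => by rw [hT, mem_nb]
  have hTc : T.card = 3 := by rw [hT]; exact hw3
  have hone := fun p hp hvp => Z_one hA hH h4 (v := v) (p := p) hv hv3 hp hvp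
  have hfar := fun z hz => Z_far hA hH h4 (v := v) (z := z) hv hv3 hz
  have hZc := Z_card hA hH h4 hv hv3
  have mZ : ∀ {z}, z ∈ Zs A H v → z ∈ H ∧ ¬ A v z ∧ dg A (nb A H v) z = 0 := fun h => mem_Zs.1 h
  have hTZ : ∀ t ∈ T, t ∉ Zs A H v := by
    intro t ht htZ
    have hTs : T ⊆ Zs A H v := by
      intro y hy
      by_cases hyt : y = t
      · rw [hyt]; exact htZ
      · rw [mT] at ht hy
        exact (hfar t htZ).1 y (T_far hA hw ht.1 hy.1 ht.2 hy.2 hyt)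
    obtain ⟨a, ha, b, hb, hab⟩ := two_of (T := T) (by omega)
    have hn : ∀ a ∈ T, ∃ n ∈ Zs A H v \ T, A a n := by
      intro a ha
      have haZ := mZ (hTs ha)
      obtain ⟨n, hn, han⟩ := dg_pos (A := A) (P := Zs A H v) (x := a) (by
        rw [hone a haZ.1 haZ.2.1]; norm_num)
      exact ⟨n, Finset.mem_sdiff.2 ⟨hn, fun h => hA.tri ((mT a).1 ha).2 han ((mT n).1 h).2⟩, han⟩
    obtain ⟨n, hn1, han⟩ := hn a ha
    obtain ⟨m, hm1, hbm⟩ := hn b hb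
    have hcc := Finset.card_sdiff_add_card_eq_card hTs
    have : n = m := Finset.card_le_one.1 (by omega) n hn1 m hm1
    subst this
    have hnZ := mZ (Finset.mem_sdiff.1 hn1).1
    exact hab (Finset.card_le_one.1 (le_of_eq (hone n hnZ.1 hnZ.2.1)) a
      (mem_nb.2 ⟨hTs ha, hA.symm han⟩) b (mem_nb.2 ⟨hTs hb, hA.symm hbm⟩))
  have hsum : ∑ z ∈ Zs A H v, dg A T z = 3 := by
    rw [dg_swap hA, Finset.sum_congr rfl (fun t ht => hone t ((mT t).1 ht).1
      (fun h => hd t ((mT t).1 ht).1 h ((mT t).1 ht).2)), Finset.sum_const, hTc, smul_eq_mul]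
  obtain ⟨z, hz, hz0, hz1⟩ := uniq (T := Zs A H v) (n := 3) hZc (f := dg A T)
    (fun x hx => dg_le_one hA (fun q hq => ((mT q).1 hq).2) (fun h => hw (h ▸ (mZ hx).1))) hsum
  have hzw : z ∈ Zs A H w := mem_Zs.2 ⟨(mZ hz).1, fun h => hTZ z ((mT z).2 ⟨(mZ hz).1, h⟩) hz, hT ▸ hz0⟩
  obtain ⟨y, hy⟩ := Finset.card_pos.1 (hfar z hz).2
  have h1 := hz1 y ((hfar z hz).1 y hy) (mem_Fs.1 hy).2.1
  have h2 := (mem_Zs.1 ((Z_far hA hH h4 hw hw3 hzw).1 y hy)).2.2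
  rw [← hT] at h2
  omega

theorem range22 (hA : Good A) {S : Finset V} (hS : S.card = 22) (hE : E A S = 94) :
    ∀ x ∈ S, 3 ≤ dg A S x ∧ dg A S x ≤ 5 := by
  have h3 : ∀ x ∈ S, 3 ≤ dg A S x := fun v hv => by
    have := del hA (B21 hA) hS hv
    omega
  intro x hx
  refine ⟨h3 x hx, ?_⟩
  by_contra h5
  have hb := (ball hA hx).1
  obtain ⟨T, hT⟩ : ∃ T, T = (nb A S x).filter (fun y => dg A S y = 3) := ⟨_, rfl⟩
  have mT : ∀ y, y ∈ T ↔ (y ∈ S ∧ A x y) ∧ dg A S y = 3 := fun y => by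
    rw [hT, Finset.mem_filter, mem_nb]
  have hc : 4 * dg A S x ≤ ∑ y ∈ nb A S x, dg A S y + T.card := by
    rw [hT, Finset.card_filter, ← Finset.sum_add_distrib, mul_comm, dg, ← smul_eq_mul]
    refine Finset.card_nsmul_le_sum _ _ _ fun y hy => ?_
    have := h3 y (mem_nb.1 hy).1
    split_ifs <;> omega
  have hD := ball_low hA hx 3 (fun y hy _ => h3 y hy)
  obtain ⟨U, hUT, hU⟩ := Finset.exists_subset_card_eq (show 3 ≤ T.card by omega)
  have hUS : U ⊆ S := fun y hy => ((mT y).1 (hUT hy)).1.1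
  have hUx : ∀ y ∈ U, A x y := fun y hy => ((mT y).1 (hUT hy)).1.2
  obtain ⟨d1, d2⟩ := E_del3 hA hUS (fun y hy => ((mT y).1 (hUT hy)).2)
    (fun a ha b hb hab => hA.tri (hUx a ha) hab (hUx b hb))
  have hr := (B19 hA (S \ U) (by omega)).2 (by omega)
  have hxU : x ∈ S \ U := Finset.mem_sdiff.2 ⟨hx, fun h => hA.irr (hUx x h)⟩
  have e1 := hr x hxU
  have e2 := dg_sdiff (A := A) hUS x
  have e3 : dg A U x = U.card := by rw [dg, nb, Finset.filter_true_of_mem hUx]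
  obtain ⟨t, ht⟩ := Finset.card_pos.1 (show 0 < (T \ U).card by
    have := Finset.le_card_sdiff U T; omega)
  rw [Finset.mem_sdiff, mT] at ht
  have e4 := hr t (Finset.mem_sdiff.2 ⟨ht.1.1.1, ht.2⟩)
  have e5 := dg_mono (A := A) (Finset.sdiff_subset (s := S) (t := U)) t
  omega

theorem star22 (hA : Good A) {S : Finset V} (hS : S.card = 22) (hE : E A S = 94) :
    ∃ x ∈ S, dg A S x = 5 ∧ (∀ y ∈ S, A x y → 4 ≤ dg A S y) ∧
      ∃ y ∈ S, A x y ∧ dg A S y = 5 := by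
  have h35 := range22 hA hS hE
  by_contra hno
  push Not at hno
  have hns : ∀ x ∈ S, dg A S x = 5 → (∀ y ∈ S, A x y → dg A S y ≠ 3) →
      ∀ y ∈ S, A x y → dg A S y = 4 := by
    intro x hx h5 h3 y hy hxy
    have h4 : ∀ y ∈ S, A x y → 4 ≤ dg A S y := fun y hy hxy => by
      have := h35 y hy
      have := h3 y hy hxy
      omega
    have := hno x hx h5 h4 y hy hxy
    have := h35 y hy
    have := h4 y hy hxy
    omega
  have hi : ∀ a ∈ D A S 3, ∀ b ∈ D A S 3, ¬ A a b := by
    intro a ha b hb hab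
    rw [mem_D] at ha hb
    have hba : b ≠ a := by rintro rfl; exact hA.irr hab
    have hb' : b ∈ S.erase a := Finset.mem_erase.2 ⟨hba, hb.1⟩
    have e1 := E_erase hA ha.1
    have e2 := E_erase hA hb'
    have e3 := dg_er_adj ha.1 (hA.symm hab)
    have := (B20 hA _ (card_er (card_er hS ha.1) hb')).1
    omega
  have hsub : D A S 3 ⊆ S := Finset.filter_subset _ _
  have h3 : ∀ t ∈ D A S 3, dg A S t = 3 := fun t ht => (mem_D.1 ht).2
  have hn3 : (D A S 3).card ≤ 3 := by
    by_contra hc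
    obtain ⟨U, hUT, hU⟩ := Finset.exists_subset_card_eq (show 4 ≤ (D A S 3).card by omega)
    obtain ⟨d1, d2⟩ := E_del3 hA (hUT.trans hsub) (fun y hy => h3 y (hUT hy))
      (fun a ha b hb => hi a (hUT ha) b (hUT hb))
    have := B18 hA (S \ U) (by omega)
    omega
  have hcase : (D A S 3).card = 0 ∨ (D A S 3).card = 1 ∨ (D A S 3).card = 2 ∨ (D A S 3).card = 3 := by
    omega
  rcases hcase with h0 | h1 | h2 | h3'
  · rw [Finset.card_eq_zero, Finset.eq_empty_iff_forall_notMem] at h0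
    have hne : ∀ x ∈ S, dg A S x ≠ 3 := fun x hx h => h0 x (mem_D.2 ⟨hx, h⟩)
    refine N0 hA hS hE (fun x hx => ?_) (fun p hp => ?_)
    · have := h35 x hx
      have := hne x hx
      omega
    · rw [mem_D] at hp
      rw [dg_all (S := S) (L := D A S 4) (Finset.filter_subset _ _) (fun y hy hpy => mem_D.2
        ⟨hy, hns p hp.1 hp.2 (fun y hy _ => hne y hy) y hy hpy⟩)]
      exact hp.2
  · obtain ⟨v, hv⟩ := Finset.card_eq_one.1 h1
    have hvm : v ∈ D A S 3 := by rw [hv]; simp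
    have hvu : ∀ x ∈ S, dg A S x = 3 → x = v := fun x hx h => by
      have : x ∈ D A S 3 := mem_D.2 ⟨hx, h⟩
      rw [hv] at this; simpa using this
    rw [mem_D] at hvm
    exact N1 hA hS hE h35 hvm.1 hvm.2 hvu (fun x hx h5 hxv => hns x hx h5
      (fun y hy hxy h => hxv (hvu y hy h ▸ hxy)))
  · exact N2 hA hS hE h35 h2 hi (fun x hx h5 h0 => hns x hx h5
      (fun y hy hxy h => dg_zero h0 y (mem_D.2 ⟨hy, h⟩) hxy))
  · obtain ⟨d1, d2⟩ := E_del3 hA hsub h3 hi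
    have hr := (B19 hA (S \ D A S 3) (by omega)).2 (by omega)
    obtain ⟨v, hv, w, hw, hvw⟩ := two_of (T := D A S 3) (by omega)
    have hd : ∀ t ∈ D A S 3, dg A (S \ D A S 3) t = 3 := fun t ht => by
      rw [dg_all Finset.sdiff_subset (fun y hy hty => Finset.mem_sdiff.2
        ⟨hy, fun h => hi t ht y h hty⟩)]
      exact h3 t ht
    refine N3 hA (by omega) hr (v := v) (w := w) (fun h => (Finset.mem_sdiff.1 h).2 hv) (hd v hv)
      (fun h => (Finset.mem_sdiff.1 h).2 hw) (hd w hw) (fun x hx h1 h2 => ?_)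
    have e1 := hr x hx
    have e2 := dg_sdiff (A := A) hsub x
    have e3 := h35 x (Finset.mem_sdiff.1 hx).1
    exact hvw (Finset.card_le_one.1 (show dg A (D A S 3) x ≤ 1 by omega) v
      (mem_nb.2 ⟨hv, hA.symm h1⟩) w (mem_nb.2 ⟨hw, hA.symm h2⟩))

theorem good_of {V : Type*} {G : SimpleGraph V} (hg : GirthAtLeast5 G) : Good G.Adj where
  symm h := SimpleGraph.Adj.symm h
  irr h := G.loopless.irrefl _ h
  tri := by
    intro a b c h1 h2 h3
    have hw := hg (Walk.cons h1 (Walk.cons h2 (Walk.cons h3.symm Walk.nil))) (by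
      rw [Walk.cons_isCycle_iff]
      have := h1.ne; have := h2.ne; have := h3.ne
      have := h1.ne'; have := h2.ne'; have := h3.ne'
      constructor
      · simp [Walk.cons_isPath_iff, *]
      · simp [*])
    simp at hw
  c4 := by
    intro a b c d h1 h2 h3 h4 hab
    by_contra hcd
    have hw := hg (Walk.cons h1 (Walk.cons h3.symm (Walk.cons h4 (Walk.cons h2.symm Walk.nil)))) (by
      rw [Walk.cons_isCycle_iff]
      have := h1.ne; have := h2.ne; have := h3.ne; have := h4.ne
      have := h1.ne'; have := h2.ne'; have := h3.ne'; have := h4.ne'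
      have := hab.symm; have : d ≠ c := fun h => hcd h.symm
      constructor
      · simp [Walk.cons_isPath_iff, *]
      · simp [*])
    simp at hw

theorem dg_deg {n : ℕ} (G : SimpleGraph (Fin n)) [DecidableRel G.Adj] (x : Fin n) :
    dg G.Adj Finset.univ x = G.degree x := by
  rw [dg, ← G.card_neighborFinset_eq_degree]
  congr 1
  ext y
  simp [mem_nb]


end

end Girth

theorem stmt9 (G : SimpleGraph (Fin 22)) [DecidableRel G.Adj]
    (hg : GirthAtLeast5 G) (he : G.edgeFinset.card = 47) :
    ((G.minDegree, G.maxDegree) = (3, 5) ∨ (G.minDegree, G.maxDegree) = (4, 5)) ∧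
    HasEmbeddedStar G 5 ![4, 3, 3, 3, 3] := by
  have hA := Girth.good_of hg
  have hS : (Finset.univ : Finset (Fin 22)).card = 22 := by simp
  have hd := Girth.dg_deg G
  have hE : Girth.E G.Adj Finset.univ = 94 := by
    unfold Girth.E
    rw [Finset.sum_congr rfl (fun x _ => hd x), G.sum_degrees_eq_twice_card_edges, he]
  have h35 := Girth.range22 hA hS hE
  obtain ⟨x, -, hx5, hx4, y, -, hxy, hy5⟩ := Girth.star22 hA hS hE
  obtain ⟨u, -, hu⟩ := Girth.exlt (A := G.Adj) (S := Finset.univ) (k := 5) (by rw [hE, hS]; norm_num)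
  simp only [hd, Finset.mem_univ, true_implies] at h35 hx5 hx4 hy5 hu
  constructor
  · have m1 : G.maxDegree = 5 := le_antisymm (G.maxDegree_le_of_forall_degree_le 5 fun v => (h35 v).2)
      (hx5 ▸ G.degree_le_maxDegree x)
    have m2 : 3 ≤ G.minDegree := G.le_minDegree_of_forall_le_degree 3 fun v => (h35 v).1
    have m3 : G.minDegree ≤ 4 := (G.minDegree_le_degree u).trans (by omega)
    rw [m1]
    have : G.minDegree = 3 ∨ G.minDegree = 4 := by omega
    rcases this with h | h <;> rw [h] <;> simp
  · have hc : ((G.neighborFinset x).erase y).card = 4 := by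
      rw [Finset.card_erase_of_mem (by simpa using hxy), G.card_neighborFinset_eq_degree, hx5]
    let e := ((G.neighborFinset x).erase y).orderEmbOfFin hc
    have hem : ∀ i, e i ≠ y ∧ G.Adj x (e i) := fun i => by
      have := Finset.orderEmbOfFin_mem _ hc i
      rwa [Finset.mem_erase, G.mem_neighborFinset] at this
    refine ⟨x, Fin.cons y e, hx5, ?_, ?_, ?_⟩
    · rw [Fin.cons_injective_iff]
      exact ⟨by rintro ⟨i, hi⟩; exact (hem i).1 hi, e.injective⟩
    · intro i
      refine Fin.cases ?_ (fun j => ?_) i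
      · simpa using hxy
      · simpa using (hem j).2
    · intro i
      refine Fin.cases ?_ (fun j => ?_) i
      · rw [Fin.cons_zero]; exact hy5.ge
      · have h1 := hx4 (e j) (hem j).2
        have h2 : (![4, 3, 3, 3, 3] : Fin 5 → ℕ) j.succ = 3 := by fin_cases j <;> rfl
        rw [h2, Fin.cons_succ]
        exact h1
end
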